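/- Suppose (A1)-(A3) hold, all coordinates of the mean vector M are nonnegative, and exactly one coordinate of M is zero, i.e. Λ(M) = {i} for some 1 ≤ i ≤ d. Then: (i) the function h_M(x) = x^i − E_x(S^i(τ)) is strictly positive and harmonic for (Z(t)); (ii) every sequence x_n ∈ ℤ_+^d with |x_n| → ∞ and x_n/|x_n| → M/|M| is fundamental for (Z(t)), and for every x ∈ ℤ_+^d, lim_n G(x,x_n)/G(x_0,x_n) = h_M(x)/h_M(x_0). -/

import Mathlib

open Filter Topology

attribute [local instance] Classical.propDecidable

noncomputable section

variable {V : Type*} [AddCommGroup V]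

/-- `n`-step transition kernel of the random walk with step distribution `μ`,
killed upon leaving the set `A` : `kern μ A n x y = P_x(S n = y, τ_A > n)`,
where `τ_A` is the first exit time from `A`. -/
def kern (μ : V → ℝ) (A : Set V) : ℕ → V → V → ℝ
  | 0 => fun x y => if x = y ∧ x ∈ A then 1 else 0
  | n + 1 => fun x y => ∑' z : V, (if x ∈ A then μ (z - x) else 0) * kern μ A n z y

/-- Green function of the walk killed outside `A`. -/
def green (μ : V → ℝ) (A : Set V) (x y : V) : ℝ :=
  ∑' n : ℕ, kern μ A n x y

/-- `E_x [ g(S τ) ; S τ ∈ B, τ < ∞ ]`, where `τ` is the first exit time from `A`. -/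
def exitExp (μ : V → ℝ) (A B : Set V) (g : V → ℝ) (x : V) : ℝ :=
  ∑' n : ℕ, ∑' z : V, kern μ A n x z *
    ∑' y : V, (if y ∉ A ∧ y ∈ B then μ (y - z) else 0) * g y

/-- `ℝ≥0∞`-valued version of `exitExp`. -/
def exitExpE (μ : V → ℝ) (A B : Set V) (g : V → ℝ) (x : V) : ENNReal :=
  ∑' n : ℕ, ∑' z : V, ENNReal.ofReal (kern μ A n x z) *
    ∑' y : V, ENNReal.ofReal ((if y ∉ A ∧ y ∈ B then μ (y - z) else 0) * g y)

/-- `P_x(S t = y for some t ≥ 0)` for the walk killed outside `A`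
(first passage decomposition). -/
def hitProb (μ : V → ℝ) (A : Set V) (x y : V) : ℝ :=
  (if x = y ∧ x ∈ A then 1 else 0) +
    ∑' n : ℕ, ∑' z : V, kern μ (A \ {y}) n x z * (if y ∈ A then μ (y - z) else 0)

/-- `h` is (strictly speaking, satisfies the mean value property of a) harmonic
function on `A` for the walk with step distribution `μ` killed outside `A`. -/
def HarmOn (μ : V → ℝ) (A : Set V) (h : V → ℝ) : Prop :=
  ∀ x ∈ A, h x = ∑' y : V, if y ∈ A then μ (y - x) * h y else 0

/-- Irreducibility of the walk killed outside `A`. -/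
def Irred (μ : V → ℝ) (A : Set V) : Prop :=
  ∀ x ∈ A, ∀ x' ∈ A, ∃ (k : ℕ) (c : ℕ → V), c 0 = x ∧ c k = x' ∧
    (∀ j ≤ k, c j ∈ A) ∧ ∀ j < k, 0 < μ (c (j + 1) - c j)

/-- A sequence `xs` is fundamental for the walk killed outside `A` :
the Martin kernels `G(x, xs n)/G(x₀, xs n)` converge for every `x ∈ A`. -/
def Fundamental (μ : V → ℝ) (A : Set V) (x₀ : V) (xs : ℕ → V) : Prop :=
  ∀ x ∈ A, ∃ L : ℝ,
    Tendsto (fun n => green μ A x (xs n) / green μ A x₀ (xs n)) atTop (𝓝 L)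

/-- ℓ¹-norm of an integer vector. -/
def znorm {ι : Type*} [Fintype ι] (x : ι → ℤ) : ℝ := ∑ i, |(x i : ℝ)|

/-- ℓ¹-norm of a real vector. -/
def rnorm {ι : Type*} [Fintype ι] (q : ι → ℝ) : ℝ := ∑ i, |q i|

variable {d : ℕ}

/-- `ℤ^{Λ,d}_+ = {x ∈ ℤ^d : xⁱ > 0 for all i ∈ Λ}`. -/
def posDom (Λ : Set (Fin d)) : Set (Fin d → ℤ) := {x | ∀ i ∈ Λ, 0 < x i}

/-- `ℤ^d_+ = {x ∈ ℤ^d : xⁱ > 0 for all i}`. -/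
def posAll : Set (Fin d → ℤ) := {x | ∀ i, 0 < x i}

/-- `a · z` for `a ∈ ℝ^d`, `z ∈ ℤ^d`. -/
def dotZ (a : Fin d → ℝ) (z : Fin d → ℤ) : ℝ := ∑ i, a i * (z i : ℝ)

/-- `a · q` for `a, q ∈ ℝ^d`. -/
def dotR (a q : Fin d → ℝ) : ℝ := ∑ i, a i * q i

/-- jump generating function `φ(a) = Σ_z μ(z) exp(a·z)` (valued in `ℝ≥0∞`). -/
def phiE (μ : (Fin d → ℤ) → ℝ) (a : Fin d → ℝ) : ENNReal :=
  ∑' z : Fin d → ℤ, ENNReal.ofReal (μ z * Real.exp (dotZ a z))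

/-- `D = {a ∈ ℝ^d : φ(a) ≤ 1}`. -/
def Dset (μ : (Fin d → ℤ) → ℝ) : Set (Fin d → ℝ) := {a | phiE μ a ≤ 1}

/-- mean vector `M = Σ_z μ(z) z`. -/
def Mvec (μ : (Fin d → ℤ) → ℝ) : Fin d → ℝ := fun i => ∑' z : Fin d → ℤ, μ z * (z i : ℝ)

/-- `Λ(M) = {i : Mⁱ = 0}`. -/
def LambdaM (μ : (Fin d → ℤ) → ℝ) : Set (Fin d) := {i | Mvec μ i = 0}

/-- Assumption (A1) : irreducibility on every `ℤ^{Λ,d}_+`. -/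
def A1 (μ : (Fin d → ℤ) → ℝ) : Prop := ∀ Λ : Set (Fin d), Irred μ (posDom Λ)

/-- Assumption (A2) : `φ` is finite on a neighborhood of the set `D`. -/
def A2 (μ : (Fin d → ℤ) → ℝ) : Prop :=
  ∃ U : Set (Fin d → ℝ), IsOpen U ∧ Dset μ ⊆ U ∧ ∀ a ∈ U, phiE μ a ≠ ⊤

/-- Assumption (A3) : `M ≠ 0`. -/
def A3 (μ : (Fin d → ℤ) → ℝ) : Prop := Mvec μ ≠ 0

/-- projection `x ↦ x^Λ`. -/
def projL (Λ : Set (Fin d)) (x : Fin d → ℤ) : ↥Λ → ℤ := fun i => x (i : Fin d)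

/-- jump distribution `μ_Λ(v) = Σ_{x : x^Λ = v} μ(x)` of the projected walk. -/
def muL (μ : (Fin d → ℤ) → ℝ) (Λ : Set (Fin d)) (v : ↥Λ → ℤ) : ℝ :=
  ∑' x : Fin d → ℤ, if projL Λ x = v then μ x else 0

/-- `ℤ^Λ_+`. -/
def posL (Λ : Set (Fin d)) : Set (↥Λ → ℤ) := {u | ∀ i, 0 < u i}

end

/-- `h_M(x) = xⁱ − E_x(Sⁱ(τ))`, `τ` the first exit time from `ℤ^d_+`. -/
noncomputable def hM2 {d : ℕ} (μ : (Fin d → ℤ) → ℝ) (i₀ : Fin d) (x : Fin d → ℤ) : ℝ :=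
  (x i₀ : ℝ) - exitExp μ posAll Set.univ (fun y => (y i₀ : ℝ)) x

open scoped ENNReal

namespace KilledWalk

section Kernels

variable {V : Type*}

/-- The operator `f ↦ (x ↦ ∑ k(x,y) f(y))` attached to a nonnegative kernel. -/
noncomputable def kop (k : V → V → ℝ≥0∞) : Module.End ℝ≥0∞ (V → ℝ≥0∞) where
  toFun f x := ∑' y, k x y * f y
  map_add' f g := by
    funext x
    simp [mul_add, ENNReal.tsum_add]
  map_smul' c f := by
    funext x
    simp only [Pi.smul_apply, smul_eq_mul, RingHom.id_apply, ← ENNReal.tsum_mul_left]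
    exact tsum_congr fun y => by ring

lemma kop_apply (k : V → V → ℝ≥0∞) (f : V → ℝ≥0∞) (x : V) :
    kop k f x = ∑' y, k x y * f y := rfl

/-- Operators given by a nonnegative kernel. -/
def IsKer (L : Module.End ℝ≥0∞ (V → ℝ≥0∞)) : Prop := ∃ k, L = kop k

lemma isKer_kop (k : V → V → ℝ≥0∞) : IsKer (kop k) := ⟨k, rfl⟩

lemma IsKer.one : IsKer (1 : Module.End ℝ≥0∞ (V → ℝ≥0∞)) := by
  refine ⟨fun x y => if y = x then 1 else 0, ?_⟩
  ext f x
  simp [kop_apply]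

lemma IsKer.mul {L L' : Module.End ℝ≥0∞ (V → ℝ≥0∞)} (h : IsKer L) (h' : IsKer L') :
    IsKer (L * L') := by
  obtain ⟨k, rfl⟩ := h
  obtain ⟨l, rfl⟩ := h'
  refine ⟨fun x y => ∑' z, k x z * l z y, ?_⟩
  refine LinearMap.ext fun f => funext fun x => ?_
  simp only [Module.End.mul_apply, kop_apply, ← ENNReal.tsum_mul_left, ← ENNReal.tsum_mul_right]
  rw [ENNReal.tsum_comm]
  simp only [mul_assoc]

lemma IsKer.pow {L : Module.End ℝ≥0∞ (V → ℝ≥0∞)} (h : IsKer L) (n : ℕ) : IsKer (L ^ n) := by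
  induction n with
  | zero => simpa using IsKer.one
  | succ n ih => rw [pow_succ]; exact ih.mul h

lemma IsKer.mono {L : Module.End ℝ≥0∞ (V → ℝ≥0∞)} (h : IsKer L) {f g : V → ℝ≥0∞}
    (hfg : f ≤ g) : L f ≤ L g := by
  obtain ⟨k, rfl⟩ := h
  intro x
  exact ENNReal.tsum_le_tsum fun y => by gcongr; exact hfg y

lemma IsKer.tsum {L : Module.End ℝ≥0∞ (V → ℝ≥0∞)} (h : IsKer L) {ι : Type*}
    (f : ι → V → ℝ≥0∞) (x : V) :
    L (fun x => ∑' i, f i x) x = ∑' i, L (f i) x := by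
  obtain ⟨k, rfl⟩ := h
  simp only [kop_apply, ← ENNReal.tsum_mul_left]
  exact ENNReal.tsum_comm

lemma IsKer.apply_eq [DecidableEq V] {L : Module.End ℝ≥0∞ (V → ℝ≥0∞)} (h : IsKer L) (f : V → ℝ≥0∞) (x : V) :
    L f x = ∑' z, L (Pi.single z 1) x * f z := by
  have hf : f = fun x => ∑' z, (f z • (Pi.single z 1 : V → ℝ≥0∞)) x := by
    funext x
    simp only [Pi.smul_apply, smul_eq_mul]
    rw [tsum_eq_single x]
    · simp
    · intro b hb
      simp [hb.symm]
  conv_lhs => rw [hf]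
  rw [h.tsum]
  exact tsum_congr fun z => by rw [map_smul, Pi.smul_apply, smul_eq_mul, mul_comm]

lemma kop_single [DecidableEq V] (k : V → V → ℝ≥0∞) (x y : V) : kop k (Pi.single y 1) x = k x y := by
  rw [kop_apply, tsum_eq_single y]
  · simp
  · intro b hb
    simp [hb]

lemma IsKer.ext [DecidableEq V] {L L' : Module.End ℝ≥0∞ (V → ℝ≥0∞)} (h : IsKer L) (h' : IsKer L')
    (H : ∀ x y, L (Pi.single y 1) x = L' (Pi.single y 1) x) : L = L' := by
  refine LinearMap.ext fun f => funext fun x => ?_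
  rw [h.apply_eq, h'.apply_eq]
  simp only [H]

lemma toReal_apply_eq [DecidableEq V] {L : Module.End ℝ≥0∞ (V → ℝ≥0∞)} (hL : IsKer L) {f : V → ℝ≥0∞} {x : V}
    (hf : L f x ≠ ⊤) :
    HasSum (fun z => (L (Pi.single z 1) x).toReal * (f z).toReal) (L f x).toReal := by
  rw [hL.apply_eq] at hf ⊢
  have h2 : ∀ z, L (Pi.single z 1) x * f z ≠ ⊤ := fun z => ENNReal.ne_top_of_tsum_ne_top hf z
  rw [ENNReal.tsum_toReal_eq h2]
  have := (ENNReal.summable_toReal hf).hasSum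
  simpa only [ENNReal.toReal_mul] using this

lemma pow_le_of_superharmonic {L : Module.End ℝ≥0∞ (V → ℝ≥0∞)} (h : IsKer L) {f : V → ℝ≥0∞}
    (hf : L f ≤ f) (n : ℕ) : (L ^ n) f ≤ f := by
  induction n with
  | zero => simp
  | succ n ih => rw [pow_succ, Module.End.mul_apply]; exact ((h.pow n).mono hf).trans ih

lemma pow_le_smul_of_le {L : Module.End ℝ≥0∞ (V → ℝ≥0∞)} (h : IsKer L) {f : V → ℝ≥0∞}
    {q : ℝ≥0∞} (hf : L f ≤ q • f) (n : ℕ) : (L ^ n) f ≤ q ^ n • f := by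
  induction n with
  | zero => simp
  | succ n ih =>
    rw [pow_succ, Module.End.mul_apply]
    refine ((h.pow n).mono hf).trans ?_
    rw [map_smul, pow_succ', mul_smul]
    exact fun x => by simpa using mul_le_mul_right (ih x) q

lemma pow_le_pow_of_le {L L' : Module.End ℝ≥0∞ (V → ℝ≥0∞)} (h' : IsKer L')
    (H : ∀ f, L f ≤ L' f) (n : ℕ) (f : V → ℝ≥0∞) : (L ^ n) f ≤ (L' ^ n) f := by
  induction n generalizing f with
  | zero => simp
  | succ n ih =>
    rw [pow_succ, pow_succ, Module.End.mul_apply, Module.End.mul_apply]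
    exact (ih _).trans ((h'.pow n).mono (H f))

/-- The potential `∑ Lⁿ s`. -/
noncomputable def pot (L : Module.End ℝ≥0∞ (V → ℝ≥0∞)) (s : V → ℝ≥0∞) (x : V) : ℝ≥0∞ :=
  ∑' n : ℕ, (L ^ n) s x

lemma pot_mono {L : Module.End ℝ≥0∞ (V → ℝ≥0∞)} (h : IsKer L) {s s' : V → ℝ≥0∞}
    (hs : s ≤ s') : pot L s ≤ pot L s' :=
  fun x => ENNReal.tsum_le_tsum fun n => (h.pow n).mono hs x

lemma pot_le_of_le {L L' : Module.End ℝ≥0∞ (V → ℝ≥0∞)} (h' : IsKer L')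
    (H : ∀ f, L f ≤ L' f) (s : V → ℝ≥0∞) : pot L s ≤ pot L' s :=
  fun x => ENNReal.tsum_le_tsum fun n => pow_le_pow_of_le h' H n s x

lemma pot_smul (L : Module.End ℝ≥0∞ (V → ℝ≥0∞)) (c : ℝ≥0∞) (s : V → ℝ≥0∞) :
    pot L (c • s) = c • pot L s := by
  funext x
  simp [pot, ENNReal.tsum_mul_left]

lemma pot_eq {L : Module.End ℝ≥0∞ (V → ℝ≥0∞)} (h : IsKer L) (s : V → ℝ≥0∞) :
    L (pot L s) + s = pot L s := by
  funext x
  have h1 : L (pot L s) x = ∑' n : ℕ, (L ^ (n + 1)) s x := by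
    have := h.tsum (fun n : ℕ => (L ^ n) s) x
    rw [show pot L s = fun x => ∑' n : ℕ, (L ^ n) s x from rfl, this]
    exact tsum_congr fun n => by rw [pow_succ', Module.End.mul_apply]
  rw [Pi.add_apply, h1, add_comm]
  simpa [pot] using (tsum_eq_zero_add' (f := fun n : ℕ => (L ^ n) s x) ENNReal.summable).symm

lemma telescope {L : Module.End ℝ≥0∞ (V → ℝ≥0∞)} {f s s' : V → ℝ≥0∞}
    (hf : L f + s = f + s') (n : ℕ) :
    (L ^ n) f + ∑ t ∈ Finset.range n, (L ^ t) s = f + ∑ t ∈ Finset.range n, (L ^ t) s' := by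
  induction n with
  | zero => simp
  | succ n ih =>
    rw [Finset.sum_range_succ, Finset.sum_range_succ, pow_succ, Module.End.mul_apply]
    calc (L ^ n) (L f) + (∑ t ∈ Finset.range n, (L ^ t) s + (L ^ n) s)
        = (L ^ n) (L f + s) + ∑ t ∈ Finset.range n, (L ^ t) s := by rw [map_add]; abel
      _ = _ := by
        rw [hf, map_add, add_right_comm, ih]; abel

lemma tendsto_sum_pow (L : Module.End ℝ≥0∞ (V → ℝ≥0∞)) (s : V → ℝ≥0∞) (x : V) :
    Tendsto (fun n => (∑ t ∈ Finset.range n, (L ^ t) s) x) atTop (𝓝 (pot L s x)) := by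
  simp only [Finset.sum_apply]
  exact ENNReal.tendsto_nat_tsum _

lemma add_pot_eq_of_tendsto {L : Module.End ℝ≥0∞ (V → ℝ≥0∞)} {f s : V → ℝ≥0∞}
    (hf : L f + s = f) {x : V} {l : ℝ≥0∞}
    (hl : Tendsto (fun n => (L ^ n) f x) atTop (𝓝 l)) : l + pot L s x = f x := by
  have h2 := hl.add (tendsto_sum_pow L s x)
  refine tendsto_nhds_unique h2 ?_
  have : (fun n => (L ^ n) f x + (∑ t ∈ Finset.range n, (L ^ t) s) x) = fun _ => f x := by
    funext n
    have := congrFun (telescope (s' := 0) (by simpa using hf) n) x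
    simpa using this
  rw [this]
  exact tendsto_const_nhds

lemma pot_le_of_lyapunov {L : Module.End ℝ≥0∞ (V → ℝ≥0∞)} (h : IsKer L) {f s : V → ℝ≥0∞}
    (hf : L f + s ≤ f) : pot L s ≤ f := by
  have key : ∀ n, (L ^ n) f + ∑ t ∈ Finset.range n, (L ^ t) s ≤ f := by
    intro n
    induction n with
    | zero => simp
    | succ n ih =>
      rw [Finset.sum_range_succ, pow_succ, Module.End.mul_apply]
      calc (L ^ n) (L f) + (∑ t ∈ Finset.range n, (L ^ t) s + (L ^ n) s)
          = (L ^ n) (L f + s) + ∑ t ∈ Finset.range n, (L ^ t) s := by rw [map_add]; abel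
        _ ≤ (L ^ n) f + ∑ t ∈ Finset.range n, (L ^ t) s := by
            gcongr; exact (h.pow n).mono hf
        _ ≤ f := ih
  intro x
  refine le_of_tendsto' (tendsto_sum_pow L s x) fun n => ?_
  exact le_trans (by simp) (key n x)

end Kernels

section Walk

variable {V : Type*} [AddCommGroup V] {μ : V → ℝ}

/-- One step of the walk killed outside `A`. -/
noncomputable def stepK (μ : V → ℝ) (A : Set V) : Module.End ℝ≥0∞ (V → ℝ≥0∞) :=
  kop fun x y => if x ∈ A ∧ y ∈ A then ENNReal.ofReal (μ (y - x)) else 0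

/-- One step of the walk leaving `A`. -/
noncomputable def exitK (μ : V → ℝ) (A : Set V) : Module.End ℝ≥0∞ (V → ℝ≥0∞) :=
  kop fun x y => if x ∈ A ∧ y ∉ A then ENNReal.ofReal (μ (y - x)) else 0

/-- One step of the free walk. -/
noncomputable def avg (μ : V → ℝ) (f : V → ℝ≥0∞) (x : V) : ℝ≥0∞ :=
  ∑' z, ENNReal.ofReal (μ z) * f (x + z)

lemma isKer_stepK (μ : V → ℝ) (A : Set V) : IsKer (stepK μ A) := isKer_kop _

lemma isKer_exitK (μ : V → ℝ) (A : Set V) : IsKer (exitK μ A) := isKer_kop _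

lemma stepK_apply {A : Set V} {x : V} (hx : x ∈ A) (f : V → ℝ≥0∞) :
    stepK μ A f x = ∑' z, ENNReal.ofReal (μ z) * (if x + z ∈ A then f (x + z) else 0) := by
  rw [stepK, kop_apply, ← (Equiv.addLeft x).tsum_eq]
  refine tsum_congr fun z => ?_
  by_cases h : x + z ∈ A <;> simp [h, hx]

lemma exitK_apply {A : Set V} {x : V} (hx : x ∈ A) (f : V → ℝ≥0∞) :
    exitK μ A f x = ∑' z, ENNReal.ofReal (μ z) * (if x + z ∈ A then 0 else f (x + z)) := by
  rw [exitK, kop_apply, ← (Equiv.addLeft x).tsum_eq]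
  refine tsum_congr fun z => ?_
  by_cases h : x + z ∈ A <;> simp [h, hx]

lemma stepK_of_notMem {A : Set V} {x : V} (hx : x ∉ A) (f : V → ℝ≥0∞) :
    stepK μ A f x = 0 := by
  simp [stepK, kop_apply, hx]

lemma exitK_of_notMem {A : Set V} {x : V} (hx : x ∉ A) (f : V → ℝ≥0∞) :
    exitK μ A f x = 0 := by
  simp [exitK, kop_apply, hx]

lemma stepK_add_exitK {A : Set V} {x : V} (hx : x ∈ A) (f : V → ℝ≥0∞) :
    stepK μ A f x + exitK μ A f x = avg μ f x := by
  rw [stepK_apply hx, exitK_apply hx, avg, ← ENNReal.tsum_add]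
  refine tsum_congr fun z => ?_
  by_cases h : x + z ∈ A <;> simp [h]

lemma stepK_le_avg (A : Set V) (f : V → ℝ≥0∞) : stepK μ A f ≤ avg μ f := by
  intro x
  by_cases hx : x ∈ A
  · rw [← stepK_add_exitK hx]; exact le_self_add
  · simp [stepK_of_notMem hx]

lemma exitK_le_avg (A : Set V) (f : V → ℝ≥0∞) : exitK μ A f ≤ avg μ f := by
  intro x
  by_cases hx : x ∈ A
  · rw [← stepK_add_exitK hx]; exact le_add_self
  · simp [exitK_of_notMem hx]

lemma stepK_mono_set {A B : Set V} (h : A ⊆ B) (f : V → ℝ≥0∞) : stepK μ A f ≤ stepK μ B f := by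
  intro x
  rw [stepK, stepK, kop_apply, kop_apply]
  refine ENNReal.tsum_le_tsum fun y => ?_
  gcongr
  by_cases hxy : x ∈ A ∧ y ∈ A
  · simp [hxy, h hxy.1, h hxy.2]
  · simp [hxy]

lemma stepK_congr {A : Set V} {f g : V → ℝ≥0∞} (h : ∀ x ∈ A, f x = g x) :
    stepK μ A f = stepK μ A g := by
  funext x
  by_cases hx : x ∈ A
  · rw [stepK_apply hx, stepK_apply hx]
    refine tsum_congr fun z => ?_
    by_cases hz : x + z ∈ A
    · simp [hz, h _ hz]
    · simp [hz]
  · simp [stepK_of_notMem hx]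

lemma exitK_congr {A : Set V} {f g : V → ℝ≥0∞} (h : ∀ x ∉ A, f x = g x) :
    exitK μ A f = exitK μ A g := by
  funext x
  by_cases hx : x ∈ A
  · rw [exitK_apply hx, exitK_apply hx]
    refine tsum_congr fun z => ?_
    by_cases hz : x + z ∈ A
    · simp [hz]
    · simp [hz, h _ hz]
  · simp [exitK_of_notMem hx]

lemma avg_one (hnn : ∀ z, 0 ≤ μ z) (hsum : HasSum μ 1) (c : ℝ≥0∞) (x : V) :
    avg μ (fun _ => c) x = c := by
  rw [avg, ENNReal.tsum_mul_right, ← ENNReal.ofReal_tsum_of_nonneg hnn hsum.summable,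
    hsum.tsum_eq]
  simp

lemma stepK_const_le (hnn : ∀ z, 0 ≤ μ z) (hsum : HasSum μ 1) (A : Set V) (c : ℝ≥0∞) :
    stepK μ A (fun _ => c) ≤ fun _ => c := by
  intro x
  exact (stepK_le_avg A _ x).trans (avg_one hnn hsum c x).le

lemma pow_le_const (hnn : ∀ z, 0 ≤ μ z) (hsum : HasSum μ 1) (A : Set V) {c : ℝ≥0∞}
    {f : V → ℝ≥0∞} (hf : ∀ x, f x ≤ c) (n : ℕ) (x : V) : ((stepK μ A) ^ n) f x ≤ c :=
  (((isKer_stepK μ A).pow n).mono (g := fun _ => c) hf x).trans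
    (pow_le_of_superharmonic (isKer_stepK μ A) (stepK_const_le hnn hsum A c) n x)

lemma pow_single_le_one [DecidableEq V] (hnn : ∀ z, 0 ≤ μ z) (hsum : HasSum μ 1) (A : Set V) (n : ℕ) (x y : V) :
    ((stepK μ A) ^ n) (Pi.single y 1) x ≤ 1 := by
  refine pow_le_const hnn hsum A (fun z => ?_) n x
  by_cases h : z = y
  · subst h; simp
  · simp [h]

lemma pow_of_notMem {A : Set V} {x : V} (hx : x ∉ A) {f : V → ℝ≥0∞} (hf : f x = 0) (n : ℕ) :
    ((stepK μ A) ^ n) f x = 0 := by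
  cases n with
  | zero => simpa
  | succ n => rw [pow_succ', Module.End.mul_apply, stepK_of_notMem hx]

lemma pow_single_of_notMem [DecidableEq V] {A : Set V} {x y : V} (hx : x ∉ A) (hy : y ∈ A) (n : ℕ) :
    ((stepK μ A) ^ n) (Pi.single y 1) x = 0 :=
  pow_of_notMem hx (by rw [Pi.single_eq_of_ne]; rintro rfl; exact hx hy) n

lemma kern_eq_zero_left {A : Set V} {x : V} (hx : x ∉ A) (n : ℕ) (y : V) :
    kern μ A n x y = 0 := by
  cases n <;> simp [kern, hx]

lemma kern_eq_zero_right {A : Set V} {y : V} (hy : y ∉ A) (n : ℕ) (x : V) :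
    kern μ A n x y = 0 := by
  induction n generalizing x with
  | zero =>
    have : ¬ (x = y ∧ x ∈ A) := by rintro ⟨rfl, h⟩; exact hy h
    simp [kern, this]
  | succ n ih => simp [kern, ih]

lemma kern_eq_of_mem [DecidableEq V] (hnn : ∀ z, 0 ≤ μ z) (hsum : HasSum μ 1) {A : Set V} {y : V} (hy : y ∈ A)
    (n : ℕ) (x : V) :
    kern μ A n x y = (((stepK μ A) ^ n) (Pi.single y 1) x).toReal := by
  induction n generalizing x with
  | zero =>
    by_cases h : x = y
    · subst h; simp [kern, hy]
    · simp [kern, h]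
  | succ n ih =>
    by_cases hx : x ∈ A
    · rw [pow_succ', Module.End.mul_apply, stepK, kop_apply, ENNReal.tsum_toReal_eq]
      · simp only [kern]
        refine tsum_congr fun z => ?_
        rw [ENNReal.toReal_mul, ← stepK, ih z]
        by_cases hz : z ∈ A
        · simp [hx, hz, ENNReal.toReal_ofReal (hnn _)]
        · simp [hz, pow_single_of_notMem hz hy]
      · intro z
        refine ENNReal.mul_ne_top (by split_ifs <;> simp) ?_
        exact ne_top_of_le_ne_top ENNReal.one_ne_top (pow_single_le_one hnn hsum A n z y)
    · rw [kern_eq_zero_left hx, pow_single_of_notMem hx hy, ENNReal.toReal_zero]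

lemma kern_eq [DecidableEq V] (hnn : ∀ z, 0 ≤ μ z) (hsum : HasSum μ 1) {A : Set V} {x : V} (hx : x ∈ A)
    (n : ℕ) (y : V) :
    kern μ A n x y = (((stepK μ A) ^ n) (Pi.single y 1) x).toReal := by
  by_cases hy : y ∈ A
  · exact kern_eq_of_mem hnn hsum hy n x
  · rw [kern_eq_zero_right hy]
    cases n with
    | zero =>
      have : x ≠ y := by rintro rfl; exact hy hx
      simp [this]
    | succ n =>
      have : stepK μ A (Pi.single y 1) = 0 := by
        funext w
        rw [stepK, kop_single]
        simp [hy]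
      rw [pow_succ, Module.End.mul_apply, this]
      simp

lemma green_eq [DecidableEq V] (hnn : ∀ z, 0 ≤ μ z) (hsum : HasSum μ 1) {A : Set V} {y : V} (hy : y ∈ A) (x : V) :
    green μ A x y = (pot (stepK μ A) (Pi.single y 1) x).toReal := by
  rw [green, pot, ENNReal.tsum_toReal_eq]
  · exact tsum_congr fun n => kern_eq_of_mem hnn hsum hy n x
  · intro n
    exact ne_top_of_le_ne_top ENNReal.one_ne_top (pow_single_le_one hnn hsum A n x y)

/-- Exit expectations of a difference of two nonnegative functions, as a difference of
potentials. -/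
lemma exitExp_eq (hnn : ∀ z, 0 ≤ μ z) (hsum : HasSum μ 1) {A : Set V} {x : V} (hx : x ∈ A)
    {g : V → ℝ} {gp gm : V → ℝ≥0∞} (hg : ∀ y, g y = (gp y).toReal - (gm y).toReal)
    (hep : ∀ z, exitK μ A gp z ≠ ⊤) (hem : ∀ z, exitK μ A gm z ≠ ⊤)
    (hp : pot (stepK μ A) (exitK μ A gp) x ≠ ⊤) (hm : pot (stepK μ A) (exitK μ A gm) x ≠ ⊤) :
    exitExp μ A Set.univ g x =
      (pot (stepK μ A) (exitK μ A gp) x).toReal - (pot (stepK μ A) (exitK μ A gm) x).toReal := by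
  have inner : ∀ z ∈ A, ∑' y : V, (if y ∉ A ∧ y ∈ Set.univ then μ (y - z) else 0) * g y =
      (exitK μ A gp z).toReal - (exitK μ A gm z).toReal := by
    intro z hz
    have key : ∀ f : V → ℝ≥0∞, exitK μ A f z ≠ ⊤ →
        HasSum (fun y => (if y ∉ A then μ (y - z) else 0) * (f y).toReal)
          (exitK μ A f z).toReal := by
      intro f hf
      have := toReal_apply_eq (isKer_exitK μ A) hf (x := z)
      convert this using 2 with y
      rw [exitK, kop_single]
      by_cases hy : y ∈ A <;> simp [hy, hz, ENNReal.toReal_ofReal (hnn _)]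
    rw [← ((key gp (hep z)).sub (key gm (hem z))).tsum_eq]
    refine tsum_congr fun y => ?_
    rw [hg y]
    simp [mul_sub]
  have outer : ∀ n, ∑' z : V, kern μ A n x z *
      ∑' y : V, (if y ∉ A ∧ y ∈ Set.univ then μ (y - z) else 0) * g y =
      (((stepK μ A) ^ n) (exitK μ A gp) x).toReal - (((stepK μ A) ^ n) (exitK μ A gm) x).toReal := by
    intro n
    have a1 := toReal_apply_eq ((isKer_stepK μ A).pow n) (f := exitK μ A gp) (x := x)
      (ENNReal.ne_top_of_tsum_ne_top hp n)
    have a2 := toReal_apply_eq ((isKer_stepK μ A).pow n) (f := exitK μ A gm) (x := x)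
      (ENNReal.ne_top_of_tsum_ne_top hm n)
    rw [← (a1.sub a2).tsum_eq]
    refine tsum_congr fun z => ?_
    by_cases hz : z ∈ A
    · rw [inner z hz, kern_eq hnn hsum hx, mul_sub]
    · rw [kern_eq_zero_right hz, exitK_of_notMem hz, exitK_of_notMem hz]
      simp
  rw [exitExp]
  refine (tsum_congr fun n => (by convert outer n)).trans ?_
  rw [((ENNReal.summable_toReal hp).hasSum.sub (ENNReal.summable_toReal hm).hasSum).tsum_eq,
    pot, pot, ENNReal.tsum_toReal_eq (ENNReal.ne_top_of_tsum_ne_top hp),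
    ENNReal.tsum_toReal_eq (ENNReal.ne_top_of_tsum_ne_top hm)]

end Walk

section Moments

variable {d : ℕ} {μ : (Fin d → ℤ) → ℝ} {r : ℝ}

lemma znorm_nonneg (x : Fin d → ℤ) : 0 ≤ znorm x := Finset.sum_nonneg fun _ _ => abs_nonneg _

lemma znorm_add_le (x y : Fin d → ℤ) : znorm (x + y) ≤ znorm x + znorm y := by
  simp only [znorm, ← Finset.sum_add_distrib, Pi.add_apply, Int.cast_add]
  exact Finset.sum_le_sum fun i _ => abs_add_le _ _

lemma znorm_neg (x : Fin d → ℤ) : znorm (-x) = znorm x := by simp [znorm]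

lemma znorm_sub_comm (x y : Fin d → ℤ) : znorm (x - y) = znorm (y - x) := by
  rw [← znorm_neg, neg_sub]

lemma znorm_le_add_sub (x y : Fin d → ℤ) : znorm x ≤ znorm y + znorm (x - y) := by
  simpa using znorm_add_le y (x - y)

lemma abs_coord_le (x : Fin d → ℤ) (k : Fin d) : |(x k : ℝ)| ≤ znorm x :=
  Finset.single_le_sum (f := fun i => |(x i : ℝ)|) (fun _ _ => abs_nonneg _) (Finset.mem_univ k)

/-- A step distribution with a finite exponential moment of order `r`. -/
structure ExpStep (μ : (Fin d → ℤ) → ℝ) (r : ℝ) : Prop where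
  nn : ∀ z, 0 ≤ μ z
  sum : HasSum μ 1
  pos : 0 < r
  exp : Summable fun z => μ z * Real.exp (r * znorm z)

lemma exists_expStep (hnn : ∀ z, 0 ≤ μ z) (hsum : HasSum μ 1) (hA2 : A2 μ) :
    ∃ r, ExpStep μ r := by
  obtain ⟨U, hU, hDU, hfin⟩ := hA2
  have h0 : (0 : Fin d → ℝ) ∈ U := by
    apply hDU
    simp only [Dset, Set.mem_ofPred_eq, phiE, dotZ, Pi.zero_apply, zero_mul, Finset.sum_const_zero,
      Real.exp_zero, mul_one]
    rw [← ENNReal.ofReal_tsum_of_nonneg hnn hsum.summable, hsum.tsum_eq]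
    simp
  obtain ⟨ε, hε, hball⟩ := Metric.isOpen_iff.mp hU 0 h0
  refine ⟨ε / 2, hnn, hsum, by positivity, ?_⟩
  let a : (Fin d → Bool) → Fin d → ℝ := fun s k => if s k then ε / 2 else -(ε / 2)
  have ha : ∀ s, Summable fun z => μ z * Real.exp (dotZ (a s) z) := by
    intro s
    have hs : a s ∈ U := by
      apply hball
      rw [mem_ball_zero_iff]
      refine lt_of_le_of_lt ((pi_norm_le_iff_of_nonneg (r := ε / 2) (by positivity)).mpr
        fun k => ?_) (by linarith)
      simp only [a]
      split_ifs <;> simp [abs_of_pos hε]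
    have := ENNReal.summable_toReal (hfin _ hs)
    refine this.congr fun z => ?_
    rw [ENNReal.toReal_ofReal (mul_nonneg (hnn z) (Real.exp_pos _).le)]
  refine Summable.of_nonneg_of_le (fun z => mul_nonneg (hnn z) (Real.exp_pos _).le) (fun z => ?_)
    (summable_sum fun s (_ : s ∈ Finset.univ) => ha s)
  rw [← Finset.mul_sum]
  refine mul_le_mul_of_nonneg_left ?_ (hnn z)
  have h1 : ε / 2 * znorm z = dotZ (a fun k => decide (0 ≤ z k)) z := by
    simp only [znorm, dotZ, Finset.mul_sum, a]
    refine Finset.sum_congr rfl fun k _ => ?_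
    by_cases hk : 0 ≤ z k
    · simp [hk, abs_of_nonneg (show (0 : ℝ) ≤ z k by exact_mod_cast hk)]
    · simp [hk, abs_of_neg (show (z k : ℝ) < 0 by exact_mod_cast not_le.mp hk)]
  rw [h1]
  exact Finset.single_le_sum (f := fun s => Real.exp (dotZ (a s) z))
    (fun s _ => (Real.exp_pos _).le) (Finset.mem_univ _)

lemma exp_le_taylor (t : ℝ) : Real.exp t ≤ 1 + t + t ^ 2 * Real.exp |t| := by
  rcases le_or_gt |t| 1 with h | h
  · have h1 := (abs_le.mp (Real.abs_exp_sub_one_sub_id_le h)).2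
    nlinarith [Real.one_le_exp (abs_nonneg t), sq_nonneg t]
  · rcases lt_abs.mp h with h | h
    · rw [abs_of_pos (by linarith)]
      nlinarith [Real.exp_pos t, mul_pos (Real.exp_pos t) (show 0 < t ^ 2 - 1 by nlinarith)]
    · have h1 : Real.exp t ≤ 1 := Real.exp_le_one_iff.mpr (by linarith)
      nlinarith [Real.one_le_exp (abs_nonneg t), sq_nonneg t]

namespace ExpStep

lemma summable_mul (H : ExpStep μ r) {f : (Fin d → ℤ) → ℝ} {C : ℝ}
    (h : ∀ z, |f z| ≤ C * Real.exp (r * znorm z)) : Summable fun z => μ z * f z := by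
  refine Summable.of_norm_bounded (H.exp.mul_left C) fun z => ?_
  rw [Real.norm_eq_abs, abs_mul, abs_of_nonneg (H.nn z)]
  nlinarith [h z, H.nn z]

lemma linear_le_exp (H : ExpStep μ r) (z : Fin d → ℤ) : znorm z ≤ 1 / r * Real.exp (r * znorm z) := by
  have := H.pos
  rw [one_div, inv_mul_eq_div, le_div_iff₀ this]
  linarith [Real.add_one_le_exp (r * znorm z)]

lemma summable_linear (H : ExpStep μ r) {t : (Fin d → ℤ) → ℝ} {α : ℝ} (ht : ∀ z, |t z| ≤ α * znorm z) :
    Summable fun z => μ z * t z := by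
  refine H.summable_mul (C := |α| * (1 / r)) fun z => (ht z).trans ?_
  rw [mul_assoc]
  exact mul_le_mul (le_abs_self α) (H.linear_le_exp z) (znorm_nonneg z) (abs_nonneg α)

lemma summable_exp (H : ExpStep μ r) {t : (Fin d → ℤ) → ℝ} (ht : ∀ z, t z ≤ r * znorm z) :
    Summable fun z => μ z * Real.exp (t z) := by
  refine H.summable_mul (C := 1) fun z => ?_
  rw [Real.abs_exp, one_mul]
  exact Real.exp_le_exp.mpr (ht z)

lemma exists_taylor (H : ExpStep μ r) : ∃ C : ℝ, 0 < C ∧ ∀ (t : (Fin d → ℤ) → ℝ) (α : ℝ), α ≤ r / 2 →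
    (∀ z, |t z| ≤ α * znorm z) →
    ∑' z, μ z * Real.exp (t z) ≤ Real.exp (∑' z, μ z * t z + C * α ^ 2) := by
  have hr := H.pos
  set E := ∑' z, μ z * Real.exp (r * znorm z) with hE
  have hEn : 0 ≤ E := tsum_nonneg fun z => mul_nonneg (H.nn z) (Real.exp_pos _).le
  refine ⟨8 / r ^ 2 * E + 1, by positivity, fun t α hα ht => ?_⟩
  have hs1 := H.summable_linear ht
  have hs2 : Summable fun z => μ z * Real.exp (t z) := by
    refine H.summable_exp fun z => (le_abs_self _).trans ((ht z).trans ?_)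
    nlinarith [znorm_nonneg z]
  have hle : ∀ z, μ z * Real.exp (t z) ≤
      μ z + μ z * t z + (8 / r ^ 2 * α ^ 2) * (μ z * Real.exp (r * znorm z)) := by
    intro z
    have hN := znorm_nonneg z
    have h1 := exp_le_taylor (t z)
    have h2 : t z ^ 2 ≤ α ^ 2 * znorm z ^ 2 := by
      rw [← sq_abs (t z), ← mul_pow]
      exact pow_le_pow_left₀ (abs_nonneg _) (ht z) 2
    have h3 : Real.exp |t z| ≤ Real.exp (r / 2 * znorm z) :=
      Real.exp_le_exp.mpr ((ht z).trans (by nlinarith))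
    have h4 : znorm z ^ 2 ≤ 8 / r ^ 2 * Real.exp (r / 2 * znorm z) := by
      have := Real.quadratic_le_exp_of_nonneg (show 0 ≤ r / 2 * znorm z by positivity)
      rw [div_mul_eq_mul_div, le_div_iff₀ (by positivity)]
      nlinarith
    have h5 : t z ^ 2 * Real.exp |t z| ≤ 8 / r ^ 2 * α ^ 2 * Real.exp (r * znorm z) := by
      calc t z ^ 2 * Real.exp |t z| ≤ (α ^ 2 * (8 / r ^ 2 * Real.exp (r / 2 * znorm z))) *
            Real.exp (r / 2 * znorm z) := by
              refine mul_le_mul (h2.trans ?_) h3 (Real.exp_pos _).le (by positivity)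
              gcongr
        _ = 8 / r ^ 2 * α ^ 2 * (Real.exp (r / 2 * znorm z) * Real.exp (r / 2 * znorm z)) := by ring
        _ = _ := by rw [← Real.exp_add]; ring_nf
    nlinarith [H.nn z, mul_le_mul_of_nonneg_left (h1.trans (add_le_add_right h5 _)) (H.nn z)]
  have h6 := hs2.tsum_le_tsum hle
    ((H.sum.summable.add hs1).add (H.exp.mul_left (8 / r ^ 2 * α ^ 2)))
  rw [(H.sum.summable.add hs1).tsum_add (H.exp.mul_left _), H.sum.summable.tsum_add hs1,
    tsum_mul_left, H.sum.tsum_eq, ← hE] at h6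
  refine (h6.trans ?_).trans (Real.add_one_le_exp _)
  nlinarith [sq_nonneg α]

end ExpStep

lemma avg_ofReal (hnn : ∀ z, 0 ≤ μ z) {f : (Fin d → ℤ) → ℝ} {x : Fin d → ℤ}
    (hf : ∀ y, 0 ≤ f y) (hs : Summable fun z => μ z * f (x + z)) :
    avg μ (fun y => ENNReal.ofReal (f y)) x = ENNReal.ofReal (∑' z, μ z * f (x + z)) := by
  rw [ENNReal.ofReal_tsum_of_nonneg (fun z => mul_nonneg (hnn z) (hf _)) hs]
  exact tsum_congr fun z => (ENNReal.ofReal_mul (hnn z)).symm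

lemma ExpStep.exists_avg_exp_le (H : ExpStep μ r) : ∃ C : ℝ, 0 < C ∧
    ∀ (T t : (Fin d → ℤ) → ℝ) (α : ℝ), α ≤ r / 2 → (∀ z, |t z| ≤ α * znorm z) →
    (∀ x z, T (x + z) ≤ T x + t z) → ∀ x,
    avg μ (fun y => ENNReal.ofReal (Real.exp (T y))) x ≤
      ENNReal.ofReal (Real.exp (∑' z, μ z * t z + C * α ^ 2)) * ENNReal.ofReal (Real.exp (T x)) := by
  obtain ⟨C, hC, h⟩ := H.exists_taylor
  refine ⟨C, hC, fun T t α hα ht hT x => ?_⟩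
  have hs2 : Summable fun z => μ z * Real.exp (t z) := by
    refine H.summable_exp fun z => (le_abs_self _).trans ((ht z).trans ?_)
    nlinarith [znorm_nonneg z, H.pos]
  have hle : ∀ z, μ z * Real.exp (T (x + z)) ≤ Real.exp (T x) * (μ z * Real.exp (t z)) := by
    intro z
    have : Real.exp (T (x + z)) ≤ Real.exp (T x) * Real.exp (t z) := by
      rw [← Real.exp_add]; exact Real.exp_le_exp.mpr (hT x z)
    nlinarith [H.nn z]
  have hs3 : Summable fun z => μ z * Real.exp (T (x + z)) :=
    Summable.of_nonneg_of_le (fun z => mul_nonneg (H.nn z) (Real.exp_pos _).le) hle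
      (hs2.mul_left _)
  rw [avg_ofReal H.nn (fun y => (Real.exp_pos _).le) hs3, ← ENNReal.ofReal_mul (Real.exp_pos _).le]
  apply ENNReal.ofReal_le_ofReal
  refine (hs3.tsum_le_tsum hle (hs2.mul_left _)).trans ?_
  rw [tsum_mul_left, mul_comm]
  exact mul_le_mul_of_nonneg_right (h t α hα ht) (Real.exp_pos _).le

lemma exists_tail_le {ι : Type*} {f : ι → ℝ≥0∞} (hf : ∑' i, f i ≠ ⊤) (ρ : ι → ℝ) {ε : ℝ≥0∞}
    (hε : 0 < ε) : ∃ A : ℕ, ∑' i, (if (A : ℝ) < ρ i then f i else 0) ≤ ε := by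
  have h1 : Tendsto (fun A : ℕ => ∑' i, (if (A : ℝ) < ρ i then (f i).toReal else 0)) atTop
      (𝓝 (∑' _ : ι, (0 : ℝ))) := by
    refine tendsto_tsum_of_dominated_convergence (ENNReal.summable_toReal hf) (fun i => ?_)
      (Eventually.of_forall fun A i => ?_)
    · refine tendsto_const_nhds.congr' ?_
      filter_upwards [tendsto_natCast_atTop_atTop.eventually_ge_atTop (ρ i)] with A hA
      simp [not_lt.mpr hA]
    · split_ifs <;> simp
  rw [tsum_zero] at h1
  have h2 := ENNReal.tendsto_ofReal h1
  rw [ENNReal.ofReal_zero] at h2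
  obtain ⟨A, hA⟩ := (h2.eventually (eventually_le_nhds hε)).exists
  refine ⟨A, le_trans (le_of_eq ?_) hA⟩
  have hfi := ENNReal.ne_top_of_tsum_ne_top hf
  rw [ENNReal.ofReal_tsum_of_nonneg (fun i => by split_ifs <;> simp)
    (Summable.of_nonneg_of_le (fun i => by split_ifs <;> simp) (fun i => by split_ifs <;> simp)
      (ENNReal.summable_toReal hf))]
  refine tsum_congr fun i => ?_
  split_ifs <;> simp [ENNReal.ofReal_toReal (hfi i)]

end Moments

section HalfSpace

variable {d : ℕ} {μ : (Fin d → ℤ) → ℝ} {r : ℝ} {i : Fin d}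

/-- The half-space `{x | 0 < xⁱ}`. -/
def half (i : Fin d) : Set (Fin d → ℤ) := {x | 0 < x i}

lemma mem_half {x : Fin d → ℤ} : x ∈ half i ↔ 0 < x i := Iff.rfl

lemma half_eq_posDom (i : Fin d) : half i = posDom {i} := by
  ext x; simp [half, posDom]

lemma posAll_subset_half (i : Fin d) : posAll ⊆ half i := fun _ hx => hx i

/-- An irreducible walk with exponential moments whose mean vanishes in direction `i` and is
positive in all other directions. -/
structure Setup (μ : (Fin d → ℤ) → ℝ) (r : ℝ) (i : Fin d) : Prop extends ExpStep μ r where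
  irr : A1 μ
  mean_zero : Mvec μ i = 0
  mean_pos : ∀ j, j ≠ i → 0 < Mvec μ j
  nontriv : ∃ j, j ≠ i

lemma Setup.irred_half (S : Setup μ r i) : Irred μ (half i) := half_eq_posDom i ▸ S.irr {i}

lemma exists_pos_step (hirr : Irred μ (half i)) (f : ℤ → ℤ) (hf : ∀ a, f (-a) = -f a)
    {x x' : Fin d → ℤ} (hx : x ∈ half i) (hx' : x' ∈ half i)
    (hadd : ∀ a b, f (a + b) = f a + f b) (h : f (x i) < f (x' i)) : ∃ z, 0 < μ z ∧ 0 < f (z i) := by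
  obtain ⟨k, c, h0, hk, -, hstep⟩ := hirr x hx x' hx'
  by_contra! hcon
  have : ∀ j ≤ k, f (c j i) ≤ f (x i) := by
    intro j hj
    induction j with
    | zero => rw [h0]
    | succ j ih =>
      have h1 := hcon _ (hstep j (by omega))
      rw [Pi.sub_apply, sub_eq_add_neg, hadd, hf] at h1
      linarith [ih (by omega)]
  have := this k le_rfl
  rw [hk] at this
  omega

lemma Setup.exists_step_pos (S : Setup μ r i) : ∃ z, 0 < μ z ∧ 0 < z i :=
  exists_pos_step S.irred_half (fun a => a) (fun _ => rfl) (x := fun _ => 1) (x' := fun _ => 2)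
    (by simp [half]) (by simp [half]) (fun _ _ => rfl) (by simp)

lemma Setup.exists_step_neg (S : Setup μ r i) : ∃ z, 0 < μ z ∧ z i < 0 := by
  obtain ⟨z, h1, h2⟩ :=
    exists_pos_step S.irred_half (fun a => -a) (fun _ => rfl) (x := fun _ => 2) (x' := fun _ => 1)
    (by simp [half]) (by simp [half]) (fun _ _ => by ring) (by simp)
  exact ⟨z, h1, by omega⟩

lemma ExpStep.summable_coord (H : ExpStep μ r) (k : Fin d) :
    Summable fun z => μ z * (z k : ℝ) :=
  H.summable_linear (t := fun z => (z k : ℝ)) (α := 1) fun z => by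
    simpa using abs_coord_le z k

lemma Setup.hasSum_coord (S : Setup μ r i) : HasSum (fun z => μ z * (z i : ℝ)) 0 := by
  have := (S.summable_coord i).hasSum
  rwa [show ∑' z, μ z * (z i : ℝ) = 0 from S.mean_zero] at this

lemma ExpStep.summable_exp_coord (H : ExpStep μ r) {s : ℝ} (hs : |s| ≤ r) (k : Fin d) :
    Summable fun z => μ z * Real.exp (s * z k) := by
  refine H.summable_exp fun z => ?_
  calc s * z k ≤ |s * z k| := le_abs_self _
    _ = |s| * |(z k : ℝ)| := abs_mul _ _
    _ ≤ r * znorm z := mul_le_mul hs (abs_coord_le z k) (abs_nonneg _) H.pos.le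

lemma Setup.one_lt_exp_moment (S : Setup μ r i) {s : ℝ} (hs : |s| ≤ r) (h0 : s ≠ 0) :
    1 < ∑' z, μ z * Real.exp (s * z i) := by
  have h1 : HasSum (fun z => μ z * (1 + s * z i)) 1 := by
    have := S.sum.add (S.hasSum_coord.mul_left s)
    simp only [mul_zero, add_zero] at this
    refine this.congr_fun fun z => by ring
  rw [← h1.tsum_eq]
  obtain ⟨z, hz, hzi⟩ := S.exists_step_pos
  refine Summable.tsum_lt_tsum (i := z) (fun w => ?_) ?_ h1.summable (S.summable_exp_coord hs i)
  · exact mul_le_mul_of_nonneg_left (by linarith [Real.add_one_le_exp (s * w i)]) (S.nn w)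
  · refine mul_lt_mul_of_pos_left ?_ hz
    have : s * z i ≠ 0 := mul_ne_zero h0 (by exact_mod_cast hzi.ne')
    linarith [Real.add_one_lt_exp this]

/-- `x ↦ exp(-θ xⁱ)` on the half-space. -/
noncomputable def decay (i : Fin d) (θ : ℝ) (x : Fin d → ℤ) : ℝ≥0∞ :=
  if x ∈ half i then ENNReal.ofReal (Real.exp (-θ * x i)) else 0

/-- Positive part of the `i`-th coordinate. -/
noncomputable def coordPos (i : Fin d) (x : Fin d → ℤ) : ℝ≥0∞ := ENNReal.ofReal (x i)

/-- Negative part of the `i`-th coordinate. -/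
noncomputable def coordNeg (i : Fin d) (x : Fin d → ℤ) : ℝ≥0∞ := ENNReal.ofReal (-(x i))

lemma avg_exp_coord (H : ExpStep μ r) {s : ℝ} (hs : |s| ≤ r) (k : Fin d) (x : Fin d → ℤ) :
    avg μ (fun y => ENNReal.ofReal (Real.exp (s * y k))) x =
      ENNReal.ofReal (∑' z, μ z * Real.exp (s * z k)) * ENNReal.ofReal (Real.exp (s * x k)) := by
  have h1 : ∀ z : Fin d → ℤ, μ z * Real.exp (s * (x + z) k) =
      (μ z * Real.exp (s * z k)) * Real.exp (s * x k) := by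
    intro z
    rw [mul_assoc, ← Real.exp_add]
    push_cast [Pi.add_apply]
    ring_nf
  rw [avg_ofReal H.nn (fun _ => (Real.exp_pos _).le)]
  · simp only [h1, tsum_mul_right]
    rw [ENNReal.ofReal_mul (tsum_nonneg fun z => mul_nonneg (H.nn z) (Real.exp_pos _).le)]
  · simp only [h1]
    exact (H.summable_exp_coord hs k).mul_right _

lemma Setup.exists_lyapunov (S : Setup μ r i) : ∃ θ : ℝ, 0 < θ ∧ ∃ C : ℝ≥0∞, C ≠ ⊤ ∧
    (∀ A ⊆ half i, ∀ x, pot (stepK μ A) (decay i θ) x ≤ C) ∧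
    (∀ A ⊆ half i, exitK μ A (coordNeg i) ≤ C • decay i θ) := by
  have hr := S.pos
  set θ := r with hθ
  have habs : |-θ| ≤ r := by rw [abs_neg, abs_of_pos hr]
  have hφ := S.one_lt_exp_moment habs (by simpa using hr.ne')
  set φ := ∑' z, μ z * Real.exp (-θ * z i) with hφdef
  set c : ℝ≥0∞ := ENNReal.ofReal ((φ - 1) / 2) with hc
  have hc0 : c ≠ 0 := by
    rw [hc, Ne, ENNReal.ofReal_eq_zero]; linarith
  have hφc : ENNReal.ofReal φ = 1 + 2 * c := by
    rw [hc, ← ENNReal.ofReal_one, show (2 : ℝ≥0∞) = ENNReal.ofReal 2 by simp,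
      ← ENNReal.ofReal_mul (by norm_num), ← ENNReal.ofReal_add (by norm_num) (by linarith)]
    congr 1; ring
  have htail : ∑' z, ENNReal.ofReal (μ z * Real.exp (-θ * z i)) ≠ ⊤ :=
    (S.summable_exp_coord habs i).tsum_ofReal_ne_top
  obtain ⟨L, hL⟩ := exists_tail_le htail (fun z => -(z i : ℝ)) (pos_iff_ne_zero.mpr hc0)
  set B : ℝ := Real.exp (θ * L) with hB
  have hB1 : 1 ≤ B := Real.one_le_exp (by positivity)
  set e : (Fin d → ℤ) → ℝ≥0∞ := fun y => ENNReal.ofReal (Real.exp (-θ * y i)) with he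
  set Vf : (Fin d → ℤ) → ℝ≥0∞ := fun y => ENNReal.ofReal (B - Real.exp (-θ * y i)) with hV
  have hVe : ∀ y ∈ half i, (Vf + e) y = ENNReal.ofReal B := by
    intro y hy
    have : Real.exp (-θ * y i) ≤ 1 := by
      rw [Real.exp_le_one_iff]
      have : (0 : ℝ) < y i := by exact_mod_cast hy
      nlinarith
    simp only [hV, he, Pi.add_apply]
    rw [← ENNReal.ofReal_add (by linarith) (Real.exp_pos _).le]
    congr 1; ring
  have hLy : stepK μ (half i) Vf + c • decay i θ ≤ Vf := by
    intro x
    by_cases hx : x ∈ half i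
    swap
    · simp [stepK_of_notMem hx, decay, hx]
    have hxp : (0 : ℝ) < x i := by exact_mod_cast hx
    have e1 : stepK μ (half i) Vf x + stepK μ (half i) e x =
        stepK μ (half i) (fun _ => ENNReal.ofReal B) x := by
      rw [← stepK_congr hVe, map_add]; rfl
    have e2 := (stepK_add_exitK (μ := μ) hx e).trans (avg_exp_coord S.toExpStep habs i x)
    have e3 := (stepK_add_exitK (μ := μ) hx _).trans
      (avg_one S.nn S.sum (ENNReal.ofReal B) x)
    have e4 : exitK μ (half i) e x ≤
        exitK μ (half i) (fun _ => ENNReal.ofReal B) x + c * e x := by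
      rw [exitK_apply hx, exitK_apply hx]
      calc _ ≤ ∑' z, (ENNReal.ofReal (μ z) *
              (if x + z ∈ half i then 0 else ENNReal.ofReal B) +
              (if (L : ℝ) < -(z i : ℝ) then ENNReal.ofReal (μ z * Real.exp (-θ * z i)) else 0) *
                e x) := by
            refine ENNReal.tsum_le_tsum fun z => ?_
            by_cases hz : x + z ∈ half i
            · simp [hz]
            by_cases hzL : (L : ℝ) < -(z i : ℝ)
            · refine le_add_left (le_of_eq ?_)
              simp only [hz, hzL, if_true, if_false, he]
              rw [ENNReal.ofReal_mul (S.nn z), mul_assoc, ← ENNReal.ofReal_mul (Real.exp_pos _).le,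
                ← Real.exp_add]
              congr 3
              push_cast [Pi.add_apply]; ring
            · simp only [hz, hzL, if_false, zero_mul, add_zero, he]
              gcongr
              rw [hB]
              apply Real.exp_le_exp.mpr
              push_cast [Pi.add_apply]
              nlinarith
        _ ≤ _ := by
            rw [ENNReal.tsum_add, ENNReal.tsum_mul_right]
            gcongr
    have e5 := hVe x hx
    rw [← hφdef, hφc] at e2
    have hefin : e x ≠ ⊤ := ENNReal.ofReal_ne_top
    have hEfin : exitK μ (half i) (fun _ => ENNReal.ofReal B) x ≠ ⊤ :=
      ne_top_of_le_ne_top (b := ENNReal.ofReal B) ENNReal.ofReal_ne_top (le_add_self.trans e3.le)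
    have hcfin : c ≠ ⊤ := ENNReal.ofReal_ne_top
    simp only [Pi.add_apply, Pi.smul_apply, smul_eq_mul, decay, hx, if_true]
    change stepK μ (half i) Vf x + c * e x ≤ Vf x
    change _ = (1 + 2 * c) * e x at e2
    change Vf x + e x = _ at e5
    generalize stepK μ (half i) Vf x = KV at *
    generalize stepK μ (half i) e x = Ke at *
    generalize exitK μ (half i) e x = Ee at *
    generalize stepK μ (half i) (fun _ => ENNReal.ofReal B) x = KB at *
    generalize exitK μ (half i) (fun _ => ENNReal.ofReal B) x = EB at *
    generalize e x = ex at *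
    generalize Vf x = Vx at *
    refine ENNReal.le_of_add_le_add_right (a := (1 + c) * ex + EB) (by finiteness) ?_
    calc KV + c * ex + ((1 + c) * ex + EB) = KV + (1 + 2 * c) * ex + EB := by ring
      _ = (KV + Ke) + EB + Ee := by rw [← e2]; ring
      _ = Vx + ex + Ee := by rw [e1, e3, e5]
      _ ≤ Vx + ex + (EB + c * ex) := by gcongr
      _ = _ := by ring
  have hpotH : ∀ x, pot (stepK μ (half i)) (decay i θ) x ≤ c⁻¹ * ENNReal.ofReal B := by
    intro x
    have h1 := pot_le_of_lyapunov (isKer_stepK μ _) hLy x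
    rw [pot_smul, Pi.smul_apply, smul_eq_mul] at h1
    rw [mul_comm, ← ENNReal.div_eq_inv_mul.trans (mul_comm _ _),
      ENNReal.le_div_iff_mul_le (Or.inl hc0) (Or.inl ENNReal.ofReal_ne_top), mul_comm]
    refine h1.trans (ENNReal.ofReal_le_ofReal ?_)
    linarith [Real.exp_pos (-θ * x i)]
  refine ⟨θ, hr, c⁻¹ * ENNReal.ofReal B + ENNReal.ofReal (1 / θ * φ), ?_, fun A hA x => ?_,
    fun A hA x => ?_⟩
  · have := ENNReal.inv_ne_top.mpr hc0
    finiteness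
  · exact ((pot_le_of_le (isKer_stepK μ _) (stepK_mono_set hA) _ x).trans (hpotH x)).trans
      le_self_add
  · by_cases hx : x ∈ A
    swap
    · simp [exitK_of_notMem hx]
    have h1 : coordNeg i ≤ (ENNReal.ofReal (1 / θ)) • e := by
      intro y
      simp only [Pi.smul_apply, he, coordNeg, smul_eq_mul]
      rw [← ENNReal.ofReal_mul (by positivity)]
      apply ENNReal.ofReal_le_ofReal
      rw [one_div, inv_mul_eq_div, le_div_iff₀ hr]
      linarith [Real.add_one_le_exp (-θ * y i)]
    refine (((isKer_exitK μ A).mono h1 x).trans (exitK_le_avg A _ x)).trans ?_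
    have h2 : avg μ (ENNReal.ofReal (1 / θ) • e) x = ENNReal.ofReal (1 / θ) * avg μ e x := by
      simp only [avg, ← ENNReal.tsum_mul_left, Pi.smul_apply, smul_eq_mul]
      exact tsum_congr fun z => by ring
    rw [h2, avg_exp_coord S.toExpStep habs i x, ← mul_assoc, ← ENNReal.ofReal_mul (by positivity)]
    simp only [Pi.smul_apply, smul_eq_mul, decay, hA hx, if_true]
    gcongr
    exact le_add_self

end HalfSpace

section Harmonic

variable {d : ℕ} {μ : (Fin d → ℤ) → ℝ} {r : ℝ} {i : Fin d} {A : Set (Fin d → ℤ)}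

/-- Restriction of a function to a set. -/
noncomputable def cut (A : Set (Fin d → ℤ)) (f : (Fin d → ℤ) → ℝ≥0∞) (x : Fin d → ℤ) : ℝ≥0∞ :=
  if x ∈ A then f x else 0

lemma cut_of_mem {x : Fin d → ℤ} (hx : x ∈ A) (f : (Fin d → ℤ) → ℝ≥0∞) : cut A f x = f x :=
  if_pos hx

lemma cut_of_notMem {x : Fin d → ℤ} (hx : x ∉ A) (f : (Fin d → ℤ) → ℝ≥0∞) : cut A f x = 0 :=
  if_neg hx

lemma cut_le (f : (Fin d → ℤ) → ℝ≥0∞) : cut A f ≤ f := by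
  intro x
  unfold cut
  split_ifs <;> simp

lemma stepK_cut (f : (Fin d → ℤ) → ℝ≥0∞) : stepK μ A (cut A f) = stepK μ A f :=
  stepK_congr fun _ hx => cut_of_mem hx f

/-- Expected number of steps from which the exit reward `f` is collected, i.e.
`E_x f(S(τ))`. -/
noncomputable def exitPot (μ : (Fin d → ℤ) → ℝ) (A : Set (Fin d → ℤ))
    (f : (Fin d → ℤ) → ℝ≥0∞) : (Fin d → ℤ) → ℝ≥0∞ := pot (stepK μ A) (exitK μ A f)

/-- The harmonic function `xⁱ - E_x Sⁱ(τ)` of the walk killed outside `A`. -/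
noncomputable def hfun (μ : (Fin d → ℤ) → ℝ) (i : Fin d) (A : Set (Fin d → ℤ))
    (x : Fin d → ℤ) : ℝ≥0∞ :=
  cut A (coordPos i) x + exitPot μ A (coordNeg i) x - exitPot μ A (coordPos i) x

lemma coordPos_ne_top (x : Fin d → ℤ) : coordPos i x ≠ ⊤ := ENNReal.ofReal_ne_top

lemma cut_coordPos_ne_top (x : Fin d → ℤ) : cut A (coordPos i) x ≠ ⊤ :=
  ne_top_of_le_ne_top (coordPos_ne_top x) (cut_le _ x)

lemma coordPos_eq (i : Fin d) : coordPos i = fun y => ENNReal.ofReal (max (y i : ℝ) 0) := by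
  funext y; simp [coordPos, ENNReal.ofReal, Real.toNNReal]

lemma coordNeg_eq (i : Fin d) : coordNeg i = fun y => ENNReal.ofReal (max (-(y i : ℝ)) 0) := by
  funext y; simp [coordNeg, ENNReal.ofReal, Real.toNNReal]

lemma Setup.hasSum_coord_add (S : Setup μ r i) (x : Fin d → ℤ) :
    HasSum (fun z => μ z * ((x + z) i : ℝ)) (x i) := by
  have := (S.sum.mul_right (x i : ℝ)).add S.hasSum_coord
  rw [one_mul, add_zero] at this
  refine this.congr_fun fun z => ?_
  push_cast [Pi.add_apply]; ring

lemma Setup.avg_coordPos (S : Setup μ r i) {x : Fin d → ℤ} (hx : x ∈ half i) :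
    avg μ (coordPos i) x = avg μ (coordNeg i) x + coordPos i x := by
  have hxp : (0 : ℝ) < x i := Int.cast_pos.mpr hx
  have hs := S.hasSum_coord_add x
  have hp : Summable fun z => μ z * max ((x + z) i : ℝ) 0 := by
    refine Summable.of_norm_bounded hs.summable.norm fun z => ?_
    rw [Real.norm_eq_abs, Real.norm_eq_abs, abs_mul, abs_mul]
    refine mul_le_mul_of_nonneg_left ?_ (abs_nonneg _)
    rw [abs_of_nonneg (le_max_right _ _)]
    exact max_le (le_abs_self _) (abs_nonneg _)
  have hm : Summable fun z => μ z * max (-((x + z) i : ℝ)) 0 := by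
    refine Summable.of_norm_bounded hs.summable.norm fun z => ?_
    rw [Real.norm_eq_abs, Real.norm_eq_abs, abs_mul, abs_mul]
    refine mul_le_mul_of_nonneg_left ?_ (abs_nonneg _)
    rw [abs_of_nonneg (le_max_right _ _)]
    exact max_le (neg_le_abs _) (abs_nonneg _)
  have e1 : avg μ (coordPos i) x = ENNReal.ofReal (∑' z, μ z * max ((x + z) i : ℝ) 0) := by
    rw [coordPos_eq]
    exact avg_ofReal S.nn (f := fun y => max (y i : ℝ) 0) (fun _ => le_max_right _ _) hp
  have e2 : avg μ (coordNeg i) x = ENNReal.ofReal (∑' z, μ z * max (-((x + z) i : ℝ)) 0) := by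
    rw [coordNeg_eq]
    exact avg_ofReal S.nn (f := fun y => max (-(y i : ℝ)) 0) (fun _ => le_max_right _ _) hm
  have e3 : ∑' z, μ z * max ((x + z) i : ℝ) 0 =
      ∑' z, μ z * max (-((x + z) i : ℝ)) 0 + x i := by
    rw [← hs.tsum_eq, ← hm.tsum_add hs.summable]
    refine tsum_congr fun z => ?_
    rw [← mul_add]
    congr 1
    rcases le_total ((x + z) i : ℝ) 0 with h | h
    · rw [max_eq_right h, max_eq_left (by linarith)]; ring
    · rw [max_eq_left h, max_eq_right (by linarith)]; ring
  rw [e1, e2, e3, coordPos,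
    ENNReal.ofReal_add (tsum_nonneg fun z => mul_nonneg (S.nn z) (le_max_right _ _)) hxp.le]

lemma coordNeg_of_mem {x : Fin d → ℤ} (hx : x ∈ half i) : coordNeg i x = 0 := by
  have hxp : (0 : ℝ) < x i := by exact_mod_cast hx
  simp [coordNeg, hxp.le]

lemma coordPos_of_notMem {x : Fin d → ℤ} (hx : x ∉ half i) : coordPos i x = 0 := by
  have hxp : (x i : ℝ) ≤ 0 := by exact_mod_cast not_lt.mp hx
  simp [coordPos, hxp]

lemma Setup.step_coordPos (S : Setup μ r i) (hA : A ⊆ half i) :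
    stepK μ A (cut A (coordPos i)) + exitK μ A (coordPos i) =
      cut A (coordPos i) + exitK μ A (coordNeg i) := by
  funext x
  simp only [Pi.add_apply]
  by_cases hx : x ∈ A
  · rw [stepK_cut, stepK_add_exitK hx, S.avg_coordPos (hA hx), cut_of_mem hx, add_comm]
    congr 1
    rw [← stepK_add_exitK hx, stepK_congr (g := 0), map_zero]
    · simp
    · intro y hy
      simp [coordNeg_of_mem (hA hy)]
  · simp [stepK_of_notMem hx, exitK_of_notMem hx, cut_of_notMem hx]

lemma Setup.exists_exitPot_coordNeg_le (S : Setup μ r i) :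
    ∃ C : ℝ≥0∞, C ≠ ⊤ ∧ ∀ A ⊆ half i, ∀ x, exitPot μ A (coordNeg i) x ≤ C := by
  obtain ⟨θ, hθ, C, hC, h1, h2⟩ := S.exists_lyapunov
  refine ⟨C * C, by finiteness, fun A hA x => ?_⟩
  refine (pot_mono (isKer_stepK μ A) (h2 A hA) x).trans ?_
  rw [pot_smul, Pi.smul_apply, smul_eq_mul]
  gcongr
  exact h1 A hA x

lemma Setup.telescope_coordPos (S : Setup μ r i) (hA : A ⊆ half i) (n : ℕ) (x : Fin d → ℤ) :
    ((stepK μ A) ^ n) (cut A (coordPos i)) x +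
      (∑ t ∈ Finset.range n, ((stepK μ A) ^ t) (exitK μ A (coordPos i))) x =
    cut A (coordPos i) x +
      (∑ t ∈ Finset.range n, ((stepK μ A) ^ t) (exitK μ A (coordNeg i))) x :=
  congrFun (telescope (S.step_coordPos hA) n) x

lemma sum_le_pot (L : Module.End ℝ≥0∞ ((Fin d → ℤ) → ℝ≥0∞)) (s : (Fin d → ℤ) → ℝ≥0∞) (n : ℕ)
    (x : Fin d → ℤ) : (∑ t ∈ Finset.range n, (L ^ t) s) x ≤ pot L s x := by
  rw [Finset.sum_apply]
  exact ENNReal.sum_le_tsum _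

lemma le_pot (L : Module.End ℝ≥0∞ ((Fin d → ℤ) → ℝ≥0∞)) (s : (Fin d → ℤ) → ℝ≥0∞) :
    s ≤ pot L s := fun x => by simpa using sum_le_pot L s 1 x

lemma Setup.pow_coordPos_le (S : Setup μ r i) (hA : A ⊆ half i) (n : ℕ) (x : Fin d → ℤ) :
    ((stepK μ A) ^ n) (cut A (coordPos i)) x ≤
      cut A (coordPos i) x + exitPot μ A (coordNeg i) x := by
  refine le_self_add.trans ((S.telescope_coordPos hA n x).le.trans ?_)
  gcongr
  exact sum_le_pot _ _ _ _

lemma Setup.exitPot_coordPos_le (S : Setup μ r i) (hA : A ⊆ half i) (x : Fin d → ℤ) :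
    exitPot μ A (coordPos i) x ≤ cut A (coordPos i) x + exitPot μ A (coordNeg i) x := by
  refine le_of_tendsto' (tendsto_sum_pow _ _ x) fun n => ?_
  refine le_add_self.trans ((S.telescope_coordPos hA n x).le.trans ?_)
  gcongr
  exact sum_le_pot _ _ _ _

lemma Setup.exitPot_coordNeg_ne_top (S : Setup μ r i) (hA : A ⊆ half i) (x : Fin d → ℤ) :
    exitPot μ A (coordNeg i) x ≠ ⊤ := by
  obtain ⟨C, hC, h⟩ := S.exists_exitPot_coordNeg_le
  exact ne_top_of_le_ne_top hC (h A hA x)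

lemma Setup.exitPot_coordPos_ne_top (S : Setup μ r i) (hA : A ⊆ half i) (x : Fin d → ℤ) :
    exitPot μ A (coordPos i) x ≠ ⊤ :=
  ne_top_of_le_ne_top (ENNReal.add_ne_top.mpr ⟨cut_coordPos_ne_top x,
    S.exitPot_coordNeg_ne_top hA x⟩) (S.exitPot_coordPos_le hA x)

lemma Setup.hfun_add (S : Setup μ r i) (hA : A ⊆ half i) (x : Fin d → ℤ) :
    hfun μ i A x + exitPot μ A (coordPos i) x =
      cut A (coordPos i) x + exitPot μ A (coordNeg i) x :=
  tsub_add_cancel_of_le (S.exitPot_coordPos_le hA x)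

lemma Setup.hfun_ne_top (S : Setup μ r i) (hA : A ⊆ half i) (x : Fin d → ℤ) :
    hfun μ i A x ≠ ⊤ :=
  ENNReal.sub_ne_top (ENNReal.add_ne_top.mpr ⟨cut_coordPos_ne_top x,
    S.exitPot_coordNeg_ne_top hA x⟩)

lemma Setup.tendsto_pow_coordPos (S : Setup μ r i) (hA : A ⊆ half i) (x : Fin d → ℤ) :
    Tendsto (fun n => ((stepK μ A) ^ n) (cut A (coordPos i)) x) atTop (𝓝 (hfun μ i A x)) := by
  have h1 := (tendsto_sum_pow (stepK μ A) (exitK μ A (coordNeg i)) x).const_add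
    (cut A (coordPos i) x)
  have h2 := tendsto_sum_pow (stepK μ A) (exitK μ A (coordPos i)) x
  refine (ENNReal.Tendsto.sub h1 h2 (Or.inr (S.exitPot_coordPos_ne_top hA x))).congr fun n => ?_
  rw [← S.telescope_coordPos hA n x]
  refine ENNReal.add_sub_cancel_right ?_
  exact ne_top_of_le_ne_top (S.exitPot_coordPos_ne_top hA x) (sum_le_pot _ _ _ _)

lemma Setup.stepK_hfun (S : Setup μ r i) (hA : A ⊆ half i) :
    stepK μ A (hfun μ i A) = hfun μ i A := by
  have h1 : hfun μ i A + exitPot μ A (coordPos i) =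
      cut A (coordPos i) + exitPot μ A (coordNeg i) := funext (S.hfun_add hA)
  have h2 := congrArg (stepK μ A) h1
  rw [map_add, map_add] at h2
  have h3 := pot_eq (isKer_stepK μ A) (exitK μ A (coordPos i))
  have h4 := pot_eq (isKer_stepK μ A) (exitK μ A (coordNeg i))
  have h5 := S.step_coordPos hA
  change stepK μ A (exitPot μ A (coordPos i)) + _ = exitPot μ A (coordPos i) at h3
  change stepK μ A (exitPot μ A (coordNeg i)) + _ = exitPot μ A (coordNeg i) at h4
  have h6 : stepK μ A (hfun μ i A) + (exitPot μ A (coordPos i) + exitK μ A (coordNeg i)) =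
      hfun μ i A + (exitPot μ A (coordPos i) + exitK μ A (coordNeg i)) := by
    calc _ = (stepK μ A (hfun μ i A) + stepK μ A (exitPot μ A (coordPos i))) +
          exitK μ A (coordPos i) + exitK μ A (coordNeg i) := by
            rw [add_assoc (stepK μ A (hfun μ i A)), h3]; abel
      _ = (stepK μ A (cut A (coordPos i)) + exitK μ A (coordPos i)) +
          (stepK μ A (exitPot μ A (coordNeg i)) + exitK μ A (coordNeg i)) := by rw [h2]; abel
      _ = (cut A (coordPos i) + exitPot μ A (coordNeg i)) + exitK μ A (coordNeg i) := by
          rw [h5, h4]; abel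
      _ = _ := by rw [← h1]; abel
  funext x
  have h7 := congrFun h6 x
  simp only [Pi.add_apply] at h7
  refine (ENNReal.add_left_inj (ENNReal.add_ne_top.mpr
    ⟨S.exitPot_coordPos_ne_top hA x, ?_⟩)).mp h7
  exact ne_top_of_le_ne_top (S.exitPot_coordNeg_ne_top hA x) (le_pot _ _ x)

lemma Setup.hM2_eq (S : Setup μ r i) {x : Fin d → ℤ} (hx : x ∈ posAll) :
    hM2 μ i x = (hfun μ i posAll x).toReal := by
  have hA := posAll_subset_half (d := d) i
  have hp := S.exitPot_coordPos_ne_top hA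
  have hm := S.exitPot_coordNeg_ne_top hA
  have hxp : (0 : ℝ) < x i := by exact_mod_cast hx i
  have h1 := exitExp_eq S.nn S.sum hx (g := fun y => (y i : ℝ)) (gp := coordPos i)
    (gm := coordNeg i) (fun y => ?_)
    (fun z => ne_top_of_le_ne_top (hp z) (le_pot _ _ z))
    (fun z => ne_top_of_le_ne_top (hm z) (le_pot _ _ z)) (hp x) (hm x)
  · have h2 := congrArg ENNReal.toReal (S.hfun_add hA x)
    rw [ENNReal.toReal_add (S.hfun_ne_top hA x) (hp x),
      ENNReal.toReal_add (cut_coordPos_ne_top x) (hm x), cut_of_mem hx, coordPos,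
      ENNReal.toReal_ofReal hxp.le] at h2
    rw [hM2, h1]
    simp only [exitPot] at h2
    linarith
  · simp only [coordPos, coordNeg, ENNReal.toReal_ofReal']
    rcases le_total (y i : ℝ) 0 with h | h
    · rw [max_eq_right h, max_eq_left (by linarith)]; ring
    · rw [max_eq_left h, max_eq_right (by linarith)]; ring

/-- The walk leaves the half-space almost surely. -/
lemma Setup.tendsto_pow_one (S : Setup μ r i) (hA : A ⊆ half i) (x : Fin d → ℤ) :
    Tendsto (fun n => ((stepK μ A) ^ n) (cut A 1) x) atTop (𝓝 0) := by
  obtain ⟨θ, hθ, C, hC, h1, -⟩ := S.exists_lyapunov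
  have h2 : Tendsto (fun n => ((stepK μ A) ^ n) (decay i θ) x) atTop (𝓝 0) :=
    ENNReal.tendsto_atTop_zero_of_tsum_ne_top (ne_top_of_le_ne_top hC (h1 A hA x))
  set D := cut A (coordPos i) x + exitPot μ A (coordNeg i) x with hD
  have hDfin : D ≠ ⊤ := ENNReal.add_ne_top.mpr ⟨cut_coordPos_ne_top x,
    S.exitPot_coordNeg_ne_top hA x⟩
  have key : ∀ L : ℕ, 0 < L → ∀ n, ((stepK μ A) ^ n) (cut A 1) x ≤
      ENNReal.ofReal (Real.exp (θ * L)) * ((stepK μ A) ^ n) (decay i θ) x +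
        (L : ℝ≥0∞)⁻¹ * D := by
    intro L hL n
    have hle : cut A 1 ≤ ENNReal.ofReal (Real.exp (θ * L)) • decay i θ +
        (L : ℝ≥0∞)⁻¹ • cut A (coordPos i) := by
      intro y
      by_cases hy : y ∈ A
      swap
      · simp [cut_of_notMem hy]
      simp only [cut_of_mem hy, Pi.one_apply, Pi.add_apply, Pi.smul_apply, smul_eq_mul, decay,
        hA hy, if_true]
      rcases le_total (y i) L with h | h
      · refine le_add_right ?_
        rw [← ENNReal.ofReal_mul (Real.exp_pos _).le, ← Real.exp_add, ← ENNReal.ofReal_one]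
        apply ENNReal.ofReal_le_ofReal
        have : (y i : ℝ) ≤ L := by exact_mod_cast h
        exact Real.one_le_exp (by nlinarith)
      · refine le_add_left ?_
        have h3 : (L : ℝ≥0∞) ≤ coordPos i y := by
          rw [coordPos, ← ENNReal.ofReal_natCast]
          apply ENNReal.ofReal_le_ofReal
          exact_mod_cast h
        calc (1 : ℝ≥0∞) = (L : ℝ≥0∞)⁻¹ * L :=
              (ENNReal.inv_mul_cancel (by exact_mod_cast hL.ne') (by simp)).symm
          _ ≤ _ := by gcongr
    refine (((isKer_stepK μ A).pow n).mono hle x).trans ?_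
    rw [map_add, map_smul, map_smul]
    simp only [Pi.add_apply, Pi.smul_apply, smul_eq_mul]
    gcongr
    exact S.pow_coordPos_le hA n x
  rw [ENNReal.tendsto_nhds_zero]
  intro ε hε
  have h3 : Tendsto (fun L : ℕ => (L : ℝ≥0∞)⁻¹ * D) atTop (𝓝 0) := by
    have := ENNReal.Tendsto.mul_const ENNReal.tendsto_inv_nat_nhds_zero (Or.inr hDfin)
    simpa using this
  have hε2 : 0 < ε / 2 := ENNReal.half_pos hε.ne'
  obtain ⟨L, hL1, hL2⟩ := ((ENNReal.tendsto_nhds_zero.mp h3 _ hε2).and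
    (eventually_gt_atTop 0)).exists
  have h4 : Tendsto (fun n => ENNReal.ofReal (Real.exp (θ * L)) *
      ((stepK μ A) ^ n) (decay i θ) x) atTop (𝓝 0) := by
    have := ENNReal.Tendsto.const_mul (a := ENNReal.ofReal (Real.exp (θ * L))) h2
      (Or.inr ENNReal.ofReal_ne_top)
    simpa using this
  filter_upwards [ENNReal.tendsto_nhds_zero.mp h4 _ hε2] with n hn
  refine (key L hL2 n).trans ((add_le_add hn hL1).trans (ENNReal.add_halves ε).le)

lemma Setup.exitK_half_coordPos (i : Fin d) : exitK μ (half i) (coordPos i) = 0 := by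
  rw [exitK_congr (g := 0), map_zero]
  intro x hx
  simp [coordPos_of_notMem hx]

lemma hfun_half (x : Fin d → ℤ) :
    hfun μ i (half i) x = coordPos i x + exitPot μ (half i) (coordNeg i) x := by
  have : exitPot μ (half i) (coordPos i) x = 0 := by
    simp [exitPot, Setup.exitK_half_coordPos, pot]
  rw [hfun, this, tsub_zero]
  congr 1
  by_cases hx : x ∈ half i
  · exact cut_of_mem hx _
  · rw [cut_of_notMem hx, coordPos_of_notMem hx]

/-- Comparison of the harmonic functions of the walks killed outside `A` and outside the
half-space. -/
lemma Setup.hfun_add_exitPot (S : Setup μ r i) (hA : A ⊆ half i) {x : Fin d → ℤ} (hx : x ∈ A) :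
    hfun μ i A x + exitPot μ A (cut (half i) (hfun μ i (half i))) x = hfun μ i (half i) x := by
  set h := cut (half i) (hfun μ i (half i)) with hh
  have e1 : stepK μ A (cut A h) + exitK μ A h = cut A h := by
    funext y
    by_cases hy : y ∈ A
    · have e2 := congrFun (S.stepK_hfun subset_rfl) y
      rw [Pi.add_apply, stepK_cut, stepK_add_exitK hy, cut_of_mem hy, hh, cut_of_mem (hA hy), ← e2,
        stepK_apply (hA hy)]
      rfl
    · simp [stepK_of_notMem hy, exitK_of_notMem hy, cut_of_notMem hy]
  have e3 : Tendsto (fun n => ((stepK μ A) ^ n) (cut A h) x) atTop (𝓝 (hfun μ i A x)) := by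
    obtain ⟨C, hC, hle⟩ := S.exists_exitPot_coordNeg_le
    have h1 : cut A (coordPos i) ≤ cut A h := by
      intro y
      by_cases hy : y ∈ A
      · rw [cut_of_mem hy, cut_of_mem hy, hh, cut_of_mem (hA hy), hfun_half]
        exact le_self_add
      · simp [cut_of_notMem hy]
    have h2 : cut A h ≤ cut A (coordPos i) + C • cut A 1 := by
      intro y
      by_cases hy : y ∈ A
      · simp only [Pi.add_apply, Pi.smul_apply, smul_eq_mul, cut_of_mem hy, hh, cut_of_mem (hA hy),
          hfun_half, Pi.one_apply, mul_one]
        gcongr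
        exact hle _ subset_rfl y
      · simp [cut_of_notMem hy]
    have h3 := ENNReal.Tendsto.const_mul (a := C) (S.tendsto_pow_one hA x) (Or.inr hC)
    have h4 := (S.tendsto_pow_coordPos hA x).add h3
    rw [mul_zero, add_zero] at h4
    refine tendsto_of_tendsto_of_tendsto_of_le_of_le (S.tendsto_pow_coordPos hA x) h4
      (fun n => ((isKer_stepK μ A).pow n).mono h1 x) fun n => ?_
    have := ((isKer_stepK μ A).pow n).mono h2 x
    rwa [map_add, map_smul] at this
  have := add_pot_eq_of_tendsto e1 e3
  rw [cut_of_mem hx, hh, cut_of_mem (hA hx)] at this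
  exact this

end Harmonic

section Positivity

variable {d : ℕ} {μ : (Fin d → ℤ) → ℝ} {r : ℝ} {i : Fin d}

lemma stepK_ge {A : Set (Fin d → ℤ)} {x y : Fin d → ℤ} (hx : x ∈ A) (hy : y ∈ A)
    (f : (Fin d → ℤ) → ℝ≥0∞) : ENNReal.ofReal (μ (y - x)) * f y ≤ stepK μ A f x := by
  rw [stepK, kop_apply]
  refine le_trans ?_ (ENNReal.le_tsum y)
  simp [hx, hy]

lemma _root_.Irred.pos {A : Set (Fin d → ℤ)} (h : Irred μ A) {f : (Fin d → ℤ) → ℝ≥0∞}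
    (hf : stepK μ A f ≤ f) {x x' : Fin d → ℤ} (hx : x ∈ A) (hx' : x' ∈ A) (hpos : 0 < f x') :
    0 < f x := by
  obtain ⟨k, c, rfl, rfl, hc, hstep⟩ := h x hx x' hx'
  have : ∀ j ≤ k, 0 < f (c (k - j)) := by
    intro j hj
    induction j with
    | zero => simpa
    | succ j ih =>
      have h1 := ih (by omega)
      have h2 := hstep (k - (j + 1)) (by omega)
      rw [show k - (j + 1) + 1 = k - j by omega] at h2
      refine lt_of_lt_of_le ?_ ((stepK_ge (μ := μ) (hc (k - (j + 1)) (by omega))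
        (hc (k - j) (by omega)) f).trans (hf _))
      exact ENNReal.mul_pos (by simpa using h2) h1.ne'
  simpa using this k le_rfl

/-- `x ↦ exp(ε|x|)`. -/
noncomputable def growth (ε : ℝ) (x : Fin d → ℤ) : ℝ≥0∞ := ENNReal.ofReal (Real.exp (ε * znorm x))

lemma Setup.exists_mean_ge (S : Setup μ r i) : ∃ m : ℝ, 0 < m ∧ ∀ j, j ≠ i → m ≤ Mvec μ j := by
  obtain ⟨j, hj⟩ := S.nontriv
  obtain ⟨k, hk, hmin⟩ := (Finset.univ.erase i).exists_min_image (Mvec μ) ⟨j, by simp [hj]⟩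
  exact ⟨Mvec μ k, S.mean_pos k (by simpa using hk), fun l hl => hmin l (by simp [hl])⟩

lemma ExpStep.summable_znorm (H : ExpStep μ r) : Summable fun z => μ z * znorm z :=
  H.summable_linear (α := 1) fun z => by rw [abs_of_nonneg (znorm_nonneg z), one_mul]

lemma Setup.exists_drift (S : Setup μ r i) : ∃ ε δ : ℝ, 0 < ε ∧ ε * d < δ ∧ ∀ j, j ≠ i →
    ∀ x, avg μ (fun y => ENNReal.ofReal (Real.exp (ε * znorm y - δ * y j))) x ≤
      ENNReal.ofReal (Real.exp (ε * znorm x - δ * x j)) := by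
  obtain ⟨C, hC, hav⟩ := S.exists_avg_exp_le
  obtain ⟨m, hm, hmj⟩ := S.exists_mean_ge
  have hr := S.pos
  set E := ∑' z, μ z * znorm z with hE
  have hE0 : 0 ≤ E := tsum_nonneg fun z => mul_nonneg (S.nn z) (znorm_nonneg z)
  set δ := min (r / 4) (m / (8 * C)) with hδ
  have hδ0 : 0 < δ := by positivity
  have hδ1 : δ ≤ r / 4 := min_le_left _ _
  have hδ2 : 8 * C * δ ≤ m := by
    have : δ ≤ m / (8 * C) := min_le_right _ _
    rwa [le_div_iff₀ (by positivity), mul_comm] at this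
  set ε := min (δ / (d + 1)) (δ * m / (2 * (E + 1))) with hε
  have hε0 : 0 < ε := by positivity
  have hε1 : ε * (d + 1) ≤ δ := by
    have : ε ≤ δ / (d + 1) := min_le_left _ _
    rwa [le_div_iff₀ (by positivity)] at this
  have hε2 : ε * (2 * (E + 1)) ≤ δ * m := by
    have : ε ≤ δ * m / (2 * (E + 1)) := min_le_right _ _
    rwa [le_div_iff₀ (by positivity)] at this
  have hd : (0 : ℝ) ≤ d := Nat.cast_nonneg d
  have hεδ : ε ≤ δ := by nlinarith
  refine ⟨ε, δ, hε0, by linarith, fun j hj x => ?_⟩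
  have h1 := hav (fun y => ε * znorm y - δ * y j) (fun z => ε * znorm z - δ * z j) (ε + δ)
    (by linarith) (fun z => ?_) (fun x z => ?_) x
  · refine h1.trans (mul_le_of_le_one_left zero_le ?_)
    rw [ENNReal.ofReal_le_one, Real.exp_le_one_iff]
    have h2 : ∑' z, μ z * (ε * znorm z - δ * z j) = ε * E - δ * Mvec μ j := by
      rw [hE, Mvec, ← tsum_mul_left, ← tsum_mul_left,
        ← (S.summable_znorm.mul_left ε).tsum_sub ((S.summable_coord j).mul_left δ)]
      exact tsum_congr fun z => by ring
    rw [h2]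
    have h3 := mul_le_mul_of_nonneg_left (hmj j hj) hδ0.le
    have h4 : (ε + δ) ^ 2 ≤ 4 * δ * δ := by nlinarith
    nlinarith
  · have := abs_coord_le z j
    have hz := znorm_nonneg z
    rw [abs_le] at this ⊢
    constructor <;> nlinarith
  · have := znorm_add_le x z
    push_cast [Pi.add_apply]
    nlinarith

lemma Setup.exists_exitPot_growth_le (S : Setup μ r i) : ∃ ε δ : ℝ, 0 < ε ∧ ε * d < δ ∧
    ∀ x, exitPot μ posAll (cut (half i) (growth ε)) x ≤
      ∑ j ∈ Finset.univ.erase i, ENNReal.ofReal (Real.exp (ε * znorm x - δ * x j)) := by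
  obtain ⟨ε, δ, hε, hεδ, h⟩ := S.exists_drift
  refine ⟨ε, δ, hε, hεδ, ?_⟩
  set F : (Fin d → ℤ) → ℝ≥0∞ := fun x =>
    ∑ j ∈ Finset.univ.erase i, ENNReal.ofReal (Real.exp (ε * znorm x - δ * x j)) with hF
  change exitPot μ posAll (cut (half i) (growth ε)) ≤ F
  have hδ : 0 < δ := lt_of_le_of_lt (by positivity) hεδ
  have hle : ∀ y ∉ (posAll : Set (Fin d → ℤ)), cut (half i) (growth ε) y ≤ F y := by
    intro y hy
    by_cases hyi : y ∈ half i
    swap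
    · simp [cut_of_notMem hyi]
    rw [cut_of_mem hyi]
    simp only [posAll, Set.mem_ofPred_eq, not_forall, not_lt] at hy
    obtain ⟨j, hj⟩ := hy
    have hji : j ≠ i := by rintro rfl; exact absurd hyi (not_lt.mpr hj)
    refine le_trans ?_ (Finset.single_le_sum (f := fun j =>
      ENNReal.ofReal (Real.exp (ε * znorm y - δ * y j))) (fun _ _ => zero_le)
      (Finset.mem_erase.mpr ⟨hji, Finset.mem_univ j⟩))
    apply ENNReal.ofReal_le_ofReal
    apply Real.exp_le_exp.mpr
    have : (y j : ℝ) ≤ 0 := by exact_mod_cast hj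
    nlinarith
  have hexit : exitK μ posAll (cut (half i) (growth ε)) ≤ exitK μ posAll F := by
    rw [exitK_congr (g := fun y => if y ∈ (posAll : Set (Fin d → ℤ)) then 0 else
      cut (half i) (growth ε) y) (fun y hy => by simp [hy])]
    refine (isKer_exitK μ _).mono fun y => ?_
    by_cases hy : y ∈ (posAll : Set (Fin d → ℤ))
    · simp [hy]
    · simpa [hy] using hle y hy
  refine (pot_mono (isKer_stepK μ _) hexit).trans (pot_le_of_lyapunov (isKer_stepK μ _) ?_)
  intro x
  by_cases hx : x ∈ (posAll : Set (Fin d → ℤ))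
  swap
  · simp [stepK_of_notMem hx, exitK_of_notMem hx]
  rw [Pi.add_apply, stepK_add_exitK hx]
  calc avg μ F x = ∑ j ∈ Finset.univ.erase i,
        avg μ (fun y => ENNReal.ofReal (Real.exp (ε * znorm y - δ * y j))) x := by
        simp only [avg, hF, Finset.mul_sum]
        exact Summable.tsum_finsetSum fun _ _ => ENNReal.summable
    _ ≤ F x := Finset.sum_le_sum fun j hj => h j (Finset.ne_of_mem_erase hj) x

lemma coordPos_le_growth {ε : ℝ} (hε : 0 < ε) (x : Fin d → ℤ) :
    coordPos i x ≤ ENNReal.ofReal (1 / ε) * cut (half i) (growth ε) x := by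
  by_cases hx : x ∈ half i
  · rw [cut_of_mem hx, coordPos, growth, ← ENNReal.ofReal_mul (by positivity)]
    apply ENNReal.ofReal_le_ofReal
    rw [one_div, inv_mul_eq_div, le_div_iff₀ hε]
    nlinarith [Real.add_one_le_exp (ε * znorm x), abs_coord_le x i, le_abs_self (x i : ℝ)]
  · simp [coordPos_of_notMem hx]

lemma exitPot_mono {A : Set (Fin d → ℤ)} {f g : (Fin d → ℤ) → ℝ≥0∞} (h : f ≤ g) :
    exitPot μ A f ≤ exitPot μ A g :=
  pot_mono (isKer_stepK μ _) ((isKer_exitK μ _).mono h)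

lemma exitPot_smul {A : Set (Fin d → ℤ)} (c : ℝ≥0∞) (f : (Fin d → ℤ) → ℝ≥0∞) :
    exitPot μ A (c • f) = c • exitPot μ A f := by
  rw [exitPot, map_smul, pot_smul, exitPot]

lemma Setup.exists_hfun_pos (S : Setup μ r i) : ∃ x ∈ posAll, 0 < hfun μ i posAll x := by
  obtain ⟨ε, δ, hε, hεδ, h⟩ := S.exists_exitPot_growth_le
  have hd : (1 : ℝ) ≤ d := by exact_mod_cast (Nat.one_le_iff_ne_zero.mpr (by rintro rfl; exact i.elim0))
  have hlim : Tendsto (fun R : ℕ => 1 / ε * (d * Real.exp ((ε * d - δ) * R + ε))) atTop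
      (𝓝 (1 / ε * (d * 0))) := by
    refine (Tendsto.const_mul _ (Real.tendsto_exp_atBot.comp ?_)).const_mul _
    refine tendsto_atBot_add_const_right _ _ ?_
    exact tendsto_natCast_atTop_atTop.const_mul_atTop_of_neg (by linarith)
  rw [mul_zero, mul_zero] at hlim
  obtain ⟨R, hR, hR0⟩ := ((hlim.eventually (gt_mem_nhds zero_lt_one)).and
    (eventually_gt_atTop 0)).exists
  set x : Fin d → ℤ := Function.update (fun _ => (R : ℤ)) i 1 with hx
  have hxi : x i = 1 := by simp [hx]
  have hxj : ∀ j, j ≠ i → x j = R := fun j hj => by simp [hx, hj]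
  have hxA : x ∈ (posAll : Set (Fin d → ℤ)) := by
    intro j
    by_cases hj : j = i
    · rw [hj, hxi]; norm_num
    · rw [hxj j hj]; exact_mod_cast hR0
  refine ⟨x, hxA, ?_⟩
  have hN : znorm x ≤ 1 + d * R := by
    rw [znorm, ← Finset.add_sum_erase _ _ (Finset.mem_univ i), hxi]
    have : ∑ j ∈ Finset.univ.erase i, |(x j : ℝ)| ≤ ∑ j : Fin d, (R : ℝ) := by
      refine (Finset.sum_le_sum fun j hj => ?_).trans
        (Finset.sum_le_sum_of_subset_of_nonneg (Finset.erase_subset _ _) fun _ _ _ => by positivity)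
      rw [hxj j (Finset.ne_of_mem_erase hj)]; simp
    simp only [Finset.sum_const, Finset.card_univ, Fintype.card_fin, nsmul_eq_mul] at this
    simpa using this
  have hUp : exitPot μ posAll (coordPos i) x < 1 := by
    have h1 := exitPot_mono (μ := μ) (A := posAll)
      (show coordPos i ≤ ENNReal.ofReal (1 / ε) • cut (half i) (growth ε) from
        coordPos_le_growth hε) x
    rw [exitPot_smul, Pi.smul_apply, smul_eq_mul] at h1
    refine (h1.trans (mul_le_mul_right (h x) _)).trans_lt ?_
    have h2 : ∑ j ∈ Finset.univ.erase i, ENNReal.ofReal (Real.exp (ε * znorm x - δ * x j)) ≤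
        ENNReal.ofReal (d * Real.exp ((ε * d - δ) * R + ε)) := by
      calc _ ≤ ∑ j : Fin d, ENNReal.ofReal (Real.exp ((ε * d - δ) * R + ε)) := by
            refine (Finset.sum_le_sum fun j hj => ?_).trans
              (Finset.sum_le_sum_of_subset (Finset.erase_subset _ _))
            apply ENNReal.ofReal_le_ofReal
            apply Real.exp_le_exp.mpr
            rw [hxj j (Finset.ne_of_mem_erase hj)]
            push_cast
            nlinarith
        _ = _ := by
            simp [ENNReal.ofReal_mul (show (0 : ℝ) ≤ d by positivity)]
    refine (mul_le_mul_right h2 _).trans_lt ?_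
    rw [← ENNReal.ofReal_mul (by positivity), ← ENNReal.ofReal_one]
    exact (ENNReal.ofReal_lt_ofReal_iff one_pos).mpr hR
  have h3 := S.hfun_add (posAll_subset_half i) x
  by_contra hcon
  rw [pos_iff_ne_zero, not_not] at hcon
  rw [hcon, zero_add, cut_of_mem hxA] at h3
  have h4 : (1 : ℝ≥0∞) ≤ coordPos i x := by simp [coordPos, hxi]
  exact absurd hUp (not_lt.mpr (h4.trans (le_self_add.trans h3.symm.le)))

lemma posDom_univ : posDom (Set.univ : Set (Fin d)) = posAll := by
  ext x; simp [posDom, posAll]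

lemma Setup.hfun_pos (S : Setup μ r i) {x : Fin d → ℤ} (hx : x ∈ posAll) :
    0 < hfun μ i posAll x := by
  obtain ⟨y, hy, hpos⟩ := S.exists_hfun_pos
  exact (posDom_univ ▸ S.irr Set.univ : Irred μ posAll).pos
    (S.stepK_hfun (posAll_subset_half i)).le hx hy hpos

lemma Setup.harmOn_hM2 (S : Setup μ r i) : HarmOn μ posAll (hM2 μ i) := by
  intro x hx
  have hA := posAll_subset_half (d := d) i
  have h1 := toReal_apply_eq (isKer_stepK μ posAll) (f := hfun μ i posAll) (x := x)
    (by rw [S.stepK_hfun hA]; exact S.hfun_ne_top hA x)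
  rw [S.stepK_hfun hA] at h1
  rw [S.hM2_eq hx, ← h1.tsum_eq]
  refine tsum_congr fun y => ?_
  rw [stepK, kop_single]
  by_cases hy : y ∈ (posAll : Set (Fin d → ℤ))
  · simp [hx, hy, S.hM2_eq hy, ENNReal.toReal_ofReal (S.nn _)]
  · simp [hy]

end Positivity

section Harnack

variable {d : ℕ} {μ : (Fin d → ℤ) → ℝ} {r : ℝ} {i : Fin d}

/-- ℓ¹-norm as a natural number. -/
def l1 (x : Fin d → ℤ) : ℕ := ∑ k, (x k).natAbs

lemma znorm_eq_l1 (x : Fin d → ℤ) : znorm x = l1 x := by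
  simp [znorm, l1, Nat.cast_natAbs]

/-- Unit move by `s` in direction `k`. -/
def move (u : Fin d → ℤ) (k : Fin d) (s : ℤ) : Fin d → ℤ := u + Pi.single k s

lemma move_same (u : Fin d → ℤ) (k : Fin d) (s : ℤ) : move u k s k = u k + s := by simp [move]

lemma move_of_ne (u : Fin d → ℤ) {k l : Fin d} (h : l ≠ k) (s : ℤ) : move u k s l = u l := by
  simp [move, h]

lemma chain {f : (Fin d → ℤ) → ℝ≥0∞} {D : ℝ≥0∞} {P : Fin d → Prop}
    (hstep : ∀ u ∈ half i, ∀ k s, P k → (s = 1 ∨ s = -1) → move u k s ∈ half i →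
      f (move u k s) ≤ D * f u) (n : ℕ) {u u' : Fin d → ℤ} (hu : u ∈ half i) (hu' : u' ∈ half i)
    (hn : l1 (u' - u) = n) (hP : ∀ k, ¬ P k → u k = u' k) : f u' ≤ D ^ n * f u := by
  induction n generalizing u with
  | zero =>
    have : u' = u := by
      funext k
      have : ∀ k ∈ Finset.univ, ((u' - u) k).natAbs = 0 := by
        simpa [l1, Finset.sum_eq_zero_iff] using hn
      have := this k (Finset.mem_univ k)
      simp only [Pi.sub_apply] at this
      omega
    simp [this]
  | succ n ih =>
    have hex : ∃ k, u k ≠ u' k := by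
      by_contra! hcon
      have : u' - u = 0 := by funext k; simp [hcon k]
      rw [this] at hn
      simp [l1] at hn
    obtain ⟨k, hk⟩ := hex
    have hPk : P k := by
      by_contra h
      exact hk (hP k h)
    obtain ⟨s, hs, hsk⟩ : ∃ s : ℤ, (s = 1 ∨ s = -1) ∧
        (u' k - (u k + s)).natAbs + 1 = (u' k - u k).natAbs ∧
        (0 < u k → 0 < u' k → 0 < u k + s) := by
      rcases lt_or_gt_of_ne hk with h | h
      · exact ⟨1, Or.inl rfl, by omega, by omega⟩
      · exact ⟨-1, Or.inr rfl, by omega, by omega⟩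
    have hm : move u k s ∈ half i := by
      by_cases hki : k = i
      · subst hki
        rw [mem_half, move_same]
        exact hsk.2 hu hu'
      · rw [mem_half, move_of_ne _ (Ne.symm hki)]
        exact hu
    have hl : l1 (u' - move u k s) = n := by
      have h1 : l1 (u' - move u k s) + 1 = l1 (u' - u) := by
        simp only [l1]
        rw [← Finset.add_sum_erase _ _ (Finset.mem_univ k),
          ← Finset.add_sum_erase (a := k) _ (fun l => ((u' - u) l).natAbs) (Finset.mem_univ k)]
        have : ∑ l ∈ Finset.univ.erase k, ((u' - move u k s) l).natAbs =
            ∑ l ∈ Finset.univ.erase k, ((u' - u) l).natAbs := by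
          refine Finset.sum_congr rfl fun l hl => ?_
          rw [Pi.sub_apply, move_of_ne _ (Finset.ne_of_mem_erase hl), Pi.sub_apply]
        rw [this, Pi.sub_apply, move_same, Pi.sub_apply]
        omega
      omega
    calc f u' ≤ D ^ n * f (move u k s) := by
          refine ih hm hl fun l hPl => ?_
          rw [move_of_ne, hP l hPl]
          rintro rfl
          exact hPl hPk
      _ ≤ D ^ n * (D * f u) := by
          gcongr
          exact hstep u hu k s hPk hs hm
      _ = _ := by ring

lemma path_shift {b b' : Fin d → ℤ} (hirr : Irred μ (half i)) (hb : b ∈ half i)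
    (hb' : b' ∈ half i) : ∃ (k : ℕ) (p : ℝ≥0∞), p ≠ 0 ∧ p ≠ ⊤ ∧ ∀ w : Fin d → ℤ, 0 ≤ w i →
      ∀ f : (Fin d → ℤ) → ℝ≥0∞, p * f (b' + w) ≤ ((stepK μ (half i)) ^ k) f (b + w) := by
  obtain ⟨k, c, rfl, rfl, hc, hstep⟩ := hirr b hb b' hb'
  refine ⟨k, ∏ j ∈ Finset.range k, ENNReal.ofReal (μ (c (j + 1) - c j)), ?_, ?_, ?_⟩
  · rw [Finset.prod_ne_zero_iff]
    intro j hj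
    simpa using hstep j (Finset.mem_range.mp hj)
  · exact ENNReal.prod_ne_top fun _ _ => ENNReal.ofReal_ne_top
  · intro w hw
    have : ∀ j ≤ k, ∀ f : (Fin d → ℤ) → ℝ≥0∞,
        (∏ l ∈ Finset.range j, ENNReal.ofReal (μ (c (l + 1) - c l))) * f (c j + w) ≤
          ((stepK μ (half i)) ^ j) f (c 0 + w) := by
      intro j hj
      induction j with
      | zero => simp
      | succ j ih =>
        intro f
        rw [pow_succ, Module.End.mul_apply, Finset.prod_range_succ, mul_assoc]
        refine le_trans ?_ (ih (by omega) _)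
        gcongr
        have hmem : ∀ l ≤ k, c l + w ∈ half i := by
          intro l hl
          have := hc l hl
          rw [mem_half] at this ⊢
          rw [Pi.add_apply]
          omega
        have := stepK_ge (μ := μ) (hmem j (by omega)) (hmem (j + 1) hj) f
        rwa [add_sub_add_right_eq_sub] at this
    exact this k le_rfl

lemma exists_pow_ge_move (hirr : Irred μ (half i)) (k : Fin d) {s : ℤ} (hk : k ≠ i) :
    ∃ (n : ℕ) (p : ℝ≥0∞), p ≠ 0 ∧ p ≠ ⊤ ∧ ∀ x ∈ half i, ∀ f : (Fin d → ℤ) → ℝ≥0∞,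
      p * f (move x k s) ≤ ((stepK μ (half i)) ^ n) f x := by
  set b : Fin d → ℤ := Pi.single i 1 with hb
  obtain ⟨n, p, h0, h1, h⟩ := path_shift (b := b) (b' := move b k s) hirr
    (by simp [mem_half, hb]) (by rw [mem_half, move_of_ne _ (Ne.symm hk)]; simp [hb])
  refine ⟨n, p, h0, h1, fun x hx f => ?_⟩
  have := h (x - b) (by rw [mem_half] at hx; simp [hb]; omega) f
  rw [add_sub_cancel] at this
  convert this using 3
  simp only [move]
  abel

lemma exists_harnack_move (hirr : Irred μ (half i)) (k : Fin d) {s : ℤ} (hs : s = 1 ∨ s = -1) :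
    ∃ D : ℝ≥0∞, D ≠ ⊤ ∧ ∀ f : (Fin d → ℤ) → ℝ≥0∞, stepK μ (half i) f ≤ f →
      ∀ u ∈ half i, move u k s ∈ half i → f (move u k s) ≤ D * f u := by
  set b : Fin d → ℤ := Pi.single i (if k = i ∧ s = -1 then 2 else 1) with hb
  have hbi : b i = if k = i ∧ s = -1 then 2 else 1 := by simp [hb]
  have hb1 : b ∈ half i := by rw [mem_half, hbi]; split_ifs <;> norm_num
  have hb2 : move b k s ∈ half i := by
    rw [mem_half]
    by_cases hk : k = i
    · subst hk
      rw [move_same, hbi]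
      rcases hs with rfl | rfl <;> simp
    · rw [move_of_ne _ (Ne.symm hk)]
      exact hb1
  obtain ⟨n, p, h0, h1, h⟩ := path_shift hirr hb1 hb2
  refine ⟨p⁻¹, by simpa using h0, fun f hf u hu hu' => ?_⟩
  have hw : 0 ≤ (u - b) i := by
    rw [Pi.sub_apply, hbi]
    rw [mem_half] at hu hu'
    split_ifs with hks
    · obtain ⟨rfl, rfl⟩ := hks
      rw [move_same] at hu'
      omega
    · omega
  have h2 := (h (u - b) hw f).trans (pow_le_of_superharmonic (isKer_stepK μ _) hf n _)
  rw [add_sub_cancel, show move b k s + (u - b) = move u k s by simp only [move]; abel] at h2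
  rw [← ENNReal.div_eq_inv_mul, ENNReal.le_div_iff_mul_le (Or.inl h0) (Or.inl h1), mul_comm]
  exact h2

lemma exists_harnack (hirr : Irred μ (half i)) : ∃ D : ℝ≥0∞, 1 ≤ D ∧ D ≠ ⊤ ∧
    ∀ f : (Fin d → ℤ) → ℝ≥0∞, stepK μ (half i) f ≤ f →
      ∀ u ∈ half i, ∀ u' ∈ half i, f u' ≤ D ^ l1 (u' - u) * f u := by
  choose D hD h using fun (k : Fin d) (s : {s : ℤ // s = 1 ∨ s = -1}) =>
    exists_harnack_move (μ := μ) hirr k s.2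
  refine ⟨1 + ∑ k, (D k ⟨1, Or.inl rfl⟩ + D k ⟨-1, Or.inr rfl⟩), le_self_add, ?_, fun f hf u hu u' hu' => ?_⟩
  · refine ENNReal.add_ne_top.mpr ⟨by simp, ENNReal.sum_ne_top.mpr fun k _ => ?_⟩
    exact ENNReal.add_ne_top.mpr ⟨hD _ _, hD _ _⟩
  · refine chain (P := fun _ => True) (fun v hv k s _ hs hm => ?_) _ hu hu' rfl (by simp)
    refine (h k ⟨s, hs⟩ f hf v hv hm).trans ?_
    gcongr
    refine le_trans ?_ le_add_self
    refine le_trans ?_ (Finset.single_le_sum (f := fun k =>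
      D k ⟨1, Or.inl rfl⟩ + D k ⟨-1, Or.inr rfl⟩) (fun _ _ => zero_le) (Finset.mem_univ k))
    rcases hs with rfl | rfl
    · exact le_self_add
    · exact le_add_self

end Harnack

section Commuting

variable {V : Type*} {L L' T Q : Module.End ℝ≥0∞ (V → ℝ≥0∞)}

lemma IsKer.add (h : IsKer L) (h' : IsKer L') : IsKer (L + L') := by
  obtain ⟨k, rfl⟩ := h
  obtain ⟨l, rfl⟩ := h'
  refine ⟨fun x y => k x y + l x y, LinearMap.ext fun f => funext fun x => ?_⟩
  simp [kop_apply, add_mul, ENNReal.tsum_add]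

lemma IsKer.smul (h : IsKer L) (c : ℝ≥0∞) : IsKer (c • L) := by
  obtain ⟨k, rfl⟩ := h
  refine ⟨fun x y => c * k x y, LinearMap.ext fun f => funext fun x => ?_⟩
  simp [kop_apply, mul_assoc, ENNReal.tsum_mul_left]

lemma exists_commuting_complement (hT : IsKer T) (hQ : IsKer Q) (hT1 : T 1 ≤ 1)
    (hcomm : Commute T Q) {p : ℝ≥0∞} (hp : p ≠ ⊤) (hle : ∀ f, p • T f ≤ Q f) :
    ∃ R, IsKer R ∧ p • T + R = Q ∧ Commute (p • T) R := by
  have hfin : ∀ n x y, (T ^ n) (Pi.single y 1) x ≤ 1 := by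
    intro n x y
    refine (((hT.pow n).mono (g := 1) (fun z => ?_) x).trans
      (pow_le_of_superharmonic hT hT1 n x))
    by_cases h : z = y
    · subst h; simp
    · simp [h]
  have hRsum : p • T + kop (fun x y => Q (Pi.single y 1) x - p * T (Pi.single y 1) x) = Q := by
    refine ((hT.smul p).add (isKer_kop _)).ext hQ fun x y => ?_
    rw [LinearMap.add_apply, Pi.add_apply, kop_single, LinearMap.smul_apply, Pi.smul_apply,
      smul_eq_mul]
    exact add_tsub_cancel_of_le (hle _ x)
  set R := kop (fun x y => Q (Pi.single y 1) x - p * T (Pi.single y 1) x) with hR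
  refine ⟨R, isKer_kop _, hRsum, ?_⟩
  have hTR : T * R = R * T := by
    refine (hT.mul (isKer_kop _)).ext ((isKer_kop _).mul hT) fun x y => ?_
    have h1 : T * Q = Q * T := hcomm
    rw [← hRsum, mul_add, add_mul, mul_smul_comm, smul_mul_assoc] at h1
    have h2 := congrFun (congrArg (fun L : Module.End ℝ≥0∞ (V → ℝ≥0∞) => L (Pi.single y 1)) h1) x
    simp only [LinearMap.add_apply, Pi.add_apply, LinearMap.smul_apply, Pi.smul_apply,
      smul_eq_mul] at h2
    refine (ENNReal.add_right_inj (ENNReal.mul_ne_top hp ?_)).mp h2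
    rw [← pow_two]
    exact ne_top_of_le_ne_top ENNReal.one_ne_top (hfin 2 x y)
  rw [Commute, SemiconjBy, smul_mul_assoc, mul_smul_comm, hTR]

lemma linear_le_exp_tilt {θ : ℝ} (hθ : 0 < θ) (m l : ℝ) :
    m ≤ l + 1 / θ * Real.exp (-θ * l) * Real.exp (θ * m) := by
  rw [mul_assoc, ← Real.exp_add]
  have := Real.add_one_le_exp (-θ * l + θ * m)
  have h2 : θ * (1 / θ * Real.exp (-θ * l + θ * m)) = Real.exp (-θ * l + θ * m) := by
    field_simp
  nlinarith

/-- Exponential Chebyshev bound for the number of factors `a` in the expansion of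
`(a + R)ⁿ⁺¹`. -/
lemma binomial_tilt {a R : Module.End ℝ≥0∞ (V → ℝ≥0∞)} (h : Commute a R) {θ l : ℝ} (hθ : 0 < θ)
    (hl : 0 ≤ l) (n : ℕ) (f : V → ℝ≥0∞) (x : V) :
    ((n : ℝ≥0∞) + 1) * (a * (a + R) ^ n) f x ≤
      ENNReal.ofReal l * ((a + R) ^ (n + 1)) f x +
      ENNReal.ofReal (1 / θ * Real.exp (-θ * l)) *
        ((ENNReal.ofReal (Real.exp θ) • a + R) ^ (n + 1)) f x := by
  set B : ℕ → ℝ≥0∞ := fun m => ((n + 1).choose m : ℝ≥0∞) * (a ^ m * R ^ (n + 1 - m)) f x with hB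
  have hcast : ∀ (L : Module.End ℝ≥0∞ (V → ℝ≥0∞)) (c : ℕ),
      (L * (c : Module.End ℝ≥0∞ (V → ℝ≥0∞))) f x = (c : ℝ≥0∞) * L f x := by
    intro L c
    rw [← nsmul_eq_mul', LinearMap.smul_apply, Pi.smul_apply, nsmul_eq_mul]
  have e1 : ((a + R) ^ (n + 1)) f x = ∑ m ∈ Finset.range (n + 2), B m := by
    rw [h.add_pow, LinearMap.sum_apply, Finset.sum_apply]
    exact Finset.sum_congr rfl fun m _ => hcast _ _
  have e2 : ((ENNReal.ofReal (Real.exp θ) • a + R) ^ (n + 1)) f x =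
      ∑ m ∈ Finset.range (n + 2), ENNReal.ofReal (Real.exp (θ * m)) * B m := by
    rw [(h.smul_left _).add_pow, LinearMap.sum_apply, Finset.sum_apply]
    refine Finset.sum_congr rfl fun m _ => ?_
    rw [hcast, smul_pow, smul_mul_assoc, LinearMap.smul_apply, Pi.smul_apply, smul_eq_mul,
      ← ENNReal.ofReal_pow (Real.exp_pos _).le, ← Real.exp_nat_mul, mul_comm (m : ℝ) θ, hB]
    ring
  have e3 : ((n : ℝ≥0∞) + 1) * (a * (a + R) ^ n) f x =
      ∑ m ∈ Finset.range (n + 2), (m : ℝ≥0∞) * B m := by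
    rw [Finset.sum_range_succ', Nat.cast_zero, zero_mul, add_zero, h.add_pow, Finset.mul_sum,
      LinearMap.sum_apply, Finset.sum_apply, Finset.mul_sum]
    refine Finset.sum_congr rfl fun m _ => ?_
    rw [← mul_assoc, hcast, hB]
    have h1 : ((n : ℝ≥0∞) + 1) * (n.choose m : ℝ≥0∞) =
        ((n + 1).choose (m + 1) : ℝ≥0∞) * ((m + 1 : ℕ) : ℝ≥0∞) := by
      have := Nat.add_one_mul_choose_eq n m
      exact_mod_cast this
    simp only [Nat.add_sub_add_right]
    rw [← mul_assoc, h1, ← mul_assoc a, ← pow_succ']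
    ring
  rw [e1, e2, e3, Finset.mul_sum, Finset.mul_sum, ← Finset.sum_add_distrib]
  refine Finset.sum_le_sum fun m _ => ?_
  generalize B m = b
  calc (m : ℝ≥0∞) * b
      ≤ ENNReal.ofReal (l + 1 / θ * Real.exp (-θ * l) * Real.exp (θ * m)) * b := by
        rw [← ENNReal.ofReal_natCast]
        gcongr
        exact linear_le_exp_tilt hθ m l
    _ = _ := by
        rw [ENNReal.ofReal_add hl (by positivity), ENNReal.ofReal_mul (by positivity)]
        ring

lemma ratio_of_commute (hT : IsKer T) (hQ : IsKer Q) (hT1 : T 1 ≤ 1) (hQ1 : Q 1 ≤ 1)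
    (hcomm : Commute T Q) {p : ℝ} (hp : 0 < p) (hle : ∀ f, ENNReal.ofReal p • T f ≤ Q f)
    {ε : ℝ} (hε : 0 < ε) : ∃ c : ℝ, 0 < c ∧ ∃ C : ℝ, 0 < C ∧ ∀ (n : ℕ) (f : V → ℝ≥0∞) (D : ℝ≥0∞),
      (∀ x, f x ≤ D) → ∀ x, T ((Q ^ n) f) x ≤ ENNReal.ofReal (1 + ε) * (Q ^ (n + 1)) f x +
        ENNReal.ofReal (C * Real.exp (-c * (n + 1))) * D := by
  obtain ⟨R, hR, hQR, hcR⟩ :=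
    exists_commuting_complement hT hQ hT1 hcomm ENNReal.ofReal_ne_top hle
  set θ := min (ε / 2) 1 with hθdef
  have hθ : 0 < θ := by positivity
  have hθ1 : θ ≤ 1 := min_le_right _ _
  have hθε : θ ≤ ε / 2 := min_le_left _ _
  set c := p * (θ * (1 + ε) - (Real.exp θ - 1)) with hc
  have hc0 : 0 < c := by
    refine mul_pos hp ?_
    have := (abs_le.mp (Real.abs_exp_sub_one_sub_id_le (x := θ) (by rwa [abs_of_pos hθ]))).2
    nlinarith
  refine ⟨c, hc0, 1 / (θ * p), by positivity, fun n f D hf x => ?_⟩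
  set l := (1 + ε) * (n + 1) * p with hl
  have h1 := binomial_tilt hcR hθ (show 0 ≤ l by positivity) n f x
  rw [hQR, smul_mul_assoc, LinearMap.smul_apply, Pi.smul_apply, smul_eq_mul,
    Module.End.mul_apply] at h1
  have hker : IsKer (ENNReal.ofReal (Real.exp θ) • ENNReal.ofReal p • T + R) :=
    ((hT.smul _).smul _).add hR
  set q : ℝ≥0∞ := ENNReal.ofReal (Real.exp (p * (Real.exp θ - 1))) with hq
  have hexpθ : 1 ≤ Real.exp θ := Real.one_le_exp hθ.le
  have hmass : (ENNReal.ofReal (Real.exp θ) • ENNReal.ofReal p • T + R) 1 ≤ q • 1 := by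
    intro y
    have e1 : (ENNReal.ofReal (Real.exp θ) • ENNReal.ofReal p • T + R) 1 y =
        ENNReal.ofReal (p * (Real.exp θ - 1)) * T 1 y + Q 1 y := by
      rw [← hQR]
      simp only [LinearMap.add_apply, Pi.add_apply, LinearMap.smul_apply, Pi.smul_apply,
        smul_eq_mul]
      rw [← add_assoc]
      congr 1
      rw [← add_mul, ← ENNReal.ofReal_add (by nlinarith) hp.le, ← mul_assoc,
        ← ENNReal.ofReal_mul (by positivity)]
      congr 2
      ring
    rw [e1]
    simp only [Pi.smul_apply, Pi.one_apply, smul_eq_mul, mul_one]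
    calc _ ≤ ENNReal.ofReal (p * (Real.exp θ - 1)) * 1 + 1 := by
          gcongr
          · exact hT1 y
          · exact hQ1 y
      _ = ENNReal.ofReal (p * (Real.exp θ - 1) + 1) := by
          rw [ENNReal.ofReal_add (by nlinarith) zero_le_one]; simp
      _ ≤ q := ENNReal.ofReal_le_ofReal (Real.add_one_le_exp _)
  have hpow : ((ENNReal.ofReal (Real.exp θ) • ENNReal.ofReal p • T + R) ^ (n + 1)) f x ≤
      q ^ (n + 1) * D := by
    have h2 : f ≤ D • (1 : V → ℝ≥0∞) := fun y => by simpa using hf y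
    refine (((hker.pow (n + 1)).mono h2) x).trans ?_
    rw [map_smul, Pi.smul_apply, smul_eq_mul, mul_comm]
    gcongr
    have := pow_le_smul_of_le hker hmass (n + 1) x
    simpa using this
  have h3 := h1.trans (add_le_add_right (mul_le_mul_right hpow _) _)
  have hnp : ((n : ℝ≥0∞) + 1) = ENNReal.ofReal (n + 1) := by
    rw [ENNReal.ofReal_add (by positivity) zero_le_one]; simp
  have hne : ENNReal.ofReal ((n + 1) * p) ≠ 0 := by
    rw [Ne, ENNReal.ofReal_eq_zero, not_le]; positivity
  rw [hnp, ← mul_assoc, ← ENNReal.ofReal_mul (by positivity)] at h3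
  clear_value l
  refine (ENNReal.mul_le_mul_iff_right hne ENNReal.ofReal_ne_top).mp (h3.trans ?_)
  rw [mul_add]
  refine add_le_add ?_ ?_
  · rw [← mul_assoc, ← ENNReal.ofReal_mul (by positivity)]
    gcongr
    rw [hl]
    exact le_of_eq (by ring)
  · rw [hq, ← ENNReal.ofReal_pow (Real.exp_pos _).le, ← mul_assoc, ← mul_assoc,
      ← ENNReal.ofReal_mul (by positivity), ← ENNReal.ofReal_mul (by positivity)]
    refine mul_le_mul_left (ENNReal.ofReal_le_ofReal ?_) D
    rw [← Real.exp_nat_mul, mul_assoc, ← Real.exp_add]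
    have e4 : -θ * l + ((n + 1 : ℕ) : ℝ) * (p * (Real.exp θ - 1)) = -c * (n + 1) := by
      rw [hl, hc]; push_cast; ring
    rw [e4]
    have e5 : (n + 1) * p * (1 / (θ * p) * Real.exp (-c * (n + 1))) =
        (n + 1) * (1 / θ * Real.exp (-c * (n + 1))) := by
      field_simp
    rw [e5]
    have : 0 ≤ 1 / θ * Real.exp (-c * (n + 1)) := by positivity
    nlinarith [(Nat.cast_nonneg n : (0 : ℝ) ≤ n)]

end Commuting

section GreenBound

lemma pow_single_le_exp {V : Type*} [DecidableEq V] {K : Module.End ℝ≥0∞ (V → ℝ≥0∞)} (hK : IsKer K) {T : V → ℝ}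
    {l : ℝ} (h : K (fun x => ENNReal.ofReal (Real.exp (T x))) ≤
      ENNReal.ofReal (Real.exp l) • fun x => ENNReal.ofReal (Real.exp (T x))) (n : ℕ) (x y : V) :
    (K ^ n) (Pi.single y 1) x ≤ ENNReal.ofReal (Real.exp (l * n + T x - T y)) := by
  have h1 : (Pi.single y 1 : V → ℝ≥0∞) ≤ ENNReal.ofReal (Real.exp (-T y)) •
      fun x => ENNReal.ofReal (Real.exp (T x)) := by
    intro z
    by_cases hz : z = y
    · subst hz
      simp [← ENNReal.ofReal_mul (Real.exp_pos _).le, ← Real.exp_add]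
    · simp [hz]
  refine ((hK.pow n).mono h1 x).trans ?_
  rw [map_smul]
  refine (mul_le_mul_right (pow_le_smul_of_le hK h n x) _).trans ?_
  simp only [Pi.smul_apply, smul_eq_mul]
  rw [← ENNReal.ofReal_pow (Real.exp_pos _).le, ← ENNReal.ofReal_mul (by positivity),
    ← ENNReal.ofReal_mul (by positivity), ← Real.exp_nat_mul, ← Real.exp_add, ← Real.exp_add]
  apply le_of_eq
  congr 2
  ring

lemma pot_single_le {V : Type*} [AddCommGroup V] [DecidableEq V] {μ : V → ℝ} (hnn : ∀ z, 0 ≤ μ z)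
    (hsum : HasSum μ 1) (A : Set V) (x y : V) :
    pot (stepK μ A) (Pi.single y 1) x ≤ pot (stepK μ A) (Pi.single y 1) y := by
  set K := stepK μ A
  have hs : ∀ n x, (∑ t ∈ Finset.range n, (K ^ t) (Pi.single y 1)) x ≤
      pot K (Pi.single y 1) y := by
    intro n
    induction n with
    | zero => simp
    | succ n ih =>
      intro x
      by_cases hx : x = y
      · subst hx
        rw [Finset.sum_apply]
        exact ENNReal.sum_le_tsum _
      · rw [Finset.sum_range_succ', pow_zero, Module.End.one_apply, Pi.add_apply,
          Pi.single_eq_of_ne hx, add_zero]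
        simp only [pow_succ', Module.End.mul_apply]
        rw [← map_sum]
        have := pow_le_const hnn hsum A ih 1 x
        simpa using this
  exact le_of_tendsto' (tendsto_sum_pow K _ x) fun n => hs n x

variable {d : ℕ} {μ : (Fin d → ℤ) → ℝ} {r : ℝ} {i : Fin d}

lemma Setup.exists_pot_single_le (S : Setup μ r i) : ∃ C : ℝ≥0∞, C ≠ ⊤ ∧
    ∀ (A : Set (Fin d → ℤ)) x y, pot (stepK μ A) (Pi.single y 1) x ≤ C := by
  obtain ⟨C, hC, hav⟩ := S.exists_avg_exp_le
  obtain ⟨j, hj⟩ := S.nontriv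
  have hm := S.mean_pos j hj
  have hr := S.pos
  set m := Mvec μ j with hmdef
  set δ := min (r / 2) (m / (2 * C)) with hδ
  have hδ0 : 0 < δ := by positivity
  have hδ2 : 2 * C * δ ≤ m := by
    have : δ ≤ m / (2 * C) := min_le_right _ _
    rwa [le_div_iff₀ (by positivity), mul_comm] at this
  have h1 := hav (fun x => -δ * x j) (fun z => -δ * z j) δ (min_le_left _ _)
    (fun z => by
      rw [abs_mul, abs_neg, abs_of_pos hδ0]
      exact mul_le_mul_of_nonneg_left (abs_coord_le z j) hδ0.le)
    (fun x z => by push_cast [Pi.add_apply]; linarith)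
  have h2 : ∑' z, μ z * (-δ * (z j : ℝ)) = -δ * m := by
    rw [hmdef, Mvec, ← tsum_mul_left]
    exact tsum_congr fun z => by ring
  rw [h2] at h1
  set l := -δ * m + C * δ ^ 2 with hl
  have hl0 : l < 0 := by nlinarith
  have hq : ENNReal.ofReal (Real.exp l) < 1 := by
    rw [ENNReal.ofReal_lt_one]
    rwa [Real.exp_lt_one_iff]
  refine ⟨(1 - ENNReal.ofReal (Real.exp l))⁻¹, ?_, fun A x y => ?_⟩
  · rw [Ne, ENNReal.inv_eq_top, tsub_eq_zero_iff_le, not_le]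
    exact hq
  · refine (pot_single_le S.nn S.sum A x y).trans ?_
    rw [← ENNReal.tsum_geometric]
    refine ENNReal.tsum_le_tsum fun n => ?_
    refine (pow_single_le_exp (isKer_stepK μ A) (T := fun x => -δ * x j) (l := l)
      ((stepK_le_avg A _).trans fun x => h1 x) n y y).trans ?_
    rw [← ENNReal.ofReal_pow (Real.exp_pos _).le, ← Real.exp_nat_mul]
    apply le_of_eq
    congr 2
    ring

/-- Green function of the walk on the half space. -/
noncomputable def greenHalf (μ : (Fin d → ℤ) → ℝ) (i : Fin d) (y x : Fin d → ℤ) : ℝ≥0∞ :=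
  pot (stepK μ (half i)) (Pi.single y 1) x

lemma stepK_greenHalf (y : Fin d → ℤ) :
    stepK μ (half i) (greenHalf μ i y) + Pi.single y 1 = greenHalf μ i y :=
  pot_eq (isKer_stepK _ _) _

lemma stepK_greenHalf_le (y : Fin d → ℤ) :
    stepK μ (half i) (greenHalf μ i y) ≤ greenHalf μ i y := by
  conv_rhs => rw [← stepK_greenHalf y]
  exact le_self_add

lemma ExpStep.exists_pow_single_le (H : ExpStep μ r) : ∃ α l : ℝ, 0 < α ∧ 0 < l ∧
    ∀ (A : Set (Fin d → ℤ)) (n : ℕ) x y, (stepK μ A ^ n) (Pi.single y 1) x ≤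
      ENNReal.ofReal (Real.exp (l * n - α * znorm (x - y))) := by
  obtain ⟨C, hC, hav⟩ := H.exists_avg_exp_le
  have hr := H.pos
  set α := r / 2 with hα
  set E := ∑' z, μ z * (α * znorm z)
  have hE : 0 ≤ E := tsum_nonneg fun z =>
    mul_nonneg (H.nn z) (mul_nonneg (by positivity) (znorm_nonneg z))
  refine ⟨α, E + C * α ^ 2, by positivity, by positivity, fun A n x y => ?_⟩
  have h1 := hav (fun x => -α * znorm (x - y)) (fun z => α * znorm z) α le_rfl
    (fun z => by rw [abs_of_nonneg (mul_nonneg (by positivity) (znorm_nonneg z))])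
    (fun x z => by
      have := znorm_add_le (x + z - y) (-z)
      rw [znorm_neg, show x + z - y + -z = x - y by abel] at this
      nlinarith)
  refine (pow_single_le_exp (isKer_stepK μ A) (T := fun x => -α * znorm (x - y))
      ((stepK_le_avg A _).trans fun x => h1 x) n x y).trans (le_of_eq ?_)
  congr 2
  have h0 : znorm (y - y) = 0 := by simp [znorm]
  rw [h0]
  ring

end GreenBound

section Lateral

variable {d : ℕ} {μ : (Fin d → ℤ) → ℝ} {r : ℝ} {i : Fin d}

/-- Translation by `s` in direction `k` on the half space. -/
noncomputable def shiftK (i k : Fin d) (s : ℤ) : Module.End ℝ≥0∞ ((Fin d → ℤ) → ℝ≥0∞) :=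
  kop fun x y => if x ∈ half i ∧ y = move x k s then 1 else 0

lemma isKer_shiftK (i k : Fin d) (s : ℤ) : IsKer (shiftK i k s) := isKer_kop _

lemma shiftK_of_mem {k : Fin d} {s : ℤ} {x : Fin d → ℤ} (hx : x ∈ half i)
    (f : (Fin d → ℤ) → ℝ≥0∞) : shiftK i k s f x = f (move x k s) := by
  rw [shiftK, kop_apply, tsum_eq_single (move x k s)]
  · simp [hx]
  · intro y hy
    simp [hy]

lemma shiftK_of_notMem {k : Fin d} {s : ℤ} {x : Fin d → ℤ} (hx : x ∉ half i)
    (f : (Fin d → ℤ) → ℝ≥0∞) : shiftK i k s f x = 0 := by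
  simp [shiftK, kop_apply, hx]

lemma move_mem_half {k : Fin d} {s : ℤ} {x : Fin d → ℤ} (hk : k ≠ i) :
    move x k s ∈ half i ↔ x ∈ half i := by
  rw [mem_half, mem_half, move_of_ne _ hk.symm]

lemma shiftK_commute {k : Fin d} (hk : k ≠ i) (s : ℤ) :
    Commute (shiftK i k s) (stepK μ (half i)) := by
  refine LinearMap.ext fun f => funext fun x => ?_
  rw [Module.End.mul_apply, Module.End.mul_apply]
  by_cases hx : x ∈ half i
  · rw [shiftK_of_mem hx, stepK_apply hx, stepK_apply ((move_mem_half hk).mpr hx)]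
    refine tsum_congr fun z => ?_
    have e : move x k s + z = move (x + z) k s := by simp only [move]; abel
    by_cases hz : x + z ∈ half i
    · rw [e, if_pos hz, if_pos ((move_mem_half hk).mpr hz), shiftK_of_mem hz]
    · rw [e, if_neg hz, if_neg (fun h => hz ((move_mem_half hk).mp h))]
  · rw [shiftK_of_notMem hx, stepK_of_notMem hx]

lemma znorm_move (u y : Fin d → ℤ) (k : Fin d) {s : ℤ} (hs : s = 1 ∨ s = -1) :
    znorm (u - y) - 1 ≤ znorm (move u k s - y) := by
  have h1 : znorm (Pi.single k s : Fin d → ℤ) = 1 := by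
    rw [znorm, Finset.sum_eq_single k]
    · rcases hs with rfl | rfl <;> simp
    · intro j _ hj
      simp [hj]
    · simp
  have := znorm_add_le (move u k s - y) (-Pi.single k s)
  rw [znorm_neg, h1, show move u k s - y + -Pi.single k s = u - y by simp only [move]; abel] at this
  linarith

lemma Setup.exists_greenHalf_move (S : Setup μ r i) {k : Fin d} (hk : k ≠ i) {s : ℤ}
    (hs : s = 1 ∨ s = -1) {ε : ℝ} (hε : 0 < ε) : ∃ c : ℝ, 0 < c ∧ ∃ C : ℝ, 0 < C ∧
      ∀ y, ∀ u ∈ half i, greenHalf μ i y (move u k s) ≤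
        ENNReal.ofReal (1 + ε) * greenHalf μ i y u +
          ENNReal.ofReal (C * Real.exp (-c * znorm (u - y))) := by
  set K := stepK μ (half i) with hK
  obtain ⟨m, p, hp0, hp1, hp⟩ := exists_pow_ge_move (μ := μ) S.irred_half k (s := s) hk
  have hshift1 : shiftK i k s 1 ≤ 1 := by
    intro x
    by_cases hx : x ∈ half i
    · rw [shiftK_of_mem hx]; simp
    · rw [shiftK_of_notMem hx]; simp
  obtain ⟨c, hc, C, hC, hr⟩ := ratio_of_commute (isKer_shiftK i k s) ((isKer_stepK μ (half i)).pow m)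
    hshift1 (fun x => pow_le_const S.nn S.sum _ (fun _ => le_rfl) m x)
    ((shiftK_commute hk s).pow_right m) (ENNReal.toReal_pos hp0 hp1)
    (fun f x => by
      rw [Pi.smul_apply, ENNReal.ofReal_toReal hp1]
      by_cases hx : x ∈ half i
      · rw [shiftK_of_mem hx]; exact hp x hx f
      · rw [shiftK_of_notMem hx]; simp) hε
  obtain ⟨D, hD, hg⟩ := S.exists_pot_single_le
  obtain ⟨α, l, hα, hl, hpow⟩ := S.exists_pow_single_le
  set η := α / (2 * (l + 1) * (m + 1)) with hη
  have hη0 : 0 < η := by positivity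
  refine ⟨min (c * η) (α / 2), by positivity, C * D.toReal + Real.exp α, by positivity,
    fun y u hu => ?_⟩
  set g := greenHalf μ i y with hgdef
  set N := znorm (u - y) with hN
  have hN0 : 0 ≤ N := znorm_nonneg _
  set n := ⌊η * N⌋₊ with hn
  have hn1 : η * N < n + 1 := Nat.lt_floor_add_one _
  have hn2 : (n : ℝ) ≤ η * N := Nat.floor_le (by positivity)
  have hgK : ∀ t, (K ^ t) g ≤ g :=
    pow_le_of_superharmonic (isKer_stepK _ _) (stepK_greenHalf_le y)
  have htel := telescope (L := K) (f := g) (s := Pi.single y 1) (s' := 0)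
    (by rw [add_zero]; exact stepK_greenHalf y) (m * n)
  simp only [map_zero, Finset.sum_const_zero, add_zero] at htel
  have h1 : g (move u k s) = ((K ^ m) ^ n) g (move u k s) +
      ∑ t ∈ Finset.range (m * n), (K ^ t) (Pi.single y 1) (move u k s) := by
    rw [← pow_mul]
    conv_lhs => rw [← htel]
    rw [Pi.add_apply, Finset.sum_apply]
  have h2 := hr n g D (fun x => hg _ _ _) u
  rw [shiftK_of_mem hu] at h2
  have h3 : ∑ t ∈ Finset.range (m * n), (K ^ t) (Pi.single y 1) (move u k s) ≤
      ENNReal.ofReal (Real.exp α * Real.exp (-(α / 2) * N)) := by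
    calc _ ≤ ∑ t ∈ Finset.range (m * n), ENNReal.ofReal (Real.exp (l * (m * n : ℕ) + α - α * N)) := by
          refine Finset.sum_le_sum fun t ht => (hpow _ t _ y).trans ?_
          apply ENNReal.ofReal_le_ofReal
          apply Real.exp_le_exp.mpr
          have ht' : (t : ℝ) ≤ (m * n : ℕ) := by exact_mod_cast (Finset.mem_range.mp ht).le
          nlinarith [znorm_move u y k hs]
      _ = ENNReal.ofReal ((m * n : ℕ) * Real.exp (l * (m * n : ℕ) + α - α * N)) := by
          rw [Finset.sum_const, Finset.card_range, nsmul_eq_mul,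
            ENNReal.ofReal_mul (by positivity), ENNReal.ofReal_natCast]
      _ ≤ _ := by
          apply ENNReal.ofReal_le_ofReal
          have hmn : ((m * n : ℕ) : ℝ) ≤ Real.exp (m * n : ℕ) := by
            linarith [Real.add_one_le_exp ((m * n : ℕ) : ℝ)]
          refine (mul_le_mul_of_nonneg_right hmn (Real.exp_pos _).le).trans ?_
          rw [← Real.exp_add, ← Real.exp_add]
          apply Real.exp_le_exp.mpr
          have h4 : (l + 1) * (m * n : ℕ) ≤ α / 2 * N := by
            calc (l + 1) * ((m * n : ℕ) : ℝ) ≤ (l + 1) * ((m + 1) * (η * N)) := by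
                  push_cast
                  gcongr
                  linarith
              _ = α / 2 * N := by rw [hη]; field_simp
          linarith
  rw [h1]
  refine (add_le_add h2 h3).trans ?_
  rw [add_assoc]
  refine add_le_add (mul_le_mul_right (by rw [← pow_mul]; exact hgK _ u) _) ?_
  rw [← ENNReal.ofReal_toReal hD, ← ENNReal.ofReal_mul (by positivity),
    ← ENNReal.ofReal_add (by positivity) (by positivity)]
  apply ENNReal.ofReal_le_ofReal
  rw [add_mul, ENNReal.toReal_ofReal ENNReal.toReal_nonneg, mul_right_comm]
  have e1 : min (c * η) (α / 2) * N ≤ c * (n + 1) := by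
    calc min (c * η) (α / 2) * N ≤ c * η * N := by gcongr; exact min_le_left _ _
      _ ≤ _ := by rw [mul_assoc]; gcongr
  have e2 : min (c * η) (α / 2) * N ≤ α / 2 * N := by gcongr; exact min_le_right _ _
  refine add_le_add ?_ ?_
  · refine mul_le_mul_of_nonneg_left (Real.exp_le_exp.mpr (by linarith)) (by positivity)
  · refine mul_le_mul_of_nonneg_left (Real.exp_le_exp.mpr (by linarith)) (by positivity)

/-- Exponentially decaying correction attached to the pole `y`. -/
noncomputable def bump (D c : ℝ) (y u : Fin d → ℤ) : ℝ≥0∞ :=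
  ENNReal.ofReal (D * Real.exp (-c * znorm (u - y)))

lemma Setup.exists_lateral (S : Setup μ r i) {ε : ℝ} (hε : 0 < ε) : ∃ c D : ℝ, 0 < c ∧ 0 < D ∧
    ∀ y, ∀ u ∈ half i, ∀ u' ∈ half i, u i = u' i →
      greenHalf μ i y u' ≤ ENNReal.ofReal (Real.exp (ε * znorm (u' - u))) *
        (greenHalf μ i y u + bump D c y u) := by
  have key : ∀ k : {k : Fin d // k ≠ i}, ∀ s : {s : ℤ // s = 1 ∨ s = -1}, ∀ᶠ c in 𝓝[>] (0 : ℝ),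
      ∀ᶠ D in atTop, ∀ y, ∀ u ∈ half i,
        greenHalf μ i y (move u k s) + bump D c y (move u k s) ≤
          ENNReal.ofReal (Real.exp ε) * (greenHalf μ i y u + bump D c y u) := by
    intro k s
    obtain ⟨c₀, hc₀, C, hC, h⟩ := S.exists_greenHalf_move k.2 s.2 (half_pos hε)
    have hcm : (0 : ℝ) < min c₀ (Real.log (1 + ε / 2)) :=
      lt_min hc₀ (Real.log_pos (by linarith))
    filter_upwards [Ioc_mem_nhdsGT hcm] with c hc
    filter_upwards [eventually_ge_atTop (2 * C / ε)] with D hD y u hu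
    have hD' : 2 * C ≤ D * ε := by rwa [div_le_iff₀ hε] at hD
    have hD0 : 0 ≤ D := le_trans (by positivity) hD
    have hec : Real.exp c ≤ 1 + ε / 2 := by
      rw [← Real.le_log_iff_exp_le (by positivity)]
      exact hc.2.trans (min_le_right _ _)
    have hee : 1 + ε ≤ Real.exp ε := by linarith [Real.add_one_le_exp ε]
    have h1 := h y u hu
    have hN0 : 0 ≤ znorm (u - y) := znorm_nonneg _
    have hN := znorm_move u y k s.2
    set N := znorm (u - y) with hNdef
    have h2 : C * Real.exp (-c₀ * N) + D * Real.exp (-c * znorm (move u k s - y)) ≤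
        Real.exp ε * (D * Real.exp (-c * N)) := by
      have e1 : Real.exp (-c₀ * N) ≤ Real.exp (-c * N) := by
        apply Real.exp_le_exp.mpr
        nlinarith [hc.2.trans (min_le_left _ _)]
      have e2 : Real.exp (-c * znorm (move u k s - y)) ≤ Real.exp c * Real.exp (-c * N) := by
        rw [← Real.exp_add]
        apply Real.exp_le_exp.mpr
        nlinarith [hc.1]
      have e3 := Real.exp_pos (-c * N)
      calc C * Real.exp (-c₀ * N) + D * Real.exp (-c * znorm (move u k s - y))
          ≤ C * Real.exp (-c * N) + D * ((1 + ε / 2) * Real.exp (-c * N)) := by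
            gcongr
            exact e2.trans (by gcongr)
        _ = (C + D * (1 + ε / 2)) * Real.exp (-c * N) := by ring
        _ ≤ (Real.exp ε * D) * Real.exp (-c * N) := by
            gcongr
            nlinarith
        _ = _ := by ring
    calc _ ≤ ENNReal.ofReal (1 + ε / 2) * greenHalf μ i y u +
          ENNReal.ofReal (C * Real.exp (-c₀ * N)) + bump D c y (move u k s) := by gcongr
      _ = ENNReal.ofReal (1 + ε / 2) * greenHalf μ i y u + ENNReal.ofReal
          (C * Real.exp (-c₀ * N) + D * Real.exp (-c * znorm (move u k s - y))) := by
          rw [add_assoc, bump, ← ENNReal.ofReal_add (by positivity) (by positivity)]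
      _ ≤ ENNReal.ofReal (Real.exp ε) * greenHalf μ i y u +
          ENNReal.ofReal (Real.exp ε * (D * Real.exp (-c * N))) := by
          gcongr
          linarith
      _ = _ := by
          rw [mul_add, bump, ENNReal.ofReal_mul (Real.exp_pos ε).le]
  have : Finite {s : ℤ // s = 1 ∨ s = -1} := by
    refine Set.Finite.to_subtype (s := {s : ℤ | s = 1 ∨ s = -1}) ?_
    exact (Set.toFinite {1, -1})
  have key2 : ∀ᶠ c in 𝓝[>] (0 : ℝ), ∀ᶠ D in atTop, ∀ (k : {k : Fin d // k ≠ i})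
      (s : {s : ℤ // s = 1 ∨ s = -1}), ∀ y, ∀ u ∈ half i,
        greenHalf μ i y (move u k s) + bump D c y (move u k s) ≤
          ENNReal.ofReal (Real.exp ε) * (greenHalf μ i y u + bump D c y u) := by
    simp only [eventually_all] at key ⊢
    exact key
  obtain ⟨c, hc, hc0⟩ := (key2.and self_mem_nhdsWithin).exists
  obtain ⟨D, hD, hD0⟩ := (hc.and (eventually_gt_atTop 0)).exists
  refine ⟨c, D, hc0, hD0, fun y u hu u' hu' huu => ?_⟩
  have := chain (i := i) (f := fun u => greenHalf μ i y u + bump D c y u)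
    (D := ENNReal.ofReal (Real.exp ε)) (P := fun k => k ≠ i)
    (fun v hv k s hk hs _ => hD ⟨k, hk⟩ ⟨s, hs⟩ y v hv) _ hu hu' rfl
    (fun k hk => by rw [not_not.mp hk]; exact huu)
  refine le_self_add.trans (this.trans (le_of_eq ?_))
  rw [← ENNReal.ofReal_pow (Real.exp_pos _).le, ← Real.exp_nat_mul, znorm_eq_l1, mul_comm]
  simp only [mul_comm]

end Lateral

lemma smul_pow_le {V : Type*} {L : Module.End ℝ≥0∞ (V → ℝ≥0∞)} (h : IsKer L) {f : V → ℝ≥0∞}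
    {q : ℝ≥0∞} (hf : q • f ≤ L f) (n : ℕ) : q ^ n • f ≤ (L ^ n) f := by
  induction n with
  | zero => simp
  | succ n ih =>
    rw [pow_succ, pow_succ, Module.End.mul_apply, mul_comm, mul_smul]
    calc q • q ^ n • f ≤ q • (L ^ n) f := by gcongr
      _ = (L ^ n) (q • f) := (map_smul _ _ _).symm
      _ ≤ _ := (h.pow n).mono hf

section Vertical

variable {d : ℕ} {μ : (Fin d → ℤ) → ℝ} {r : ℝ} {i : Fin d}

lemma pow_translate_le {w : Fin d → ℤ} (hw : 0 ≤ w i) (n : ℕ) (f : (Fin d → ℤ) → ℝ≥0∞)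
    (x : Fin d → ℤ) :
    ((stepK μ (half i)) ^ n) (fun y => f (y + w)) x ≤ ((stepK μ (half i)) ^ n) f (x + w) := by
  induction n generalizing x with
  | zero => simp
  | succ n ih =>
    rw [pow_succ', Module.End.mul_apply, Module.End.mul_apply]
    have hmem : ∀ y, y ∈ half i → y + w ∈ half i := by
      intro y hy
      rw [mem_half] at hy ⊢
      rw [Pi.add_apply]
      omega
    by_cases hx : x ∈ half i
    · rw [stepK_apply hx, stepK_apply (hmem x hx)]
      refine ENNReal.tsum_le_tsum fun z => ?_
      gcongr
      by_cases hz : x + z ∈ half i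
      · have e : x + w + z = x + z + w := by abel
        rw [if_pos hz, e, if_pos (hmem _ hz)]
        exact ih _
      · simp [hz]
    · simp [stepK_of_notMem hx]

lemma Setup.exists_exp_le_stepK (S : Setup μ r i) {α : ℝ} (hα : 0 < α) (hαr : α ≤ r) :
    ∃ φ : ℝ, 1 < φ ∧ ENNReal.ofReal φ • (fun x => ENNReal.ofReal (Real.exp (α * x i) - 1)) ≤
      stepK μ (half i) (fun x => ENNReal.ofReal (Real.exp (α * x i) - 1)) := by
  have hαr' : |α| ≤ r := by rwa [abs_of_pos hα]
  refine ⟨_, S.one_lt_exp_moment hαr' hα.ne', fun x => ?_⟩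
  set φ := ∑' z, μ z * Real.exp (α * z i) with hφ
  have hφ1 : 1 < φ := S.one_lt_exp_moment hαr' hα.ne'
  simp only [Pi.smul_apply, smul_eq_mul]
  by_cases hx : x ∈ half i
  · have h1 := avg_exp_coord S.toExpStep hαr' i x
    have h2 : avg μ (fun y => ENNReal.ofReal (Real.exp (α * y i))) x ≤
        stepK μ (half i) (fun x => ENNReal.ofReal (Real.exp (α * x i) - 1)) x + 1 := by
      rw [← avg_one S.nn S.sum 1 x, stepK_apply hx, avg, avg, ← ENNReal.tsum_add]
      refine ENNReal.tsum_le_tsum fun z => ?_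
      rw [← mul_add]
      gcongr
      split_ifs with hz
      · rw [← ENNReal.ofReal_one, ← ENNReal.ofReal_add _ zero_le_one, sub_add_cancel]
        rw [sub_nonneg]
        apply Real.one_le_exp
        have : (0 : ℝ) < ((x + z) i : ℤ) := by exact_mod_cast hz
        positivity
      · rw [zero_add, ENNReal.ofReal_le_one]
        apply Real.exp_le_one_iff.mpr
        have : (((x + z) i : ℤ) : ℝ) ≤ 0 := by exact_mod_cast not_lt.mp hz
        nlinarith
    rw [h1] at h2
    have hx0 : (0 : ℝ) < x i := by exact_mod_cast hx
    have he : 1 ≤ Real.exp (α * x i) := Real.one_le_exp (by positivity)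
    refine ENNReal.le_of_add_le_add_right ENNReal.one_ne_top (le_trans ?_ h2)
    rw [← ENNReal.ofReal_mul (by linarith), ← ENNReal.ofReal_mul (by linarith),
      ← ENNReal.ofReal_one, ← ENNReal.ofReal_add (by nlinarith) zero_le_one]
    apply ENNReal.ofReal_le_ofReal
    linarith
  · have : (x i : ℝ) ≤ 0 := by exact_mod_cast not_lt.mp hx
    rw [ENNReal.ofReal_of_nonpos (p := Real.exp (α * x i) - 1)]
    · simp
    · rw [sub_nonpos]
      apply Real.exp_le_one_iff.mpr
      nlinarith

lemma Setup.exists_climb (S : Setup μ r i) {ε : ℝ} (hε : 0 < ε) : ∃ (t m : ℕ) (R : ℝ), 1 ≤ m ∧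
    ∀ u ∈ half i, ENNReal.ofReal (Real.exp (-ε * m)) ≤ ((stepK μ (half i)) ^ t)
      (fun w => if w i = u i + m ∧ znorm (w - u) ≤ R then 1 else 0) u := by
  set K := stepK μ (half i) with hK
  set b : Fin d → ℤ := Pi.single i 1 with hb
  have hbi : b i = 1 := by simp [hb]
  suffices h : ∃ (t m : ℕ) (R : ℝ), 1 ≤ m ∧ ENNReal.ofReal (Real.exp (-ε * m)) ≤ (K ^ t)
      (fun w => if w i = b i + m ∧ znorm (w - b) ≤ R then 1 else 0) b by
    obtain ⟨t, m, R, hm, h⟩ := h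
    refine ⟨t, m, R, hm, fun u hu => ?_⟩
    have := pow_translate_le (μ := μ) (i := i) (w := u - b) (by
      rw [mem_half] at hu
      rw [Pi.sub_apply, hbi]
      omega) t (fun w => if w i = u i + m ∧ znorm (w - u) ≤ R then 1 else 0) b
    rw [add_sub_cancel] at this
    refine h.trans (le_trans (le_of_eq ?_) this)
    refine congrFun (congrArg (K ^ t) (funext fun w => ?_)) b
    have e1 : (w + (u - b)) i = u i + m ↔ w i = b i + m := by
      simp only [Pi.add_apply, Pi.sub_apply]
      omega
    have e2 : w + (u - b) - u = w - b := by abel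
    simp only [e1, e2]
  by_contra! hcon
  have hlev : ∀ t m : ℕ, (K ^ t) (fun w => if w i = b i + m then 1 else 0) b ≤
      if m = 0 then 1 else ENNReal.ofReal (Real.exp (-ε * m)) := by
    intro t m
    split_ifs with hm
    · exact pow_le_const S.nn S.sum _ (fun w => by split_ifs <;> simp) t b
    · rw [((isKer_stepK _ _).pow t).apply_eq, ENNReal.tsum_eq_iSup_sum]
      refine iSup_le fun s => ?_
      refine le_trans ?_ (hcon t m (∑ w ∈ s, znorm (w - b)) (by omega)).le
      rw [((isKer_stepK _ _).pow t).apply_eq]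
      refine le_trans (Finset.sum_le_sum fun w hw => ?_) (ENNReal.sum_le_tsum s)
      gcongr
      have : znorm (w - b) ≤ ∑ w ∈ s, znorm (w - b) :=
        Finset.single_le_sum (f := fun w => znorm (w - b)) (fun _ _ => znorm_nonneg _) hw
      simp [this]
  have hr := S.pos
  set α := min (ε / 2) r with hα
  have hα0 : 0 < α := by positivity
  have hαε : α ≤ ε / 2 := min_le_left _ _
  obtain ⟨φ, hφ, hgrow⟩ := S.exists_exp_le_stepK hα0 (min_le_right _ _)
  set f : (Fin d → ℤ) → ℝ≥0∞ := fun x => ENNReal.ofReal (Real.exp (α * x i) - 1) with hf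
  set q := ENNReal.ofReal (Real.exp (-(ε / 2))) with hq
  have hq1 : q < 1 := by
    rw [hq, ENNReal.ofReal_lt_one, Real.exp_lt_one_iff]
    linarith
  have hbound : ∀ t, (K ^ t) f b ≤ ENNReal.ofReal (Real.exp α) * (1 - q)⁻¹ := by
    intro t
    have h1 : f ≤ fun x => ∑' m : ℕ, (ENNReal.ofReal (Real.exp (α * (1 + m))) •
        fun w : Fin d → ℤ => if w i = b i + m then (1 : ℝ≥0∞) else 0) x := by
      intro x
      by_cases hx : 0 < x i
      · refine le_trans ?_ (ENNReal.le_tsum (x i - 1).toNat)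
        have e : x i = b i + ((x i - 1).toNat : ℤ) := by rw [hbi]; omega
        have e' : (x i : ℝ) = 1 + ((x i - 1).toNat : ℝ) := by rw [hbi] at e; exact_mod_cast e
        simp only [Pi.smul_apply, smul_eq_mul]
        rw [if_pos e, mul_one, ← e', hf]
        apply ENNReal.ofReal_le_ofReal
        linarith
      · have : (x i : ℝ) ≤ 0 := by exact_mod_cast not_lt.mp hx
        rw [hf]
        dsimp only
        rw [ENNReal.ofReal_of_nonpos]
        · exact zero_le
        · rw [sub_nonpos]
          apply Real.exp_le_one_iff.mpr
          nlinarith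
    refine (((isKer_stepK _ _).pow t).mono h1 b).trans ?_
    rw [((isKer_stepK _ _).pow t).tsum, ← ENNReal.tsum_geometric, ← ENNReal.tsum_mul_left]
    refine ENNReal.tsum_le_tsum fun m => ?_
    rw [map_smul, Pi.smul_apply, smul_eq_mul]
    refine (mul_le_mul_right (hlev t m) _).trans ?_
    rw [hq, ← ENNReal.ofReal_pow (Real.exp_pos _).le, ← Real.exp_nat_mul,
      ← ENNReal.ofReal_mul (Real.exp_pos _).le, ← Real.exp_add]
    split_ifs with hm
    · simp [hm]
    · rw [← ENNReal.ofReal_mul (Real.exp_pos _).le, ← Real.exp_add]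
      apply ENNReal.ofReal_le_ofReal
      apply Real.exp_le_exp.mpr
      nlinarith [(Nat.cast_nonneg m : (0 : ℝ) ≤ m)]
  have hfb : f b ≠ 0 := by
    simp only [hf, hbi, Int.cast_one, mul_one, Ne, ENNReal.ofReal_eq_zero, not_le, sub_pos]
    exact Real.one_lt_exp_iff.mpr hα0
  have hlow : ∀ t : ℕ, ENNReal.ofReal φ ^ t * f b ≤ (K ^ t) f b :=
    fun t => smul_pow_le (isKer_stepK _ _) hgrow t b
  have htend : Tendsto (fun t : ℕ => ENNReal.ofReal φ ^ t * f b) atTop (𝓝 ⊤) := by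
    have h1 : Tendsto (fun t : ℕ => ENNReal.ofReal φ ^ t) atTop (𝓝 ⊤) :=
      ENNReal.tendsto_pow_atTop_nhds_top_iff.mpr (by rwa [ENNReal.one_lt_ofReal])
    have := ENNReal.Tendsto.mul_const h1 (b := f b) (Or.inl ENNReal.top_ne_zero)
    rwa [ENNReal.top_mul hfb] at this
  have := le_of_tendsto' htend fun t => (hlow t).trans (hbound t)
  rw [top_le_iff] at this
  refine ENNReal.mul_ne_top ENNReal.ofReal_ne_top ?_ this
  rw [Ne, ENNReal.inv_eq_top, tsub_eq_zero_iff_le, not_le]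
  exact hq1

end Vertical

section LowerBound

variable {d : ℕ} {μ : (Fin d → ℤ) → ℝ} {r : ℝ} {i : Fin d}

lemma cut_half_coordPos : cut (half i) (coordPos i) = coordPos i := by
  funext x
  by_cases hx : x ∈ half i
  · rw [cut_of_mem hx]
  · rw [cut_of_notMem hx, coordPos, ENNReal.ofReal_of_nonpos]
    exact_mod_cast not_lt.mp hx

lemma Setup.coordPos_le_pow (S : Setup μ r i) (n : ℕ) :
    coordPos i ≤ (stepK μ (half i) ^ n) (coordPos i) := by
  have h : (1 : ℝ≥0∞) • coordPos i ≤ stepK μ (half i) (coordPos i) := by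
    have h1 := S.step_coordPos (subset_refl (half i))
    have h2 : exitK μ (half i) (coordPos i) = 0 := by
      rw [exitK_congr (g := 0), map_zero]
      intro x hx
      rw [← cut_half_coordPos, cut_of_notMem hx, Pi.zero_apply]
    rw [h2, cut_half_coordPos, add_zero] at h1
    rw [h1, one_smul]
    exact le_self_add
  simpa using smul_pow_le (isKer_stepK _ _) h n

lemma Setup.tendsto_deviation (S : Setup μ r i) (k : Fin d) {σ : ℝ} (hσ : |σ| = 1) {η : ℝ}
    (hη : 0 < η) (x : Fin d → ℤ) :
    Tendsto (fun t : ℕ => (stepK μ (half i) ^ t)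
      (fun w => if η * t < σ * (w k - t * Mvec μ k) then coordPos i w else 0) x) atTop (𝓝 0) := by
  obtain ⟨C, hC, hav⟩ := S.exists_avg_exp_le
  have hr := S.pos
  set β := min (r / 4) (η / (8 * C)) with hβ
  have hβ0 : 0 < β := by positivity
  have hβ1 : β ≤ r / 4 := min_le_left _ _
  have hβ2 : 8 * C * β ≤ η := by
    have : β ≤ η / (8 * C) := min_le_right _ _
    rw [le_div_iff₀ (by positivity)] at this
    linarith
  clear_value β
  set F : (Fin d → ℤ) → ℝ≥0∞ := fun y => ENNReal.ofReal (Real.exp (β * y i + β * σ * y k)) with hF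
  have hstep : stepK μ (half i) F ≤
      ENNReal.ofReal (Real.exp (β * σ * Mvec μ k + C * (2 * β) ^ 2)) • F := by
    refine (stepK_le_avg _ _).trans fun y => ?_
    have h := hav (fun y => β * y i + β * σ * y k) (fun z => β * z i + β * σ * z k) (2 * β)
      (by linarith) (fun z => ?_) (fun y z => le_of_eq ?_) y
    · have e : ∑' z, μ z * (β * z i + β * σ * z k) = β * σ * Mvec μ k := by
        have := (S.hasSum_coord.mul_left β).add ((S.summable_coord k).hasSum.mul_left (β * σ))
        rw [mul_zero, zero_add] at this
        rw [Mvec, ← this.tsum_eq]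
        exact tsum_congr fun z => by ring
      rw [e] at h
      exact h
    · refine (abs_add_le _ _).trans ?_
      rw [abs_mul, abs_mul, abs_mul, hσ, abs_of_pos hβ0]
      nlinarith [abs_coord_le z i, abs_coord_le z k]
    · simp only [Pi.add_apply]
      push_cast
      ring
  have hbound : ∀ t : ℕ, (stepK μ (half i) ^ t)
      (fun w => if η * t < σ * (w k - t * Mvec μ k) then coordPos i w else 0) x ≤
      ENNReal.ofReal (β⁻¹) * F x * ENNReal.ofReal (Real.exp (-(β * η / 2))) ^ t := by
    intro t
    have h1 : (fun w => if η * t < σ * (w k - t * Mvec μ k) then coordPos i w else 0) ≤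
        ENNReal.ofReal (β⁻¹ * Real.exp (-(β * σ * t * Mvec μ k) - β * η * t)) • F := by
      intro w
      dsimp only
      split_ifs with hw
      · rw [Pi.smul_apply, smul_eq_mul, coordPos, hF, ← ENNReal.ofReal_mul (by positivity),
          mul_assoc, ← Real.exp_add]
        apply ENNReal.ofReal_le_ofReal
        rw [← div_eq_inv_mul, le_div_iff₀ hβ0]
        have h2 : (w i : ℝ) * β + 1 ≤ Real.exp (w i * β) := Real.add_one_le_exp _
        have h3 : Real.exp (w i * β) ≤ Real.exp (-(β * σ * t * Mvec μ k) - β * η * t +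
            (β * w i + β * σ * w k)) := by
          apply Real.exp_le_exp.mpr
          nlinarith
        linarith
      · exact zero_le
    refine (((isKer_stepK _ _).pow t).mono h1 x).trans ?_
    rw [map_smul, Pi.smul_apply, smul_eq_mul]
    refine (mul_le_mul_right (pow_le_smul_of_le (isKer_stepK _ _) hstep t x) _).trans ?_
    rw [Pi.smul_apply, smul_eq_mul, hF, ← ENNReal.ofReal_pow (by positivity),
      ← ENNReal.ofReal_pow (by positivity), ← Real.exp_nat_mul, ← Real.exp_nat_mul,
      ← ENNReal.ofReal_mul (by positivity), ← ENNReal.ofReal_mul (by positivity),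
      ← ENNReal.ofReal_mul (by positivity), ← ENNReal.ofReal_mul (by positivity)]
    apply ENNReal.ofReal_le_ofReal
    rw [mul_assoc (β⁻¹), mul_assoc (β⁻¹)]
    refine mul_le_mul_of_nonneg_left (a := β⁻¹) ?_ (by positivity)
    rw [← Real.exp_add, ← Real.exp_add, ← Real.exp_add]
    apply Real.exp_le_exp.mpr
    have ht : (0 : ℝ) ≤ t := Nat.cast_nonneg t
    nlinarith [mul_nonneg (mul_nonneg ht hβ0.le) (sub_nonneg.mpr hβ2)]
  have hq : ENNReal.ofReal (Real.exp (-(β * η / 2))) < 1 := by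
    rw [ENNReal.ofReal_lt_one, Real.exp_lt_one_iff]
    have := mul_pos hβ0 hη
    linarith
  have h0 := ENNReal.Tendsto.const_mul (a := ENNReal.ofReal β⁻¹ * F x)
    (ENNReal.tendsto_pow_atTop_nhds_zero_of_lt_one hq)
    (Or.inr (ENNReal.mul_ne_top ENNReal.ofReal_ne_top ENNReal.ofReal_ne_top))
  rw [mul_zero] at h0
  exact tendsto_of_tendsto_of_tendsto_of_le_of_le tendsto_const_nhds h0 (fun _ => zero_le) hbound

lemma Setup.eventually_concentration (S : Setup μ r i) {η : ℝ} (hη : 0 < η) {x : Fin d → ℤ}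
    (hx : x ∈ half i) : ∀ᶠ t : ℕ in atTop, 2⁻¹ ≤ (stepK μ (half i) ^ t)
      (fun w => if ∀ k, |(w k : ℝ) - t * Mvec μ k| ≤ η * t then coordPos i w else 0) x := by
  have h1 := tendsto_finsetSum (Finset.univ : Finset (Fin d)) fun k _ =>
    (S.tendsto_deviation k (σ := 1) (by simp) hη x).add
      (S.tendsto_deviation k (σ := -1) (by simp) hη x)
  simp only [add_zero, Finset.sum_const_zero] at h1
  filter_upwards [h1.eventually (ge_mem_nhds (show (0 : ℝ≥0∞) < 2⁻¹ by simp))] with t ht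
  have hxi : 1 ≤ coordPos i x := by
    rw [coordPos, ENNReal.one_le_ofReal]
    exact_mod_cast hx
  have h2 := hxi.trans (S.coordPos_le_pow t x)
  set good : (Fin d → ℤ) → ℝ≥0∞ := fun w =>
    if ∀ k, |(w k : ℝ) - t * Mvec μ k| ≤ η * t then coordPos i w else 0 with hgood
  have hle : coordPos i ≤ fun w => ∑' j : Option (Fin d), (fun j w => match j with
      | none => good w
      | some k => (if η * t < 1 * (w k - t * Mvec μ k) then coordPos i w else 0) +
        (if η * t < -1 * (w k - t * Mvec μ k) then coordPos i w else 0)) j w := by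
    intro w
    by_cases hw : ∀ k, |(w k : ℝ) - t * Mvec μ k| ≤ η * t
    · refine le_trans ?_ (ENNReal.le_tsum none)
      simp only [hgood]
      rw [if_pos hw]
    · push Not at hw
      obtain ⟨k, hk⟩ := hw
      refine le_trans ?_ (ENNReal.le_tsum (some k))
      dsimp only
      rcases lt_abs.mp hk with h | h
      · rw [if_pos (by linarith)]
        exact le_self_add
      · rw [if_pos (c := η * t < -1 * (w k - t * Mvec μ k)) (by linarith)]
        exact le_add_self
  have h3 := h2.trans (((isKer_stepK _ _).pow t).mono hle x)
  rw [((isKer_stepK _ _).pow t).tsum, tsum_fintype, Fintype.sum_option] at h3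
  have h4 : ∀ f g : (Fin d → ℤ) → ℝ≥0∞, (stepK μ (half i) ^ t) (fun w => f w + g w) x =
      (stepK μ (half i) ^ t) f x + (stepK μ (half i) ^ t) g x := fun f g =>
    congrFun (map_add (stepK μ (half i) ^ t) f g) x
  simp only [h4] at h3
  refine ENNReal.le_of_add_le_add_right (a := 2⁻¹) (by simp) ?_
  rw [ENNReal.inv_two_add_inv_two]
  exact h3.trans (add_le_add_right ht _)

lemma exists_exp_ge {D : ℝ≥0∞} (hD : D ≠ ⊤) : ∃ κ : ℝ, 0 < κ ∧ D ≤ ENNReal.ofReal (Real.exp κ) := by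
  refine ⟨D.toReal + 1, by positivity, ?_⟩
  rw [← ENNReal.ofReal_toReal hD]
  apply ENNReal.ofReal_le_ofReal
  rw [ENNReal.toReal_ofReal ENNReal.toReal_nonneg]
  linarith [Real.add_one_le_exp (D.toReal + 1)]

lemma Setup.exists_harnack_exp (S : Setup μ r i) : ∃ κ : ℝ, 0 < κ ∧
    ∀ f : (Fin d → ℤ) → ℝ≥0∞, stepK μ (half i) f ≤ f → ∀ u ∈ half i, ∀ u' ∈ half i,
      f u' ≤ ENNReal.ofReal (Real.exp (κ * znorm (u' - u))) * f u := by
  obtain ⟨D, -, hD, h⟩ := exists_harnack (μ := μ) S.irred_half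
  obtain ⟨κ, hκ, hκD⟩ := exists_exp_ge hD
  refine ⟨κ, hκ, fun f hf u hu u' hu' => (h f hf u hu u' hu').trans ?_⟩
  gcongr
  refine (pow_le_pow_left' hκD _).trans (le_of_eq ?_)
  rw [← ENNReal.ofReal_pow (Real.exp_pos _).le, ← Real.exp_nat_mul, znorm_eq_l1, mul_comm]

lemma Setup.eventually_exp_le_greenHalf (S : Setup μ r i) {x : Fin d → ℤ} (hx : x ∈ half i)
    {xs : ℕ → Fin d → ℤ} (hxs : ∀ n, xs n ∈ half i)
    (htop : Tendsto (fun n => znorm (xs n)) atTop atTop) {ρ : ℝ} (hρ : 0 < ρ)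
    (hdir : ∀ k, Tendsto (fun n => (xs n k : ℝ) / znorm (xs n)) atTop (𝓝 (Mvec μ k / ρ)))
    {ε : ℝ} (hε : 0 < ε) :
    ∀ᶠ n in atTop, ENNReal.ofReal (Real.exp (-(ε * znorm (xs n)))) ≤ greenHalf μ i (xs n) x := by
  obtain ⟨κ, hκ, hharn⟩ := S.exists_harnack_exp
  set B := ρ⁻¹ + κ * (d * (1 + ρ⁻¹)) + 1 with hB
  have hB0 : 0 < B := by positivity
  set η := ε / (2 * B) with hη
  have hη0 : 0 < η := by positivity
  have hηB : η * B = ε / 2 := by rw [hη]; field_simp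
  have hfloor : Tendsto (fun n => (⌊ρ⁻¹ * znorm (xs n)⌋₊ : ℝ) / znorm (xs n)) atTop (𝓝 ρ⁻¹) :=
    (tendsto_nat_floor_mul_div_atTop (by positivity)).comp htop
  have hdev : ∀ k, ∀ᶠ n in atTop,
      |(xs n k : ℝ) / znorm (xs n) - ⌊ρ⁻¹ * znorm (xs n)⌋₊ / znorm (xs n) * Mvec μ k| < η := by
    intro k
    have := (((hdir k).sub (hfloor.mul_const (Mvec μ k))).abs)
    rw [div_eq_inv_mul (Mvec μ k), sub_self, abs_zero] at this
    exact this.eventually (gt_mem_nhds hη0)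
  have hftop : Tendsto (fun n => ⌊ρ⁻¹ * znorm (xs n)⌋₊) atTop atTop :=
    tendsto_nat_floor_atTop.comp (htop.const_mul_atTop (by positivity))
  filter_upwards [hftop.eventually (S.eventually_concentration hη0 hx), eventually_all.mpr hdev,
    htop.eventually_ge_atTop (2 / ε)] with n hconc hn hN
  set N := znorm (xs n) with hNdef
  set t := ⌊ρ⁻¹ * N⌋₊ with ht
  set y := xs n with hy
  have hN0 : 0 < N := lt_of_lt_of_le (by positivity) hN
  have htN : (t : ℝ) ≤ ρ⁻¹ * N := Nat.floor_le (by positivity)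
  have hNε : 2 ≤ N * ε := by rwa [div_le_iff₀ hε] at hN
  have hclose : ∀ k, |(y k : ℝ) - t * Mvec μ k| ≤ η * N := by
    intro k
    have h1 := (hn k).le
    have e : (y k : ℝ) - t * Mvec μ k = (y k / N - t / N * Mvec μ k) * N := by field_simp
    rw [e, abs_mul, abs_of_pos hN0]
    exact mul_le_mul_of_nonneg_right h1 hN0.le
  clear_value t N y
  have ht0 : (0 : ℝ) ≤ t := Nat.cast_nonneg t
  have hyH : y ∈ half i := hy ▸ hxs n
  have hg1 : 1 ≤ greenHalf μ i y y := by
    have := le_pot (stepK μ (half i)) (Pi.single y 1) y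
    rwa [Pi.single_eq_same] at this
  have hpt : (fun w => if ∀ k, |(w k : ℝ) - t * Mvec μ k| ≤ η * t then coordPos i w else 0) ≤
      ENNReal.ofReal (Real.exp (η * t + κ * (d * (η * N + η * t)))) • greenHalf μ i y := by
    intro w
    dsimp only
    by_cases hw : w ∈ half i
    · split_ifs with h
      · have h1 : coordPos i w ≤ ENNReal.ofReal (Real.exp (η * t)) := by
          apply ENNReal.ofReal_le_ofReal
          have := h i
          rw [S.mean_zero, mul_zero, sub_zero] at this
          linarith [le_abs_self (w i : ℝ), Real.add_one_le_exp (η * t)]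
        have h2 : znorm (y - w) ≤ d * (η * N + η * t) := by
          rw [znorm]
          refine (Finset.sum_le_card_nsmul _ _ (η * N + η * t) fun k _ => ?_).trans ?_
          · rw [Pi.sub_apply]
            push_cast
            have := abs_sub_le (y k : ℝ) (t * Mvec μ k) (w k)
            rw [abs_sub_comm (t * Mvec μ k)] at this
            linarith [hclose k, h k]
          · simp [mul_add]
        have h3 := hg1.trans (hharn _ (stepK_greenHalf_le y) w hw y hyH)
        calc coordPos i w ≤ ENNReal.ofReal (Real.exp (η * t)) * 1 := by rwa [mul_one]
          _ ≤ ENNReal.ofReal (Real.exp (η * t)) *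
              (ENNReal.ofReal (Real.exp (κ * znorm (y - w))) * greenHalf μ i y w) := by gcongr
          _ ≤ ENNReal.ofReal (Real.exp (η * t)) *
              (ENNReal.ofReal (Real.exp (κ * (d * (η * N + η * t)))) * greenHalf μ i y w) := by
            gcongr
          _ = _ := by
            rw [Pi.smul_apply, smul_eq_mul, ← mul_assoc, ← ENNReal.ofReal_mul (by positivity),
              ← Real.exp_add]
      · exact zero_le
    · rw [← cut_half_coordPos, cut_of_notMem hw, ite_self]
      exact zero_le
  have hfin := hconc.trans (((isKer_stepK _ _).pow t).mono hpt x)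
  rw [map_smul, Pi.smul_apply, smul_eq_mul] at hfin
  replace hfin := hfin.trans (mul_le_mul_right
    (pow_le_of_superharmonic (isKer_stepK _ _) (stepK_greenHalf_le y) t x) _)
  have hexp : Real.exp (-(ε * N)) * Real.exp (η * t + κ * (d * (η * N + η * t))) ≤ 2⁻¹ := by
    rw [← Real.exp_add]
    have h1 : -(ε * N) + (η * t + κ * (d * (η * N + η * t))) ≤ -1 := by
      have h2 : η * t + κ * (d * (η * N + η * t)) ≤ η * B * N := by
        have h3 : η * t ≤ η * (ρ⁻¹ * N) := mul_le_mul_of_nonneg_left htN hη0.le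
        have h4 : κ * (d * (η * N + η * t)) ≤ κ * (d * (η * N + η * (ρ⁻¹ * N))) := by gcongr
        rw [hB]
        nlinarith [mul_pos hη0 hN0]
      rw [hηB] at h2
      nlinarith
    refine (Real.exp_le_exp.mpr h1).trans ?_
    rw [Real.exp_neg]
    exact inv_anti₀ two_pos (by linarith [Real.add_one_le_exp (1 : ℝ)])
  calc ENNReal.ofReal (Real.exp (-(ε * N)))
      = 2 * (ENNReal.ofReal (Real.exp (-(ε * N))) * 2⁻¹) := by
        rw [mul_left_comm, ENNReal.mul_inv_cancel (by simp) (by simp), mul_one]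
    _ ≤ 2 * (ENNReal.ofReal (Real.exp (-(ε * N))) *
        (ENNReal.ofReal (Real.exp (η * t + κ * (d * (η * N + η * t)))) * greenHalf μ i y x)) := by
      gcongr
    _ = 2 * (ENNReal.ofReal (Real.exp (-(ε * N)) *
        Real.exp (η * t + κ * (d * (η * N + η * t)))) * greenHalf μ i y x) := by
      rw [ENNReal.ofReal_mul (by positivity), mul_assoc]
    _ ≤ 2 * (ENNReal.ofReal 2⁻¹ * greenHalf μ i y x) := by gcongr
    _ = greenHalf μ i y x := by
      rw [← mul_assoc, ENNReal.ofReal_inv_of_pos two_pos, ENNReal.ofReal_ofNat,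
        ENNReal.mul_inv_cancel (by simp) (by simp), one_mul]

end LowerBound

section Domination

variable {d : ℕ} {μ : (Fin d → ℤ) → ℝ} {r : ℝ} {i : Fin d}

lemma znorm_single (k : Fin d) (s : ℤ) : znorm (Pi.single k s : Fin d → ℤ) = |(s : ℝ)| := by
  rw [znorm, Finset.sum_eq_single k]
  · simp
  · intro j _ hj
    simp [hj]
  · simp

lemma Setup.exists_greenHalf_climb (S : Setup μ r i) {ε : ℝ} (hε : 0 < ε) :
    ∃ m : ℕ, 1 ≤ m ∧ ∃ c C : ℝ, 0 < c ∧ 0 < C ∧ ∀ y, ∀ u ∈ half i,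
      greenHalf μ i y (move u i m) ≤ ENNReal.ofReal (Real.exp (ε * m)) *
        (greenHalf μ i y u + bump C c y u) := by
  obtain ⟨t, m, R₀, hm, hcl⟩ := S.exists_climb (half_pos hε)
  set R := max R₀ 0 with hR
  have hR0 : 0 ≤ R := le_max_right _ _
  have hRR : R₀ ≤ R := le_max_left _ _
  clear_value R
  have hm0 : (0 : ℝ) < m := by exact_mod_cast hm
  obtain ⟨c, D, hc, hD, hlat⟩ := S.exists_lateral (ε := ε / 2 * m / (R + m)) (by positivity)
  refine ⟨m, hm, c, D * Real.exp (c * R), hc, by positivity, fun y u hu => ?_⟩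
  have hui : 0 < u i := hu
  have hmv : move u i m i = u i + m := by simp [move]
  have hpt : (greenHalf μ i y (move u i m)) • (fun w : Fin d → ℤ =>
      if w i = u i + m ∧ znorm (w - u) ≤ R₀ then (1 : ℝ≥0∞) else 0) ≤
      ENNReal.ofReal (Real.exp (ε / 2 * m)) •
        (greenHalf μ i y + fun _ => bump (D * Real.exp (c * R)) c y u) := by
    intro w
    simp only [Pi.smul_apply, smul_eq_mul, Pi.add_apply]
    split_ifs with hw
    · obtain ⟨hwi, hwu⟩ := hw
      rw [mul_one]
      refine (hlat y w (by rw [mem_half]; omega) (move u i m) (by rw [mem_half]; omega)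
        (by omega)).trans ?_
      gcongr ?_ * (_ + ?_)
      · apply ENNReal.ofReal_le_ofReal
        apply Real.exp_le_exp.mpr
        rw [div_mul_eq_mul_div, div_le_iff₀ (by positivity)]
        have : znorm (move u i m - w) ≤ R + m := by
          have h1 := znorm_add_le (u - w) (Pi.single i (m : ℤ))
          rw [znorm_single, znorm_sub_comm u w] at h1
          rw [show move u i m - w = u - w + Pi.single i (m : ℤ) by simp only [move]; abel]
          refine h1.trans ?_
          simp only [Int.cast_natCast, Nat.abs_cast]
          linarith
        gcongr
      · rw [bump, bump]
        apply ENNReal.ofReal_le_ofReal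
        rw [mul_assoc, ← Real.exp_add]
        gcongr
        have := znorm_le_add_sub (u - y) (w - y)
        rw [sub_sub_sub_cancel_right, znorm_sub_comm u w] at this
        nlinarith
    · rw [mul_zero]
      exact zero_le
  have h1 := ((isKer_stepK μ (half i)).pow t).mono hpt u
  rw [map_smul, map_smul, map_add] at h1
  simp only [Pi.smul_apply, smul_eq_mul, Pi.add_apply] at h1
  have h2 : (stepK μ (half i) ^ t) (greenHalf μ i y) u ≤ greenHalf μ i y u :=
    pow_le_of_superharmonic (isKer_stepK _ _) (stepK_greenHalf_le y) t u
  have h3 : (stepK μ (half i) ^ t) (fun _ => bump (D * Real.exp (c * R)) c y u) u ≤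
      bump (D * Real.exp (c * R)) c y u := pow_le_const S.nn S.sum _ (fun _ => le_rfl) t u
  have h4 := hcl u hu
  set G := greenHalf μ i y (move u i m)
  have e : ENNReal.ofReal (Real.exp (ε / 2 * m)) * ENNReal.ofReal (Real.exp (-(ε / 2) * m)) = 1 := by
    rw [← ENNReal.ofReal_mul (by positivity), ← Real.exp_add]
    simp
  calc G = ENNReal.ofReal (Real.exp (ε / 2 * m)) *
        (G * ENNReal.ofReal (Real.exp (-(ε / 2) * m))) := by rw [mul_left_comm, e, mul_one]
    _ ≤ ENNReal.ofReal (Real.exp (ε / 2 * m)) * (ENNReal.ofReal (Real.exp (ε / 2 * m)) *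
        (greenHalf μ i y u + bump (D * Real.exp (c * R)) c y u)) := by
      exact mul_le_mul_right ((mul_le_mul_right h4 _).trans
        (h1.trans (mul_le_mul_right (add_le_add h2 h3) _))) _
    _ = _ := by
      rw [← mul_assoc, ← ENNReal.ofReal_mul (by positivity), ← Real.exp_add]
      congr 4
      ring

lemma bump_le_bump {C C' c c' : ℝ} (hC : C ≤ C') (hC' : 0 ≤ C') (hc : c' ≤ c) (y u : Fin d → ℤ) :
    bump C c y u ≤ bump C' c' y u := by
  apply ENNReal.ofReal_le_ofReal
  have := znorm_nonneg (u - y)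
  gcongr

lemma bump_add {C C' c : ℝ} (hC : 0 ≤ C) (hC' : 0 ≤ C') (y u : Fin d → ℤ) :
    bump C c y u + bump C' c y u = bump (C + C') c y u := by
  rw [bump, bump, bump, ← ENNReal.ofReal_add (by positivity) (by positivity), add_mul]

lemma ofReal_mul_bump {a C c : ℝ} (ha : 0 ≤ a) (y u : Fin d → ℤ) :
    ENNReal.ofReal a * bump C c y u = bump (a * C) c y u := by
  rw [bump, bump, ← ENNReal.ofReal_mul ha, mul_assoc]

lemma bump_move_le {C c : ℝ} (hC : 0 ≤ C) (hc : 0 ≤ c) (y u u' : Fin d → ℤ) :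
    bump C c y u' ≤ bump (Real.exp (c * znorm (u' - u)) * C) c y u := by
  apply ENNReal.ofReal_le_ofReal
  rw [mul_right_comm, ← Real.exp_add, mul_comm]
  gcongr
  have := znorm_le_add_sub (u - y) (u' - y)
  rw [sub_sub_sub_cancel_right, znorm_sub_comm u u'] at this
  nlinarith

lemma Setup.exists_greenHalf_le (S : Setup μ r i) {x : Fin d → ℤ} (hx : x ∈ half i) {ε : ℝ}
    (hε : 0 < ε) : ∃ c C : ℝ, 0 < c ∧ 0 < C ∧ ∀ y, ∀ z ∈ half i,
      greenHalf μ i y z ≤ ENNReal.ofReal (C * Real.exp (ε * znorm z)) *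
        (greenHalf μ i y x + ENNReal.ofReal (Real.exp (-c * znorm y))) := by
  obtain ⟨ε₁, hε₁, rfl⟩ : ∃ ε₁ : ℝ, 0 < ε₁ ∧ ε = 4 * ε₁ := ⟨ε / 4, by positivity, by ring⟩
  obtain ⟨m, hm, c₁, C₁, hc₁, hC₁, hcl⟩ := S.exists_greenHalf_climb hε₁
  obtain ⟨c₂, D₂, hc₂, hD₂, hlat⟩ := S.exists_lateral hε₁
  obtain ⟨κ, hκ, hharn⟩ := S.exists_harnack_exp
  have hm0 : (0 : ℝ) < m := by exact_mod_cast hm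
  set c := min ε₁ (min c₁ c₂) with hcdef
  have hc : 0 < c := by positivity
  have hcε : c ≤ ε₁ := min_le_left _ _
  have hcc₁ : c ≤ c₁ := (min_le_right _ _).trans (min_le_left _ _)
  have hcc₂ : c ≤ c₂ := (min_le_right _ _).trans (min_le_right _ _)
  clear_value c
  set B := C₁ / (ε₁ * m) + D₂ with hB
  have hB0 : 0 < B := by positivity
  have hBD : D₂ ≤ B := le_add_of_nonneg_left (by positivity)
  have hBC : C₁ + B ≤ Real.exp (ε₁ * m) * B := by
    have h1 : C₁ = ε₁ * m * (C₁ / (ε₁ * m)) := by field_simp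
    have h2 := Real.add_one_le_exp (ε₁ * m)
    have h3 : ε₁ * m * (C₁ / (ε₁ * m)) ≤ ε₁ * m * B := by gcongr; exact le_add_of_nonneg_right hD₂.le
    nlinarith
  clear_value B
  have hstep : ∀ y, ∀ u ∈ half i, greenHalf μ i y (move u i m) + bump B c y (move u i m) ≤
      ENNReal.ofReal (Real.exp (2 * ε₁ * m)) * (greenHalf μ i y u + bump B c y u) := by
    intro y u hu
    have h1 := hcl y u hu
    have h2 : bump B c y (move u i m) ≤ bump (Real.exp (ε₁ * m) * B) c y u := by
      refine (bump_move_le hB0.le hc.le y u _).trans (bump_le_bump ?_ (by positivity) le_rfl _ _)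
      rw [show move u i m - u = Pi.single i (m : ℤ) by simp [move], znorm_single]
      simp only [Int.cast_natCast, Nat.abs_cast]
      gcongr
    calc _ ≤ ENNReal.ofReal (Real.exp (ε₁ * m)) * (greenHalf μ i y u + bump C₁ c y u) +
          bump (Real.exp (ε₁ * m) * B) c y u := by
          refine add_le_add (h1.trans ?_) h2
          gcongr
          exact bump_le_bump le_rfl hC₁.le hcc₁ _ _
      _ = ENNReal.ofReal (Real.exp (ε₁ * m)) * (greenHalf μ i y u + bump (C₁ + B) c y u) := by
          rw [← ofReal_mul_bump (by positivity), ← mul_add, add_assoc, bump_add hC₁.le hB0.le]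
      _ ≤ ENNReal.ofReal (Real.exp (ε₁ * m)) * (ENNReal.ofReal (Real.exp (ε₁ * m)) *
            greenHalf μ i y u + ENNReal.ofReal (Real.exp (ε₁ * m)) * bump B c y u) := by
          gcongr
          · refine le_mul_of_one_le_left' ?_
            rw [ENNReal.one_le_ofReal]
            exact Real.one_le_exp (by positivity)
          · rw [ofReal_mul_bump (by positivity)]
            exact bump_le_bump hBC (by positivity) le_rfl _ _
      _ = _ := by
          rw [← mul_add, ← mul_assoc, ← ENNReal.ofReal_mul (by positivity), ← Real.exp_add]
          congr 3
          ring
  have hiter : ∀ (q : ℕ) y, ∀ u ∈ half i,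
      greenHalf μ i y (move u i (q * m : ℕ)) + bump B c y (move u i (q * m : ℕ)) ≤
      ENNReal.ofReal (Real.exp (2 * ε₁ * (q * m : ℕ))) * (greenHalf μ i y u + bump B c y u) := by
    intro q y u hu
    induction q with
    | zero => simp [move]
    | succ q ih =>
      have e : move u i ((q + 1) * m : ℕ) = move (move u i (q * m : ℕ)) i m := by
        simp only [move, add_assoc, ← Pi.single_add]
        congr 2
        push_cast
        ring
      have hmem : move u i (q * m : ℕ) ∈ half i := by
        have : 0 < u i := hu
        rw [mem_half, show move u i (q * m : ℕ) i = u i + (q * m : ℕ) by simp [move]]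
        omega
      rw [e]
      refine (hstep y _ hmem).trans ((mul_le_mul_right ih _).trans (le_of_eq ?_))
      rw [← mul_assoc, ← ENNReal.ofReal_mul (by positivity), ← Real.exp_add]
      congr 3
      push_cast
      ring
  set N₀ := znorm x with hN₀
  have hN₀0 : 0 ≤ N₀ := znorm_nonneg x
  refine ⟨c, Real.exp (2 * ε₁ * N₀) * (Real.exp (κ * (m + N₀)) + B * Real.exp (c * (2 * N₀ + m))),
    hc, by positivity, fun y z hz => ?_⟩
  have hxi : 0 < x i := hx
  have hzi : 0 < z i := hz
  obtain ⟨q, s, hs, hqs⟩ : ∃ q s : ℕ, s < m ∧ z i = 1 + (s : ℤ) + (q * m : ℕ) := by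
    refine ⟨(z i - 1).toNat / m, (z i - 1).toNat % m, Nat.mod_lt _ (by omega), ?_⟩
    have := Nat.mod_add_div' (z i - 1).toNat m
    omega
  set v := move x i (1 + s - x i) with hv
  have hvi : v i = 1 + s := by simp [hv, move]
  have hvH : v ∈ half i := by rw [mem_half]; omega
  set z' := move v i (q * m : ℕ) with hz'
  have hz'i : z' i = z i := by rw [hqs, ← hvi]; simp [hz', move]
  have hxz : (x i : ℝ) ≤ N₀ := (le_abs_self _).trans (abs_coord_le x i)
  have hx1 : (1 : ℝ) ≤ x i := by exact_mod_cast hxi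
  have hvx : znorm (v - x) ≤ m + N₀ := by
    rw [hv, show move x i (1 + s - x i) - x = Pi.single i (1 + s - x i) by simp [move], znorm_single]
    push_cast
    have hsm : (s : ℝ) + 1 ≤ m := by exact_mod_cast hs
    have hs0 : (0 : ℝ) ≤ s := Nat.cast_nonneg s
    rw [abs_le]
    constructor <;> linarith
  have hzz : znorm (z - z') ≤ 2 * znorm z + 2 * N₀ := by
    have h1 : z' = x + Pi.single i (z i - x i) := by
      rw [hz', hv, hqs]
      simp only [move, add_assoc, ← Pi.single_add]
      congr 2
      ring
    have h2 := znorm_add_le (z - x) (-Pi.single i (z i - x i))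
    have h3 := znorm_add_le z (-x)
    rw [znorm_neg, ← sub_eq_add_neg] at h3
    rw [znorm_neg, znorm_single] at h2
    rw [h1, show z - (x + Pi.single i (z i - x i)) = z - x + -Pi.single i (z i - x i) by abel]
    push_cast at h2
    have h4 := abs_sub_le (z i : ℝ) 0 (x i)
    rw [sub_zero, zero_sub, abs_neg] at h4
    linarith [abs_coord_le z i, abs_coord_le x i]
  have hv2 : znorm (v - y) ≥ znorm y - (2 * N₀ + m) := by
    have h1 := znorm_le_add_sub y v
    have h2 := znorm_le_add_sub v x
    rw [znorm_sub_comm] at h1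
    linarith
  have hzN : (z i : ℝ) ≤ znorm z := (le_abs_self _).trans (abs_coord_le z i)
  have hqz : ((q * m : ℕ) : ℝ) ≤ znorm z := by
    refine le_trans ?_ hzN
    have : ((q * m : ℕ) : ℤ) ≤ z i := by omega
    exact_mod_cast this
  calc greenHalf μ i y z ≤ ENNReal.ofReal (Real.exp (ε₁ * znorm (z - z'))) *
        (greenHalf μ i y z' + bump D₂ c₂ y z') :=
        hlat y z' (by rw [mem_half]; omega) z hz hz'i
    _ ≤ ENNReal.ofReal (Real.exp (ε₁ * (2 * znorm z + 2 * N₀))) *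
        (greenHalf μ i y z' + bump B c y z') := by
        gcongr
        exact bump_le_bump hBD hB0.le hcc₂ _ _
    _ ≤ ENNReal.ofReal (Real.exp (ε₁ * (2 * znorm z + 2 * N₀))) *
        (ENNReal.ofReal (Real.exp (2 * ε₁ * znorm z)) * (greenHalf μ i y v + bump B c y v)) := by
        gcongr
        refine (hiter q y v hvH).trans ?_
        gcongr
    _ ≤ ENNReal.ofReal (Real.exp (ε₁ * (2 * znorm z + 2 * N₀))) *
        (ENNReal.ofReal (Real.exp (2 * ε₁ * znorm z)) *
          (ENNReal.ofReal (Real.exp (κ * (m + N₀))) * greenHalf μ i y x +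
            ENNReal.ofReal (B * Real.exp (c * (2 * N₀ + m))) *
              ENNReal.ofReal (Real.exp (-c * znorm y)))) := by
        gcongr
        · refine (hharn _ (stepK_greenHalf_le y) x hx v hvH).trans ?_
          gcongr
        · rw [bump, ← ENNReal.ofReal_mul (by positivity), mul_assoc, ← Real.exp_add]
          apply ENNReal.ofReal_le_ofReal
          gcongr
          nlinarith
    _ ≤ ENNReal.ofReal (Real.exp (ε₁ * (2 * znorm z + 2 * N₀))) *
        (ENNReal.ofReal (Real.exp (2 * ε₁ * znorm z)) *
          (ENNReal.ofReal (Real.exp (κ * (m + N₀)) + B * Real.exp (c * (2 * N₀ + m))) *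
            (greenHalf μ i y x + ENNReal.ofReal (Real.exp (-c * znorm y))))) := by
        rw [mul_add (ENNReal.ofReal (Real.exp (κ * (m + N₀)) + B * Real.exp (c * (2 * N₀ + m))))]
        gcongr
        · exact le_add_of_nonneg_right (by positivity)
        · exact le_add_of_nonneg_left (by positivity)
    _ = _ := by
        rw [← mul_assoc, ← mul_assoc, ← ENNReal.ofReal_mul (by positivity),
          ← ENNReal.ofReal_mul (by positivity), ← Real.exp_add, mul_right_comm,
          mul_comm (Real.exp (2 * ε₁ * N₀)), mul_assoc (_ + _), ← Real.exp_add,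
          mul_comm (_ + _) (Real.exp _)]
        congr 4
        ring

end Domination

section Limit

lemma tendsto_tsum_of_dominated {V ι : Type*} {l : Filter ι} [l.NeBot] {f : ι → V → ℝ≥0∞}
    {g b : V → ℝ≥0∞} (hf : ∀ z, Tendsto (fun n => f n z) l (𝓝 (g z)))
    (hle : ∀ᶠ n in l, ∀ z, f n z ≤ b z) (hb : ∑' z, b z ≠ ⊤) :
    Tendsto (fun n => ∑' z, f n z) l (𝓝 (∑' z, g z)) := by
  have hbz : ∀ z, b z ≠ ⊤ := fun z => ENNReal.ne_top_of_tsum_ne_top hb z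
  have hg : ∀ z, g z ≤ b z := fun z => le_of_tendsto (hf z) (hle.mono fun n h => h z)
  have hreal : ∀ a : V → ℝ≥0∞, (∀ z, a z ≤ b z) →
      ENNReal.ofReal (∑' z, (a z).toReal) = ∑' z, a z := by
    intro a ha
    have hat : ∑' z, a z ≠ ⊤ := ne_top_of_le_ne_top hb (ENNReal.tsum_le_tsum ha)
    rw [← ENNReal.tsum_toReal_eq fun z => ne_top_of_le_ne_top (hbz z) (ha z),
      ENNReal.ofReal_toReal hat]
  rw [← hreal g hg]
  have h1 := tendsto_tsum_of_dominated_convergence (f := fun n z => (f n z).toReal)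
    (g := fun z => (g z).toReal) (bound := fun z => (b z).toReal) (ENNReal.summable_toReal hb)
    (fun z => (ENNReal.tendsto_toReal (ne_top_of_le_ne_top (hbz z) (hg z))).comp (hf z))
    (hle.mono fun n h z => by
      rw [Real.norm_of_nonneg ENNReal.toReal_nonneg]
      exact ENNReal.toReal_mono (hbz z) (h z))
  refine (ENNReal.tendsto_ofReal h1).congr' (hle.mono fun n h => hreal _ h)

lemma tendsto_tsum_mul {V ι : Type*} {l : Filter ι} [l.NeBot] {f : ι → V → ℝ≥0∞}
    {c g b : V → ℝ≥0∞} (hf : ∀ z, Tendsto (fun n => f n z) l (𝓝 (g z)))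
    (hle : ∀ᶠ n in l, ∀ z, f n z ≤ b z) (hb : ∑' z, c z * b z ≠ ⊤) :
    Tendsto (fun n => ∑' z, c z * f n z) l (𝓝 (∑' z, c z * g z)) := by
  refine tendsto_tsum_of_dominated (fun z => ?_) (hle.mono fun n h z => mul_le_mul_right (h z) _) hb
  by_cases hc : c z = ⊤
  · have hbz : b z = 0 := by
      by_contra h
      exact ENNReal.ne_top_of_tsum_ne_top hb z (by rw [hc, ENNReal.top_mul h])
    have h0 : ∀ᶠ n in l, f n z = 0 := hle.mono fun n h => le_antisymm ((h z).trans hbz.le) zero_le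
    have hg : g z = 0 := tendsto_nhds_unique (hf z)
      (tendsto_const_nhds.congr' (h0.mono fun n h => h.symm))
    rw [hg]
    exact tendsto_const_nhds.congr' (h0.mono fun n h => by simp only [h])
  · exact ENNReal.Tendsto.const_mul (hf z) (Or.inr hc)

lemma IsKer.tendsto {V ι : Type*} {L : Module.End ℝ≥0∞ (V → ℝ≥0∞)} (hL : IsKer L)
    {l : Filter ι} [l.NeBot] {f : ι → V → ℝ≥0∞} {g b : V → ℝ≥0∞}
    (hf : ∀ z, Tendsto (fun n => f n z) l (𝓝 (g z))) (hle : ∀ᶠ n in l, ∀ z, f n z ≤ b z) {x : V}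
    (hb : L b x ≠ ⊤) : Tendsto (fun n => L (f n) x) l (𝓝 (L g x)) := by
  classical
  rw [hL.apply_eq b x] at hb
  rw [hL.apply_eq g x]
  exact (tendsto_tsum_mul hf hle hb).congr fun n => (hL.apply_eq (f n) x).symm

variable {d : ℕ} {μ : (Fin d → ℤ) → ℝ} {r : ℝ} {i : Fin d}

lemma exitPot_eq_tsum (A : Set (Fin d → ℤ)) (f : (Fin d → ℤ) → ℝ≥0∞) (x : Fin d → ℤ) :
    exitPot μ A f x = ∑' z, exitPot μ A (Pi.single z 1) x * f z := by
  simp only [exitPot, pot, ← ENNReal.tsum_mul_right]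
  rw [ENNReal.tsum_comm]
  exact tsum_congr fun n => (((isKer_stepK μ A).pow n).mul (isKer_exitK μ A)).apply_eq f x

/-- The Martin kernel of the half-space walk with pole `y` and reference point `x`. -/
noncomputable def martin (μ : (Fin d → ℤ) → ℝ) (i : Fin d) (x y z : Fin d → ℤ) : ℝ≥0∞ :=
  greenHalf μ i y z / greenHalf μ i y x

lemma greenHalf_of_notMem {y z : Fin d → ℤ} (hy : y ∈ half i) (hz : z ∉ half i) :
    greenHalf μ i y z = 0 := by
  rw [greenHalf, pot, ENNReal.tsum_eq_zero]
  exact fun n => pow_single_of_notMem hz hy n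

lemma martin_of_notMem {x y z : Fin d → ℤ} (hy : y ∈ half i) (hz : z ∉ half i) :
    martin μ i x y z = 0 := by
  rw [martin, greenHalf_of_notMem hy hz, ENNReal.zero_div]

lemma Setup.greenHalf_ne_top (S : Setup μ r i) (y x : Fin d → ℤ) : greenHalf μ i y x ≠ ⊤ := by
  obtain ⟨C, hC, h⟩ := S.exists_pot_single_le
  exact ne_top_of_le_ne_top hC (h _ x y)

/-- A sequence of poles going to infinity in the half space, along which the Green function at
`x` decays subexponentially. -/
structure Poles (μ : (Fin d → ℤ) → ℝ) (i : Fin d) (x : Fin d → ℤ) (xs : ℕ → Fin d → ℤ) : Prop where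
  mem_base : x ∈ half i
  mem : ∀ n, xs n ∈ half i
  top : Tendsto (fun n => znorm (xs n)) atTop atTop
  lower : ∀ ε : ℝ, 0 < ε → ∀ᶠ n in atTop,
    ENNReal.ofReal (Real.exp (-(ε * znorm (xs n)))) ≤ greenHalf μ i (xs n) x

variable {x : Fin d → ℤ} {xs : ℕ → Fin d → ℤ}

lemma Poles.eventually_pos (P : Poles μ i x xs) : ∀ᶠ n in atTop, greenHalf μ i (xs n) x ≠ 0 := by
  filter_upwards [P.lower 1 one_pos] with n hn h0
  rw [h0, nonpos_iff_eq_zero, ENNReal.ofReal_eq_zero] at hn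
  exact absurd hn (not_le.mpr (Real.exp_pos _))

lemma Setup.exists_martin_le (S : Setup μ r i) (P : Poles μ i x xs) {ε : ℝ} (hε : 0 < ε) :
    ∃ C : ℝ, 0 < C ∧ ∀ᶠ n in atTop, ∀ z,
      martin μ i x (xs n) z ≤ cut (half i) (ENNReal.ofReal C • growth ε) z := by
  obtain ⟨c, C, hc, hC, h⟩ := S.exists_greenHalf_le P.mem_base hε
  refine ⟨2 * C, by positivity, ?_⟩
  filter_upwards [P.lower c hc, P.eventually_pos] with n hn h0 z
  by_cases hz : z ∈ half i
  · rw [cut_of_mem hz, martin]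
    refine ENNReal.div_le_of_le_mul ((h _ z hz).trans ?_)
    rw [neg_mul]
    refine (mul_le_mul_right (add_le_add_right hn _) _).trans (le_of_eq ?_)
    rw [Pi.smul_apply, growth, smul_eq_mul, ← ENNReal.ofReal_mul (by positivity), mul_assoc 2 C,
      ENNReal.ofReal_mul zero_le_two, ENNReal.ofReal_ofNat]
    ring
  · rw [martin_of_notMem (P.mem n) hz]
    exact zero_le

lemma Poles.tendsto_bump_div (P : Poles μ i x xs) {c D : ℝ} (hc : 0 < c) (hD : 0 ≤ D)
    (u : Fin d → ℤ) :
    Tendsto (fun n => bump D c (xs n) u / greenHalf μ i (xs n) x) atTop (𝓝 0) := by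
  have h1 : Tendsto (fun n => ENNReal.ofReal (D * Real.exp (c * znorm u) *
      Real.exp (-(c / 2 * znorm (xs n))))) atTop (𝓝 (ENNReal.ofReal (D * Real.exp (c * znorm u) * 0))) :=
    ENNReal.tendsto_ofReal ((Real.tendsto_exp_atBot.comp
      (tendsto_neg_atTop_atBot.comp (P.top.const_mul_atTop (by positivity)))).const_mul _)
  rw [mul_zero, ENNReal.ofReal_zero] at h1
  refine tendsto_of_tendsto_of_tendsto_of_le_of_le' tendsto_const_nhds h1
    (Eventually.of_forall fun _ => zero_le) ?_
  filter_upwards [P.lower (c / 2) (by positivity)] with n hn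
  refine ENNReal.div_le_of_le_mul (le_trans ?_ (mul_le_mul_right hn _))
  rw [bump, ← ENNReal.ofReal_mul (by positivity), mul_assoc, mul_assoc, ← Real.exp_add,
    ← Real.exp_add]
  apply ENNReal.ofReal_le_ofReal
  gcongr
  have := znorm_le_add_sub (xs n) u
  rw [znorm_sub_comm] at this
  nlinarith

lemma Setup.stepK_growth_ne_top (S : Setup μ r i) (A : Set (Fin d → ℤ)) (z : Fin d → ℤ) :
    stepK μ A (growth r) z ≠ ⊤ := by
  refine ne_top_of_le_ne_top ?_ (stepK_le_avg A _ z)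
  have h : avg μ (growth r) z ≤ ENNReal.ofReal (∑' w, Real.exp (r * znorm z) *
      (μ w * Real.exp (r * znorm w))) := by
    rw [ENNReal.ofReal_tsum_of_nonneg
      (fun w => mul_nonneg (Real.exp_pos _).le (mul_nonneg (S.nn w) (Real.exp_pos _).le))
      (S.exp.mul_left _)]
    refine ENNReal.tsum_le_tsum fun w => ?_
    rw [growth, ← ENNReal.ofReal_mul (S.nn w)]
    apply ENNReal.ofReal_le_ofReal
    rw [mul_left_comm, ← Real.exp_add]
    refine mul_le_mul_of_nonneg_left (Real.exp_le_exp.mpr ?_) (S.nn w)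
    nlinarith [znorm_add_le z w, S.pos]
  exact ne_top_of_le_ne_top ENNReal.ofReal_ne_top h

lemma Setup.exists_martin_limit (S : Setup μ r i) (P : Poles μ i x xs) (U : Ultrafilter ℕ)
    (hU : (U : Filter ℕ) ≤ atTop) : ∃ k : (Fin d → ℤ) → ℝ≥0∞,
      (∀ z, Tendsto (fun n => martin μ i x (xs n) z) U (𝓝 (k z))) ∧ k x = 1 ∧
      (∀ z ∉ half i, k z = 0) ∧ (∀ z ∈ half i, ∀ z' ∈ half i, z i = z' i → k z = k z') ∧
      stepK μ (half i) k = k ∧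
      ∀ ε : ℝ, 0 < ε → ∃ C : ℝ, 0 < C ∧ ∀ z, k z ≤ cut (half i) (ENNReal.ofReal C • growth ε) z := by
  have hlim : ∀ z, ∃ a, Tendsto (fun n => martin μ i x (xs n) z) U (𝓝 a) := by
    intro z
    obtain ⟨a, -, ha⟩ := isCompact_univ.ultrafilter_le_nhds
      (U.map fun n => martin μ i x (xs n) z) (by simp)
    exact ⟨a, ha⟩
  choose k hk using hlim
  have hgrow : ∀ ε : ℝ, 0 < ε → ∃ C : ℝ, 0 < C ∧
      ∀ z, k z ≤ cut (half i) (ENNReal.ofReal C • growth ε) z := by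
    intro ε hε
    obtain ⟨C, hC, h⟩ := S.exists_martin_le P hε
    exact ⟨C, hC, fun z => le_of_tendsto (hk z) ((h.filter_mono hU).mono fun n hn => hn z)⟩
  refine ⟨k, hk, ?_, ?_, ?_, ?_, hgrow⟩
  · refine tendsto_nhds_unique (hk x) (tendsto_const_nhds.congr' ?_)
    filter_upwards [hU P.eventually_pos] with n hn
    rw [martin, ENNReal.div_self hn (S.greenHalf_ne_top _ _)]
  · intro z hz
    refine tendsto_nhds_unique (hk z) (tendsto_const_nhds.congr fun n => ?_)
    rw [martin_of_notMem (P.mem n) hz]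
  · have key : ∀ z ∈ half i, ∀ z' ∈ half i, z i = z' i → k z' ≤ k z := by
      intro z hz z' hz' hzz
      have h1 : ∀ ε : ℝ, 0 < ε → k z' ≤ ENNReal.ofReal (Real.exp (ε * znorm (z' - z))) * k z := by
        intro ε hε
        obtain ⟨c, D, hc, hD, hlat⟩ := S.exists_lateral hε
        have h2 : Tendsto (fun n => ENNReal.ofReal (Real.exp (ε * znorm (z' - z))) *
            (martin μ i x (xs n) z + bump D c (xs n) z / greenHalf μ i (xs n) x)) U
            (𝓝 (ENNReal.ofReal (Real.exp (ε * znorm (z' - z))) * (k z + 0))) :=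
          ENNReal.Tendsto.const_mul ((hk z).add ((P.tendsto_bump_div hc hD.le z).mono_left hU))
            (Or.inr ENNReal.ofReal_ne_top)
        rw [add_zero] at h2
        refine le_of_tendsto_of_tendsto' (hk z') h2 fun n => ?_
        rw [martin, martin, ← ENNReal.add_div, ← mul_div_assoc]
        exact ENNReal.div_le_div_right (hlat _ z hz z' hz' hzz) _
      have h3 : Tendsto (fun ε : ℝ => ENNReal.ofReal (Real.exp (ε * znorm (z' - z))) * k z)
          (𝓝[>] 0) (𝓝 (ENNReal.ofReal (Real.exp (0 * znorm (z' - z))) * k z)) := by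
        refine ENNReal.Tendsto.mul_const (ENNReal.tendsto_ofReal ?_) (Or.inl ?_)
        · exact ((by fun_prop : Continuous fun ε : ℝ => Real.exp (ε * znorm (z' - z))).tendsto
            0).mono_left nhdsWithin_le_nhds
        · simp
      have h4 := ge_of_tendsto h3 (eventually_mem_nhdsWithin.mono fun ε hε => h1 ε hε)
      simpa using h4
    exact fun z hz z' hz' hzz => le_antisymm (key z' hz' z hz hzz.symm) (key z hz z' hz' hzz)
  · funext z
    obtain ⟨C, hC, h⟩ := S.exists_martin_le P S.pos
    have hb : stepK μ (half i) (cut (half i) (ENNReal.ofReal C • growth r)) z ≠ ⊤ := by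
      rw [stepK_cut, map_smul, Pi.smul_apply, smul_eq_mul]
      exact ENNReal.mul_ne_top ENNReal.ofReal_ne_top (S.stepK_growth_ne_top _ z)
    have h1 := (isKer_stepK μ (half i)).tendsto hk (hU h) hb
    refine tendsto_nhds_unique h1 ((hk z).congr' ?_)
    filter_upwards [hU (P.top.eventually_gt_atTop (znorm z))] with n hn
    have h2 := congrFun (stepK_greenHalf (μ := μ) (i := i) (xs n)) z
    rw [Pi.add_apply, Pi.single_eq_of_ne (by rintro rfl; exact lt_irrefl _ hn), add_zero] at h2
    have h3 : martin μ i x (xs n) = (greenHalf μ i (xs n) x)⁻¹ • greenHalf μ i (xs n) := by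
      funext w
      rw [martin, Pi.smul_apply, smul_eq_mul, ENNReal.div_eq_inv_mul]
    rw [h3, map_smul, Pi.smul_apply, Pi.smul_apply, h2]

end Limit

section HalfLine

/-- The discrete Green-type kernel whose second difference in `y` is
`δ_z - (1 - z) δ_0 - z δ_1`. -/
def gap (z y : ℤ) : ℕ := if 0 < y then (z - y).toNat else (y - z).toNat

lemma gap_second (z y : ℤ) :
    gap z (y - 1) + gap z (y + 1) + (if y = 0 then 1 else 0) +
        ((if y = 0 then (-z).toNat else 0) + (if y = 1 then z.toNat else 0)) =
      2 * gap z y + (if z = y then 1 else 0) +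
        ((if y = 0 then z.toNat else 0) + (if y = 1 then (-z).toNat else 0)) := by
  unfold gap
  split_ifs <;> omega

variable {d : ℕ} {μ : (Fin d → ℤ) → ℝ} {r : ℝ} {i : Fin d}

/-- Average of `gap` over a step in direction `i`. -/
noncomputable def meanGap (μ : (Fin d → ℤ) → ℝ) (i : Fin d) (y : ℤ) : ℝ≥0∞ :=
  ∑' z, ENNReal.ofReal (μ z) * gap (z i) y

/-- Law of the `i`-th coordinate of a step. -/
noncomputable def law (μ : (Fin d → ℤ) → ℝ) (i : Fin d) (y : ℤ) : ℝ≥0∞ :=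
  ∑' z, ENNReal.ofReal (μ z) * (if z i = y then 1 else 0)

lemma ofReal_intCast (a : ℤ) : ENNReal.ofReal a = (a.toNat : ℝ≥0∞) := by
  rcases le_total 0 a with h | h
  · lift a to ℕ using h
    simp
  · rw [Int.toNat_of_nonpos h, ENNReal.ofReal_of_nonpos (by exact_mod_cast h), Nat.cast_zero]

lemma Setup.tsum_toNat (S : Setup μ r i) :
    ∑' z, ENNReal.ofReal (μ z) * ((z i).toNat : ℝ≥0∞) =
      ∑' z, ENNReal.ofReal (μ z) * ((-z i).toNat : ℝ≥0∞) ∧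
    ∑' z, ENNReal.ofReal (μ z) * ((z i).toNat : ℝ≥0∞) ≠ ⊤ := by
  have hp : Summable fun z => μ z * max (z i : ℝ) 0 :=
    S.summable_linear (α := 1) fun z => by
      rw [one_mul, abs_of_nonneg (le_max_right _ _)]
      exact max_le ((le_abs_self _).trans (abs_coord_le z i)) (znorm_nonneg z)
  have hn : Summable fun z => μ z * max (-(z i : ℝ)) 0 :=
    S.summable_linear (α := 1) fun z => by
      rw [one_mul, abs_of_nonneg (le_max_right _ _)]
      exact max_le ((neg_le_abs _).trans (abs_coord_le z i)) (znorm_nonneg z)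
  have e : ∑' z, μ z * max (z i : ℝ) 0 = ∑' z, μ z * max (-(z i : ℝ)) 0 := by
    rw [← sub_eq_zero, ← hp.tsum_sub hn]
    refine Eq.trans ?_ S.hasSum_coord.tsum_eq
    refine tsum_congr fun z => ?_
    rw [← mul_sub]
    congr 1
    rcases le_total 0 (z i : ℝ) with h | h
    · rw [max_eq_left h, max_eq_right (by linarith)]; ring
    · rw [max_eq_right h, max_eq_left (by linarith)]; ring
  have hmax : ∀ a : ℤ, (a.toNat : ℝ≥0∞) = ENNReal.ofReal (max (a : ℝ) 0) := fun a => by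
    rw [← ofReal_intCast, ENNReal.ofReal_max, ENNReal.ofReal_zero, max_eq_left zero_le]
  have e1 : ∑' z, ENNReal.ofReal (μ z) * ((z i).toNat : ℝ≥0∞) =
      ENNReal.ofReal (∑' z, μ z * max (z i : ℝ) 0) := by
    rw [ENNReal.ofReal_tsum_of_nonneg (fun z => mul_nonneg (S.nn z) (le_max_right _ _)) hp]
    exact tsum_congr fun z => by rw [ENNReal.ofReal_mul (S.nn z), hmax]
  have e2 : ∑' z, ENNReal.ofReal (μ z) * ((-z i).toNat : ℝ≥0∞) =
      ENNReal.ofReal (∑' z, μ z * max (-(z i : ℝ)) 0) := by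
    rw [ENNReal.ofReal_tsum_of_nonneg (fun z => mul_nonneg (S.nn z) (le_max_right _ _)) hn]
    exact tsum_congr fun z => by rw [ENNReal.ofReal_mul (S.nn z), hmax, Int.cast_neg]
  rw [e1, e2, e]
  exact ⟨rfl, ENNReal.ofReal_ne_top⟩

lemma ExpStep.tsum_ofReal (H : ExpStep μ r) : ∑' z, ENNReal.ofReal (μ z) = 1 := by
  rw [← ENNReal.ofReal_tsum_of_nonneg H.nn H.sum.summable, H.sum.tsum_eq, ENNReal.ofReal_one]

lemma Setup.meanGap_second (S : Setup μ r i) (y : ℤ) :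
    meanGap μ i (y - 1) + meanGap μ i (y + 1) + (if y = 0 then 1 else 0) =
      2 * meanGap μ i y + law μ i y := by
  obtain ⟨he, hfin⟩ := S.tsum_toNat
  have h1 : ∀ z : Fin d → ℤ, ENNReal.ofReal (μ z) * gap (z i) (y - 1) +
        ENNReal.ofReal (μ z) * gap (z i) (y + 1) + ENNReal.ofReal (μ z) * (if y = 0 then 1 else 0) +
        (ENNReal.ofReal (μ z) * ((-z i).toNat : ℝ≥0∞) * (if y = 0 then 1 else 0) +
          ENNReal.ofReal (μ z) * ((z i).toNat : ℝ≥0∞) * (if y = 1 then 1 else 0)) =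
      2 * (ENNReal.ofReal (μ z) * gap (z i) y) + ENNReal.ofReal (μ z) * (if z i = y then 1 else 0) +
        (ENNReal.ofReal (μ z) * ((z i).toNat : ℝ≥0∞) * (if y = 0 then 1 else 0) +
          ENNReal.ofReal (μ z) * ((-z i).toNat : ℝ≥0∞) * (if y = 1 then 1 else 0)) := by
    intro z
    have h := congrArg (fun n : ℕ => ENNReal.ofReal (μ z) * (n : ℝ≥0∞)) (gap_second (z i) y)
    push_cast at h
    simp only [mul_add, mul_ite, mul_one, mul_zero] at h ⊢
    rw [h, mul_left_comm]
  have h2 := tsum_congr (L := .unconditional _) h1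
  simp only [ENNReal.tsum_add, ENNReal.tsum_mul_left, ENNReal.tsum_mul_right, ← he,
    S.tsum_ofReal, one_mul] at h2
  rw [ENNReal.add_left_inj] at h2
  · exact h2
  · split_ifs <;> simp [hfin]

lemma gap_le {r : ℝ} (hr : 0 < r) (z y : ℤ) :
    (gap z y : ℝ) ≤ r⁻¹ * (Real.exp (r * |(z : ℝ)|) * Real.exp (-(r * |(y : ℝ)|))) := by
  have key : ∀ a : ℤ, (a : ℝ) ≤ |(z : ℝ)| - |(y : ℝ)| → ((a.toNat : ℕ) : ℝ) ≤
      r⁻¹ * (Real.exp (r * |(z : ℝ)|) * Real.exp (-(r * |(y : ℝ)|))) := by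
    intro a ha
    rw [← Real.exp_add, inv_mul_eq_div, le_div_iff₀ hr]
    rcases le_total 0 a with h | h
    · have : ((a.toNat : ℕ) : ℝ) = a := by exact_mod_cast Int.toNat_of_nonneg h
      rw [this]
      nlinarith [Real.add_one_le_exp (r * |(z : ℝ)| + -(r * |(y : ℝ)|))]
    · rw [Int.toNat_of_nonpos h, Nat.cast_zero, zero_mul]
      exact (Real.exp_pos _).le
  unfold gap
  split_ifs with h
  · apply key
    have : (0 : ℝ) < y := by exact_mod_cast h
    push_cast
    rw [abs_of_pos this]
    linarith [le_abs_self (z : ℝ)]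
  · apply key
    have : (y : ℝ) ≤ 0 := by exact_mod_cast not_lt.mp h
    push_cast
    rw [abs_of_nonpos this]
    linarith [neg_le_abs (z : ℝ)]

lemma ExpStep.exists_meanGap_le (H : ExpStep μ r) (i : Fin d) : ∃ C : ℝ, 0 < C ∧ ∀ y,
    meanGap μ i y ≤ ENNReal.ofReal (C * Real.exp (-(r * |(y : ℝ)|))) := by
  have hs : Summable fun z : Fin d → ℤ => μ z * Real.exp (r * |(z i : ℝ)|) :=
    H.summable_exp fun z => mul_le_mul_of_nonneg_left (abs_coord_le z i) H.pos.le
  have hr := H.pos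
  refine ⟨r⁻¹ * ∑' z, μ z * Real.exp (r * |(z i : ℝ)|) + 1, ?_, fun y => ?_⟩
  · have : 0 ≤ ∑' z, μ z * Real.exp (r * |(z i : ℝ)|) :=
      tsum_nonneg fun z => mul_nonneg (H.nn z) (Real.exp_pos _).le
    positivity
  · calc meanGap μ i y ≤ ∑' z, ENNReal.ofReal ((r⁻¹ * Real.exp (-(r * |(y : ℝ)|))) *
          (μ z * Real.exp (r * |(z i : ℝ)|))) := by
          refine ENNReal.tsum_le_tsum fun z => ?_
          rw [← ENNReal.ofReal_natCast, ← ENNReal.ofReal_mul (H.nn z)]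
          apply ENNReal.ofReal_le_ofReal
          calc _ ≤ _ := mul_le_mul_of_nonneg_left (gap_le hr (z i) y) (H.nn z)
            _ = _ := by ring
      _ = ENNReal.ofReal ((r⁻¹ * Real.exp (-(r * |(y : ℝ)|))) *
          ∑' z, μ z * Real.exp (r * |(z i : ℝ)|)) := by
          rw [← tsum_mul_left, ENNReal.ofReal_tsum_of_nonneg _ (hs.mul_left _)]
          intro z
          exact mul_nonneg (by positivity) (mul_nonneg (H.nn z) (Real.exp_pos _).le)
      _ ≤ _ := by
          apply ENNReal.ofReal_le_ofReal
          nlinarith [Real.exp_pos (-(r * |(y : ℝ)|))]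

/-- Smoothing of a function on the integers by `meanGap`. -/
noncomputable def smooth (μ : (Fin d → ℤ) → ℝ) (i : Fin d) (G : ℤ → ℝ≥0∞) (x : ℤ) : ℝ≥0∞ :=
  ∑' y, meanGap μ i y * G (x + y)

lemma tsum_law_mul (G : ℤ → ℝ≥0∞) :
    ∑' y, law μ i y * G y = ∑' z, ENNReal.ofReal (μ z) * G (z i) := by
  simp only [law, ← ENNReal.tsum_mul_right]
  rw [ENNReal.tsum_comm]
  refine tsum_congr fun z => ?_
  rw [tsum_eq_single (z i)]
  · simp
  · intro y hy
    simp [Ne.symm hy]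

lemma Setup.smooth_second (S : Setup μ r i) (G : ℤ → ℝ≥0∞) (x : ℤ) :
    smooth μ i G (x + 1) + smooth μ i G (x - 1) + G x =
      2 * smooth μ i G x + ∑' z, ENNReal.ofReal (μ z) * G (x + z i) := by
  have e1 : smooth μ i G (x + 1) = ∑' y, meanGap μ i (y - 1) * G (x + y) := by
    rw [smooth, ← (Equiv.subRight (1 : ℤ)).tsum_eq]
    exact tsum_congr fun y => by
      rw [Equiv.subRight_apply, show x + 1 + (y - 1) = x + y by ring]
  have e2 : smooth μ i G (x - 1) = ∑' y, meanGap μ i (y + 1) * G (x + y) := by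
    rw [smooth, ← (Equiv.addRight (1 : ℤ)).tsum_eq]
    exact tsum_congr fun y => by
      rw [Equiv.coe_addRight, show x - 1 + (y + 1) = x + y by ring]
  have e3 : G x = ∑' y : ℤ, (if y = 0 then 1 else 0) * G (x + y) := by
    rw [tsum_eq_single 0 (fun y hy => by simp [hy])]
    simp
  have e4 := tsum_law_mul (μ := μ) (i := i) fun y => G (x + y)
  rw [e1, e2, ← e4, smooth, ← ENNReal.tsum_mul_left, ← ENNReal.tsum_add, ← ENNReal.tsum_add]
  conv_lhs => rw [e3]
  rw [← ENNReal.tsum_add]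
  refine tsum_congr fun y => ?_
  rw [← add_mul, ← add_mul, ← mul_assoc, ← add_mul, S.meanGap_second]

end HalfLine

section HalfLineLiouville

variable {d : ℕ} {μ : (Fin d → ℤ) → ℝ} {r : ℝ} {i : Fin d}

lemma summable_exp_neg_abs {s : ℝ} (hs : 0 < s) :
    Summable fun y : ℤ => Real.exp (-(s * |(y : ℝ)|)) := by
  have h : Summable fun n : ℕ => Real.exp (-(s * (n : ℝ))) := by
    refine (Real.summable_exp_nat_mul_iff.mpr (neg_lt_zero.mpr hs)).congr fun n => ?_
    congr 1; ring
  refine Summable.of_nat_of_neg ?_ ?_ <;> simpa using h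

lemma ExpStep.smooth_ne_top (H : ExpStep μ r) {G : ℤ → ℝ≥0∞} {C : ℝ}
    (hG : ∀ m : ℤ, G m ≤ ENNReal.ofReal (C * Real.exp (r / 2 * |(m : ℝ)|))) (x : ℤ) :
    smooth μ i G x ≠ ⊤ := by
  obtain ⟨D, hD, h⟩ := H.exists_meanGap_le i
  have hr := H.pos
  have hs := (summable_exp_neg_abs (half_pos hr)).mul_left (D * |C| * Real.exp (r / 2 * |(x : ℝ)|))
  refine ne_top_of_le_ne_top (b := ENNReal.ofReal (∑' y : ℤ,
    (D * |C| * Real.exp (r / 2 * |(x : ℝ)|)) * Real.exp (-(r / 2 * |(y : ℝ)|))))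
    ENNReal.ofReal_ne_top ?_
  rw [ENNReal.ofReal_tsum_of_nonneg (fun y => by positivity) hs]
  refine ENNReal.tsum_le_tsum fun y => ?_
  refine (mul_le_mul' (h y) (hG _)).trans ?_
  rw [← ENNReal.ofReal_mul (by positivity)]
  apply ENNReal.ofReal_le_ofReal
  have h1 : Real.exp (r / 2 * |((x + y : ℤ) : ℝ)|) ≤
      Real.exp (r / 2 * |(x : ℝ)|) * Real.exp (r / 2 * |(y : ℝ)|) := by
    rw [← Real.exp_add, ← mul_add]
    push_cast
    exact Real.exp_le_exp.mpr (mul_le_mul_of_nonneg_left (abs_add_le _ _) (by positivity))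
  have h2 : Real.exp (-(r * |(y : ℝ)|)) * Real.exp (r / 2 * |(y : ℝ)|) =
      Real.exp (-(r / 2 * |(y : ℝ)|)) := by
    rw [← Real.exp_add]; congr 1; ring
  calc D * Real.exp (-(r * |(y : ℝ)|)) * (C * Real.exp (r / 2 * |((x + y : ℤ) : ℝ)|))
      ≤ D * Real.exp (-(r * |(y : ℝ)|)) *
        (|C| * (Real.exp (r / 2 * |(x : ℝ)|) * Real.exp (r / 2 * |(y : ℝ)|))) := by
        refine mul_le_mul_of_nonneg_left ?_ (by positivity)
        exact mul_le_mul (le_abs_self C) h1 (Real.exp_pos _).le (abs_nonneg C)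
    _ = (D * |C| * Real.exp (r / 2 * |(x : ℝ)|)) *
        (Real.exp (-(r * |(y : ℝ)|)) * Real.exp (r / 2 * |(y : ℝ)|)) := by ring
    _ = _ := by rw [h2]

lemma one_add_abs_le {r : ℝ} (hr : 0 < r) (m : ℤ) : ENNReal.ofReal (1 + |(m : ℝ)|) ≤
    ENNReal.ofReal ((1 + 2 / r) * Real.exp (r / 2 * |(m : ℝ)|)) := by
  apply ENNReal.ofReal_le_ofReal
  have h := Real.add_one_le_exp (r / 2 * |(m : ℝ)|)
  have h1 : |(m : ℝ)| = 2 / r * (r / 2 * |(m : ℝ)|) := by field_simp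
  have h2 : 0 < 2 / r := by positivity
  have h3 : 0 ≤ r / 2 * |(m : ℝ)| := by positivity
  nlinarith

lemma affine_of_second_difference {f : ℕ → ℝ≥0∞} (hf : ∀ n, f n ≠ ⊤)
    (h : ∀ n, f (n + 2) + f n = 2 * f (n + 1)) :
    ∃ a b : ℝ, 0 ≤ a ∧ 0 ≤ b ∧ ∀ n : ℕ, f n = ENNReal.ofReal (a + b * n) := by
  have h1 : ∀ n, (f (n + 2)).toReal = 2 * (f (n + 1)).toReal - (f n).toReal := by
    intro n
    have := congrArg ENNReal.toReal (h n)
    rw [ENNReal.toReal_add (hf _) (hf _), ENNReal.toReal_mul, ENNReal.toReal_ofNat] at this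
    linarith
  set a := (f 0).toReal with ha
  set b := (f 1).toReal - (f 0).toReal with hb
  have h2 : ∀ n : ℕ, (f n).toReal = a + b * n ∧ (f (n + 1)).toReal = a + b * (n + 1) := by
    intro n
    induction n with
    | zero => constructor <;> simp [ha, hb]
    | succ n ih =>
      refine ⟨by rw [ih.2]; push_cast; ring, ?_⟩
      rw [h1, ih.1, ih.2]; push_cast; ring
  refine ⟨a, b, ENNReal.toReal_nonneg, ?_, fun n => ?_⟩
  · by_contra! hb0
    obtain ⟨n, hn⟩ := exists_nat_gt (a / -b)
    rw [div_lt_iff₀ (by linarith)] at hn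
    have := (h2 n).1 ▸ (ENNReal.toReal_nonneg (a := f n))
    linarith
  · rw [← (h2 n).1, ENNReal.ofReal_toReal (hf n)]

lemma Setup.meanGap_zero_ne_zero (S : Setup μ r i) : meanGap μ i 0 ≠ 0 := by
  obtain ⟨z, hz, hzi⟩ := S.exists_step_neg
  intro h
  have := ENNReal.tsum_eq_zero.mp h z
  rw [mul_eq_zero, ENNReal.ofReal_eq_zero, Nat.cast_eq_zero] at this
  rcases this with h | h
  · exact absurd hz (not_lt.mpr h)
  · simp [gap] at h
    omega

lemma Setup.harmonic_dichotomy (S : Setup μ r i) {G : ℤ → ℝ≥0∞} (h0 : ∀ m ≤ 0, G m = 0)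
    (hharm : stepK μ (half i) (fun z => G (z i)) = fun z => G (z i)) {C : ℝ}
    (hG : ∀ m : ℤ, G m ≤ ENNReal.ofReal (C * Real.exp (r / 2 * |(m : ℝ)|))) :
    (∀ m, G m = 0) ∨ ∃ b : ℝ≥0∞, b ≠ 0 ∧ ∀ m : ℤ, 0 < m → b * ENNReal.ofReal m ≤ G m := by
  have hr := S.pos
  have hharm' : ∀ m : ℤ, 0 < m → ∑' z, ENNReal.ofReal (μ z) * G (m + z i) = G m := by
    intro m hm
    have hmem : (Pi.single i m : Fin d → ℤ) ∈ half i := by simpa [half] using hm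
    have := congrFun hharm (Pi.single i m)
    rw [stepK_apply hmem] at this
    simp only [Pi.add_apply, Pi.single_eq_same] at this
    rw [← this]
    refine tsum_congr fun z => ?_
    split_ifs with hz
    · rfl
    · rw [h0 (m + z i) (by simpa [half] using hz)]
  have hsm : ∀ x, smooth μ i G x ≠ ⊤ := fun x => S.smooth_ne_top hG x
  have hGt : ∀ m, G m ≠ ⊤ := fun m => ne_top_of_le_ne_top ENNReal.ofReal_ne_top (hG m)
  obtain ⟨a, β, ha, hβ, hu⟩ := affine_of_second_difference (f := fun n : ℕ => smooth μ i G n)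
    (fun n => hsm n) (fun n => by
      have h1 := S.smooth_second G ((n : ℤ) + 1)
      rw [hharm' _ (by omega), ENNReal.add_left_inj (hGt _)] at h1
      rw [show ((n : ℤ) + 1 + 1) = ((n + 2 : ℕ) : ℤ) by push_cast; ring,
        show ((n : ℤ) + 1 - 1) = ((n : ℕ) : ℤ) by ring,
        show ((n : ℤ) + 1) = ((n + 1 : ℕ) : ℤ) by push_cast; ring] at h1
      exact h1)
  have hg0 := S.meanGap_zero_ne_zero
  have hgt : meanGap μ i 0 ≠ ⊤ := by
    obtain ⟨D, -, h⟩ := S.exists_meanGap_le i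
    exact ne_top_of_le_ne_top ENNReal.ofReal_ne_top (h 0)
  have hlin : ∀ n : ℕ, G n ≤ (meanGap μ i 0)⁻¹ * ENNReal.ofReal (a + β * n) := by
    intro n
    rw [← hu n, ← ENNReal.mul_le_iff_le_inv hg0 hgt]
    have := ENNReal.le_tsum (f := fun y => meanGap μ i y * G ((n : ℤ) + y)) 0
    rwa [add_zero] at this
  rcases hβ.eq_or_lt with hβ0 | hβ0
  · left
    intro m
    set B := (meanGap μ i 0)⁻¹ * ENNReal.ofReal a with hB
    have hBt : B ≠ ⊤ := ENNReal.mul_ne_top (ENNReal.inv_ne_top.mpr hg0) ENNReal.ofReal_ne_top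
    have h1 : (fun z : Fin d → ℤ => G (z i)) ≤ B • cut (half i) 1 := by
      intro z
      by_cases hz : z ∈ half i
      · rw [Pi.smul_apply, cut_of_mem hz, Pi.one_apply, smul_eq_mul, mul_one]
        have h2 := hlin (z i).toNat
        rw [Int.toNat_of_nonneg (mem_half.mp hz).le, ← hβ0, zero_mul, add_zero] at h2
        exact h2
      · exact (h0 (z i) (not_lt.mp hz)).le.trans zero_le
    have h2 : ∀ n, ((stepK μ (half i)) ^ n) (fun z => G (z i)) = fun z => G (z i) := by
      intro n
      induction n with
      | zero => rfl
      | succ n ih => rw [pow_succ, Module.End.mul_apply, hharm, ih]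
    have h3 : ∀ n, G m ≤ B * ((stepK μ (half i)) ^ n) (cut (half i) 1) (Pi.single i m) := by
      intro n
      have h4 := congrFun (h2 n) (Pi.single i m)
      rw [Pi.single_eq_same] at h4
      rw [← h4]
      refine (((isKer_stepK μ (half i)).pow n).mono h1 _).trans ?_
      rw [map_smul, Pi.smul_apply, smul_eq_mul]
    have h4 := ENNReal.Tendsto.const_mul (a := B)
      (S.tendsto_pow_one subset_rfl (Pi.single i m)) (Or.inr hBt)
    rw [mul_zero] at h4
    exact le_antisymm (ge_of_tendsto' h4 h3) zero_le
  · right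
    obtain ⟨κ, hκ, hharn⟩ := S.exists_harnack_exp
    set B := (meanGap μ i 0)⁻¹ * ENNReal.ofReal (a + β) with hB
    have hBt : B ≠ ⊤ := ENNReal.mul_ne_top (ENNReal.inv_ne_top.mpr hg0) ENNReal.ofReal_ne_top
    have hBG : ∀ m : ℤ, G m ≤ B * ENNReal.ofReal (1 + |(m : ℝ)|) := by
      intro m
      rcases le_or_gt m 0 with hm | hm
      · rw [h0 m hm]; exact zero_le
      · lift m to ℕ using hm.le
        refine (hlin m).trans ?_
        rw [hB, mul_assoc, ← ENNReal.ofReal_mul (by positivity)]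
        refine mul_le_mul_right (ENNReal.ofReal_le_ofReal ?_) _
        push_cast
        rw [abs_of_nonneg (Nat.cast_nonneg m)]
        have : (0 : ℝ) ≤ m := Nat.cast_nonneg m
        nlinarith
    have hone : ∑' y, meanGap μ i y * ENNReal.ofReal (1 + |(y : ℝ)|) ≠ ⊤ := by
      have := S.smooth_ne_top (i := i) (one_add_abs_le hr) 0
      simpa only [smooth, zero_add] using this
    have hmass : ∑' y, meanGap μ i y ≠ ⊤ := by
      refine ne_top_of_le_ne_top hone (ENNReal.tsum_le_tsum fun y => ?_)
      refine le_mul_of_one_le_right' (ENNReal.one_le_ofReal.mpr ?_)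
      linarith [abs_nonneg (y : ℝ)]
    set F : ℤ → ℝ≥0∞ := fun y => 2 * B * (meanGap μ i y * ENNReal.ofReal (1 + |(y : ℝ)|)) with hF
    have hFt : ∑' y, F y ≠ ⊤ := by
      rw [hF, ENNReal.tsum_mul_left]
      finiteness
    obtain ⟨A, hA⟩ := exists_tail_le hFt (fun y => |(y : ℝ)|)
      (ε := ENNReal.ofReal (β / 2)) (ENNReal.ofReal_pos.mpr (by positivity))
    set Q := (∑' y, meanGap μ i y) * ENNReal.ofReal (Real.exp (κ * A)) with hQ
    have hQt : Q ≠ ⊤ := ENNReal.mul_ne_top hmass ENNReal.ofReal_ne_top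
    have hQ0 : Q ≠ 0 := by
      refine mul_ne_zero (fun h => hg0 (ENNReal.tsum_eq_zero.mp h 0)) ?_
      exact (ENNReal.ofReal_pos.mpr (Real.exp_pos _)).ne'
    refine ⟨Q⁻¹ * ENNReal.ofReal (β / 2), mul_ne_zero (ENNReal.inv_ne_zero.mpr hQt)
      (ENNReal.ofReal_pos.mpr (by positivity)).ne', fun m hm => ?_⟩
    have hm1 : (1 : ℝ) ≤ m := by exact_mod_cast hm
    have hterm : ∀ y : ℤ, meanGap μ i y * G (m + y) ≤
        meanGap μ i y * (ENNReal.ofReal (Real.exp (κ * A)) * G m) +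
          (if (A : ℝ) < |(y : ℝ)| then F y else 0) * ENNReal.ofReal m := by
      intro y
      split_ifs with hy
      · refine le_add_left ?_
        rw [hF]
        calc meanGap μ i y * G (m + y)
            ≤ meanGap μ i y * (B * ENNReal.ofReal (2 * (1 + |(y : ℝ)|) * m)) := by
              refine mul_le_mul_right ((hBG _).trans (mul_le_mul_right
                (ENNReal.ofReal_le_ofReal ?_) _)) _
              push_cast
              have h1 := abs_add_le (m : ℝ) y
              rw [abs_of_nonneg (by linarith : (0 : ℝ) ≤ m)] at h1
              nlinarith [abs_nonneg (y : ℝ)]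
          _ = _ := by
              rw [ENNReal.ofReal_mul (by positivity), ENNReal.ofReal_mul zero_le_two,
                ENNReal.ofReal_ofNat]
              ring
      · rw [zero_mul, add_zero]
        refine mul_le_mul_right ?_ _
        rcases le_or_gt (m + y) 0 with hmy | hmy
        · rw [h0 _ hmy]; exact zero_le
        · have h1 := hharn (fun z => G (z i)) hharm.le (Pi.single i m) (by simpa [half] using hm)
            (Pi.single i (m + y)) (by simpa [half] using hmy)
          simp only [Pi.single_eq_same] at h1
          refine h1.trans (mul_le_mul_left (ENNReal.ofReal_le_ofReal (Real.exp_le_exp.mpr ?_)) _)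
          rw [← Pi.single_sub, znorm_single]
          refine mul_le_mul_of_nonneg_left ?_ hκ.le
          push_cast
          rw [add_sub_cancel_left]
          exact not_lt.mp hy
    have hmain : ENNReal.ofReal (β * m) ≤
        Q * G m + ENNReal.ofReal (β / 2) * ENNReal.ofReal m := by
      have h1 : ENNReal.ofReal (β * m) ≤ smooth μ i G m := by
        lift m to ℕ using hm.le
        have h2 := hu m
        rw [h2]
        apply ENNReal.ofReal_le_ofReal
        push_cast
        linarith
      refine h1.trans ((ENNReal.tsum_le_tsum hterm).trans ?_)
      rw [ENNReal.tsum_add, ENNReal.tsum_mul_right, ENNReal.tsum_mul_right, hQ, mul_assoc]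
      exact add_le_add_right (mul_le_mul_left hA _) _
    have hsplit : ENNReal.ofReal (β * m) =
        ENNReal.ofReal (β / 2) * ENNReal.ofReal m + ENNReal.ofReal (β / 2) * ENNReal.ofReal m := by
      rw [← ENNReal.ofReal_mul (by positivity), ← ENNReal.ofReal_add (by positivity) (by positivity)]
      congr 1; ring
    rw [hsplit] at hmain
    have := ENNReal.le_of_add_le_add_right (by finiteness) hmain
    rw [mul_assoc]
    refine (mul_le_mul_right this _).trans (le_of_eq ?_)
    rw [← mul_assoc, ENNReal.inv_mul_cancel hQ0 hQt, one_mul]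

end HalfLineLiouville

section Conclusion

variable {d : ℕ} {μ : (Fin d → ℤ) → ℝ} {r : ℝ} {i : Fin d}

lemma pow_translate_lateral {v : Fin d → ℤ} (hv : v i = 0) (n : ℕ) {f : (Fin d → ℤ) → ℝ≥0∞}
    (hf : ∀ x, f (x + v) = f x) (x : Fin d → ℤ) :
    (stepK μ (half i) ^ n) f (x + v) = (stepK μ (half i) ^ n) f x := by
  have hmem : ∀ y : Fin d → ℤ, y + v ∈ half i ↔ y ∈ half i := by
    intro y; simp [half, hv]
  induction n generalizing x with
  | zero => exact hf x
  | succ n ih =>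
    rw [pow_succ', Module.End.mul_apply]
    by_cases hx : x ∈ half i
    · rw [stepK_apply hx, stepK_apply ((hmem x).mpr hx)]
      refine tsum_congr fun z => ?_
      rw [add_right_comm x v z]
      simp only [hmem, ih]
    · rw [stepK_of_notMem hx, stepK_of_notMem (mt (hmem x).mp hx)]

lemma Setup.hfun_half_congr (S : Setup μ r i) {x y : Fin d → ℤ} (h : x i = y i) :
    hfun μ i (half i) x = hfun μ i (half i) y := by
  have h1 := S.tendsto_pow_coordPos subset_rfl x
  rw [cut_half_coordPos] at h1
  have h2 := S.tendsto_pow_coordPos subset_rfl y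
  rw [cut_half_coordPos] at h2
  have hv : (y - x) i = 0 := by rw [Pi.sub_apply, h, sub_self]
  refine tendsto_nhds_unique (h1.congr fun n => ?_) h2
  have h3 := pow_translate_lateral (μ := μ) hv n (f := coordPos i) (fun z => by
    simp only [coordPos, Pi.add_apply, hv, add_zero]) x
  rw [← h3, add_sub_cancel]

lemma Setup.hfun_half_of_notMem (S : Setup μ r i) {x : Fin d → ℤ} (hx : x ∉ half i) :
    hfun μ i (half i) x = 0 := by
  rw [← S.stepK_hfun subset_rfl, stepK_of_notMem hx]

/-- Liouville property of the half-space walk: a subexponential harmonic function of the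
distance to the boundary is a multiple of `hfun μ i (half i)`. -/
lemma Setup.eq_smul_hfun (S : Setup μ r i) {k : (Fin d → ℤ) → ℝ≥0∞}
    (hzero : ∀ z ∉ half i, k z = 0)
    (hcoord : ∀ z ∈ half i, ∀ z' ∈ half i, z i = z' i → k z = k z')
    (hK : stepK μ (half i) k = k)
    (hgrow : ∀ ε : ℝ, 0 < ε → ∃ C : ℝ, 0 < C ∧
      ∀ z, k z ≤ cut (half i) (ENNReal.ofReal C • growth ε) z) :
    ∃ c : ℝ≥0∞, c ≠ ⊤ ∧ k = c • hfun μ i (half i) := by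
  set h := hfun μ i (half i) with hh
  have hht : ∀ z, h z ≠ ⊤ := S.hfun_ne_top subset_rfl
  have hge : ∀ z, ENNReal.ofReal (z i) ≤ h z := by
    intro z
    rw [hh, hfun_half]
    exact le_self_add
  have hh0 : ∀ z ∈ half i, h z ≠ 0 := fun z hz =>
    ((ENNReal.ofReal_pos.mpr (by exact_mod_cast hz)).trans_le (hge z)).ne'
  have hkt : ∀ z, k z ≠ ⊤ := by
    intro z
    obtain ⟨C, -, hC⟩ := hgrow 1 one_pos
    refine ne_top_of_le_ne_top ?_ ((hC z).trans (cut_le _ z))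
    rw [Pi.smul_apply, growth, smul_eq_mul]
    finiteness
  obtain ⟨c, hc_le, hc_ge⟩ : ∃ c : ℝ≥0∞, (∀ z ∈ half i, c ≤ k z / h z) ∧
      ∀ a, (∀ z ∈ half i, a ≤ k z / h z) → a ≤ c :=
    ⟨⨅ z ∈ half i, k z / h z, fun z hz => iInf₂_le z hz, fun a ha => le_iInf₂ ha⟩
  have hct : c ≠ ⊤ := by
    have h1 : (fun _ => 1 : Fin d → ℤ) ∈ half i := by simp [half]
    exact ne_top_of_le_ne_top (ENNReal.div_ne_top (hkt _) (hh0 _ h1)) (hc_le _ h1)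
  have hcle : ∀ z, c * h z ≤ k z := by
    intro z
    by_cases hz : z ∈ half i
    · rw [← ENNReal.le_div_iff_mul_le (Or.inl (hh0 z hz)) (Or.inl (hht z))]
      exact hc_le z hz
    · rw [hh, S.hfun_half_of_notMem hz, mul_zero]
      exact zero_le
  refine ⟨c, hct, ?_⟩
  set G : ℤ → ℝ≥0∞ := fun m => k (Pi.single i m) - c * h (Pi.single i m) with hG
  have hcoord' : ∀ z, k (Pi.single i (z i)) = k z := by
    intro z
    by_cases hz : z ∈ half i
    · exact hcoord _ (by simpa [half] using hz) _ hz (by simp)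
    · rw [hzero z hz, hzero _ (by simpa [half] using hz)]
  have hGz : ∀ z, G (z i) = k z - c * h z := by
    intro z
    simp only [hG]
    rw [hcoord', hh, S.hfun_half_congr (x := Pi.single i (z i)) (y := z) (by simp)]
  have hsum : (fun z => G (z i)) + c • h = k := by
    funext z
    rw [Pi.add_apply, Pi.smul_apply, smul_eq_mul, hGz]
    exact tsub_add_cancel_of_le (hcle z)
  have hG0 : ∀ m ≤ 0, G m = 0 := by
    intro m hm
    simp only [hG]
    rw [hzero _ (by simpa [half] using hm), zero_tsub]
  have hharm : stepK μ (half i) (fun z => G (z i)) = fun z => G (z i) := by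
    have h1 := hK
    rw [← hsum, map_add, map_smul, hh, S.stepK_hfun subset_rfl] at h1
    funext z
    have h2 := congrFun h1 z
    rw [Pi.add_apply, Pi.add_apply, ENNReal.add_left_inj] at h2
    · exact h2
    · rw [Pi.smul_apply, smul_eq_mul]
      exact ENNReal.mul_ne_top hct (hht z)
  obtain ⟨C, hC, hkC⟩ := hgrow (r / 2) (half_pos S.pos)
  have hGC : ∀ m : ℤ, G m ≤ ENNReal.ofReal (C * Real.exp (r / 2 * |(m : ℝ)|)) := by
    intro m
    refine tsub_le_self.trans ((hkC _).trans ((cut_le _ _).trans (le_of_eq ?_)))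
    rw [Pi.smul_apply, growth, smul_eq_mul, znorm_single, ENNReal.ofReal_mul hC.le]
  rcases S.harmonic_dichotomy hG0 hharm hGC with h0 | ⟨b, hb, hbG⟩
  · rw [← hsum]
    funext z
    rw [Pi.add_apply, h0, zero_add]
  · exfalso
    obtain ⟨D, hD, hexit⟩ := S.exists_exitPot_coordNeg_le
    have hD1 : 1 + D ≠ ⊤ := by finiteness
    have hD0 : 1 + D ≠ 0 := by simp
    have h1 : ∀ z ∈ half i, (b * (1 + D)⁻¹ + c) * h z ≤ k z := by
      intro z hz
      have hz1 : (1 : ℝ≥0∞) ≤ ENNReal.ofReal (z i) := by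
        rw [ENNReal.one_le_ofReal]; exact_mod_cast hz
      have h2 : h z ≤ (1 + D) * ENNReal.ofReal (z i) := by
        rw [hh, hfun_half, add_mul, one_mul]
        exact add_le_add le_rfl ((hexit _ subset_rfl z).trans (le_mul_of_one_le_right' hz1))
      have h3 : b * (1 + D)⁻¹ * h z ≤ G (z i) := by
        refine le_trans ?_ (hbG _ hz)
        rw [mul_assoc]
        refine mul_le_mul_right ?_ _
        refine (mul_le_mul_right h2 _).trans (le_of_eq ?_)
        rw [← mul_assoc, ENNReal.inv_mul_cancel hD0 hD1, one_mul]
      rw [add_mul]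
      refine (add_le_add h3 le_rfl).trans (le_of_eq ?_)
      exact congrFun hsum z
    have h2 : b * (1 + D)⁻¹ + c ≤ 0 + c := by
      rw [zero_add]
      refine hc_ge _ fun z hz => ?_
      rw [ENNReal.le_div_iff_mul_le (Or.inl (hh0 z hz)) (Or.inl (hht z))]
      exact h1 z hz
    have h3 := ENNReal.le_of_add_le_add_right hct h2
    exact mul_ne_zero hb (ENNReal.inv_ne_zero.mpr hD1) (le_antisymm h3 zero_le)

lemma pot_add {V : Type*} (L : Module.End ℝ≥0∞ (V → ℝ≥0∞)) (s t : V → ℝ≥0∞) :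
    pot L (s + t) = pot L s + pot L t := by
  funext x
  simp only [pot, map_add, Pi.add_apply, ENNReal.tsum_add]

/-- Decomposition of the half-space Green function at the exit from a smaller domain. -/
lemma Setup.pot_add_exitPot_greenHalf (S : Setup μ r i) {A : Set (Fin d → ℤ)} (hA : A ⊆ half i)
    {x y : Fin d → ℤ} (hx : x ∈ A) (hy : y ∈ A) :
    pot (stepK μ A) (Pi.single y 1) x + exitPot μ A (greenHalf μ i y) x = greenHalf μ i y x := by
  set g := greenHalf μ i y with hg
  obtain ⟨C, hC, hle⟩ := S.exists_pot_single_le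
  have hfix : stepK μ A (cut A g) + (exitK μ A g + Pi.single y 1) = cut A g := by
    funext w
    rw [stepK_cut, ← add_assoc, Pi.add_apply, Pi.add_apply]
    by_cases hw : w ∈ A
    · rw [stepK_add_exitK hw, cut_of_mem hw]
      have h1 := congrFun (stepK_greenHalf (μ := μ) (i := i) y) w
      rw [Pi.add_apply, ← hg] at h1
      rw [← h1, avg, stepK_apply (hA hw)]
      congr 1
      refine tsum_congr fun z => ?_
      split_ifs with hz
      · rfl
      · rw [hg, greenHalf_of_notMem (hA hy) hz]
    · rw [stepK_of_notMem hw, exitK_of_notMem hw, cut_of_notMem hw,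
        Pi.single_eq_of_ne (by rintro rfl; exact hw hy), add_zero, add_zero]
  have hlim : Tendsto (fun n => ((stepK μ A) ^ n) (cut A g) x) atTop (𝓝 0) := by
    have h1 := ENNReal.Tendsto.const_mul (a := C) (S.tendsto_pow_one hA x) (Or.inr hC)
    rw [mul_zero] at h1
    refine tendsto_of_tendsto_of_tendsto_of_le_of_le tendsto_const_nhds h1 (fun n => zero_le)
      fun n => ?_
    refine (((isKer_stepK μ A).pow n).mono (g := C • cut A 1) (fun w => ?_) x).trans (le_of_eq ?_)
    · by_cases hw : w ∈ A
      · rw [Pi.smul_apply, cut_of_mem hw, cut_of_mem hw, Pi.one_apply, smul_eq_mul, mul_one]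
        exact hle _ w y
      · rw [cut_of_notMem hw]; exact zero_le
    · rw [map_smul, Pi.smul_apply, smul_eq_mul]
  have h2 := add_pot_eq_of_tendsto hfix hlim
  rw [zero_add, pot_add, Pi.add_apply, cut_of_mem hx] at h2
  rw [add_comm]
  exact h2

variable {x : Fin d → ℤ} {xs : ℕ → Fin d → ℤ}

lemma Setup.exists_tendsto_pot_div (S : Setup μ r i) (P : Poles μ i x xs)
    (hxs : ∀ n, xs n ∈ posAll) (U : Ultrafilter ℕ) (hU : (U : Filter ℕ) ≤ atTop) :
    ∃ c : ℝ≥0∞, c ≠ 0 ∧ c ≠ ⊤ ∧ ∀ z ∈ posAll,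
      Tendsto (fun n => pot (stepK μ posAll) (Pi.single (xs n) 1) z / greenHalf μ i (xs n) x) U
        (𝓝 (c * hfun μ i posAll z)) := by
  have hA := posAll_subset_half (d := d) i
  obtain ⟨k, hk, hkx, hk0, hkc, hkK, hkg⟩ := S.exists_martin_limit P U hU
  obtain ⟨c, hct, hkh⟩ := S.eq_smul_hfun hk0 hkc hkK hkg
  refine ⟨c, ?_, hct, fun z hz => ?_⟩
  · rintro rfl
    rw [hkh, zero_smul] at hkx
    exact zero_ne_one hkx
  obtain ⟨ε, δ, hε, -, hexit⟩ := S.exists_exitPot_growth_le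
  obtain ⟨C, hC, hmar⟩ := S.exists_martin_le P hε
  have hbound : exitPot μ posAll (cut (half i) (ENNReal.ofReal C • growth ε)) z ≠ ⊤ := by
    have h1 : cut (half i) (ENNReal.ofReal C • growth ε) =
        ENNReal.ofReal C • cut (half i) (growth ε) := by
      funext w
      by_cases hw : w ∈ half i
      · simp only [Pi.smul_apply, cut_of_mem hw]
      · simp only [Pi.smul_apply, cut_of_notMem hw, smul_zero]
    rw [h1, exitPot_smul, Pi.smul_apply, smul_eq_mul]
    refine ENNReal.mul_ne_top ENNReal.ofReal_ne_top (ne_top_of_le_ne_top ?_ (hexit z))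
    exact ENNReal.sum_ne_top.mpr fun _ _ => ENNReal.ofReal_ne_top
  have hlim : Tendsto (fun n => exitPot μ posAll (martin μ i x (xs n)) z) U
      (𝓝 (exitPot μ posAll k z)) := by
    have hb := hbound
    rw [exitPot_eq_tsum] at hb
    rw [exitPot_eq_tsum]
    exact (tendsto_tsum_mul hk (hmar.filter_mono hU) hb).congr fun n =>
      (exitPot_eq_tsum _ _ z).symm
  have hkz : k z ≠ ⊤ := by
    rw [hkh, Pi.smul_apply, smul_eq_mul]
    exact ENNReal.mul_ne_top hct (S.hfun_ne_top subset_rfl z)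
  have hsplit : c * hfun μ i posAll z + exitPot μ posAll k z = k z := by
    have h1 := S.hfun_add_exitPot hA hz
    have h2 : cut (half i) (hfun μ i (half i)) = hfun μ i (half i) := by
      funext w
      by_cases hw : w ∈ half i
      · exact cut_of_mem hw _
      · rw [cut_of_notMem hw, S.hfun_half_of_notMem hw]
    rw [h2] at h1
    rw [hkh, exitPot_smul, Pi.smul_apply, Pi.smul_apply, smul_eq_mul, smul_eq_mul, ← mul_add, h1]
  have hsub : c * hfun μ i posAll z = k z - exitPot μ posAll k z := by
    refine ENNReal.eq_sub_of_add_eq ?_ hsplit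
    exact ne_top_of_le_ne_top hkz (hsplit ▸ le_add_self)
  rw [hsub]
  refine (ENNReal.Tendsto.sub (hk z) hlim (Or.inl hkz)).congr' ?_
  filter_upwards [P.eventually_pos.filter_mono hU] with n hn
  have hgt := S.greenHalf_ne_top (xs n) x
  have h3 : martin μ i x (xs n) = (greenHalf μ i (xs n) x)⁻¹ • greenHalf μ i (xs n) := by
    funext w
    rw [martin, Pi.smul_apply, smul_eq_mul, ENNReal.div_eq_inv_mul]
  have h4 := S.pot_add_exitPot_greenHalf hA hz (hxs n)
  have h5 : exitPot μ posAll (martin μ i x (xs n)) z ≠ ⊤ := by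
    rw [h3, exitPot_smul, Pi.smul_apply, smul_eq_mul]
    exact ENNReal.mul_ne_top (ENNReal.inv_ne_top.mpr hn)
      (ne_top_of_le_ne_top (S.greenHalf_ne_top (xs n) z) (h4 ▸ le_add_self))
  refine (ENNReal.eq_sub_of_add_eq h5 ?_).symm
  rw [h3, exitPot_smul, Pi.smul_apply, Pi.smul_apply, smul_eq_mul, smul_eq_mul,
    ENNReal.div_eq_inv_mul, ← mul_add, h4]

lemma Setup.tendsto_green_ratio (S : Setup μ r i) (P : Poles μ i x xs) (hx : x ∈ posAll)
    (hxs : ∀ n, xs n ∈ posAll) {z : Fin d → ℤ} (hz : z ∈ posAll) :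
    Tendsto (fun n => green μ posAll z (xs n) / green μ posAll x (xs n)) atTop
      (𝓝 (hM2 μ i z / hM2 μ i x)) := by
  have hA := posAll_subset_half (d := d) i
  rw [tendsto_iff_ultrafilter]
  intro U hU
  obtain ⟨c, hc0, hct, h⟩ := S.exists_tendsto_pot_div P hxs U hU
  have hreal : ∀ w ∈ posAll, Tendsto (fun n =>
      (pot (stepK μ posAll) (Pi.single (xs n) 1) w / greenHalf μ i (xs n) x).toReal) U
      (𝓝 (c.toReal * hM2 μ i w)) := by
    intro w hw
    rw [S.hM2_eq hw, ← ENNReal.toReal_mul]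
    exact (ENNReal.tendsto_toReal (ENNReal.mul_ne_top hct (S.hfun_ne_top hA w))).comp (h w hw)
  have hc : c.toReal ≠ 0 := ENNReal.toReal_ne_zero.mpr ⟨hc0, hct⟩
  have hMx : hM2 μ i x ≠ 0 := by
    rw [S.hM2_eq hx]
    exact ENNReal.toReal_ne_zero.mpr ⟨(S.hfun_pos hx).ne', S.hfun_ne_top hA x⟩
  have hdiv := (hreal z hz).div (hreal x hx) (mul_ne_zero hc hMx)
  rw [mul_div_mul_left _ _ hc] at hdiv
  refine hdiv.congr' ?_
  filter_upwards [P.eventually_pos.filter_mono hU] with n hn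
  have hg : (greenHalf μ i (xs n) x).toReal ≠ 0 :=
    ENNReal.toReal_ne_zero.mpr ⟨hn, S.greenHalf_ne_top _ _⟩
  rw [Pi.div_apply, green_eq S.nn S.sum (hxs n), green_eq S.nn S.sum (hxs n), ENNReal.toReal_div,
    ENNReal.toReal_div, div_div_div_cancel_right₀ hg]

lemma exists_setup (hnn : ∀ z, 0 ≤ μ z) (hsum : HasSum μ 1) (hA1 : A1 μ) (hA2 : A2 μ)
    (hA3 : A3 μ) (hM : ∀ i, 0 ≤ Mvec μ i) (hΛ : LambdaM μ = {i}) : ∃ r, Setup μ r i := by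
  obtain ⟨r, H⟩ := exists_expStep hnn hsum hA2
  have h0 : ∀ j, Mvec μ j = 0 ↔ j = i := fun j => Set.ext_iff.mp hΛ j
  refine ⟨r, H, hA1, (h0 i).mpr rfl,
    fun j hj => lt_of_le_of_ne (hM j) fun h => hj ((h0 j).mp h.symm), ?_⟩
  by_contra! hall
  exact hA3 (funext fun j => (h0 j).mpr (hall j))

lemma Setup.poles (S : Setup μ r i) (hx : x ∈ posAll) (hxs : ∀ n, xs n ∈ posAll)
    (htop : Tendsto (fun n => znorm (xs n)) atTop atTop)
    (hdir : Tendsto (fun n k => (xs n k : ℝ) / znorm (xs n)) atTop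
      (𝓝 (fun k => Mvec μ k / rnorm (Mvec μ)))) : Poles μ i x xs := by
  have hA := posAll_subset_half (d := d) i
  have hρ : 0 < rnorm (Mvec μ) := by
    obtain ⟨j, hj⟩ := S.nontriv
    exact Finset.sum_pos' (fun k _ => abs_nonneg _)
      ⟨j, Finset.mem_univ j, abs_pos.mpr (S.mean_pos j hj).ne'⟩
  exact ⟨hA hx, fun n => hA (hxs n), htop, fun ε hε => S.eventually_exp_le_greenHalf (hA hx)
    (fun n => hA (hxs n)) htop hρ (fun k => tendsto_pi_nhds.mp hdir k) hε⟩

end Conclusion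

end KilledWalk

theorem statement2 {d : ℕ} (μ : (Fin d → ℤ) → ℝ)
    (hnn : ∀ z, 0 ≤ μ z) (hsum : HasSum μ 1)
    (hA1 : A1 μ) (hA2 : A2 μ) (hA3 : A3 μ)
    (hM : ∀ i, 0 ≤ Mvec μ i) (i₀ : Fin d) (hΛ : LambdaM μ = {i₀})
    (x₀ : Fin d → ℤ) (hx₀ : x₀ ∈ posAll) :
    -- (i)
    ((∀ x ∈ posAll, 0 < hM2 μ i₀ x) ∧ HarmOn μ posAll (hM2 μ i₀)) ∧
    -- (ii)
    (∀ xs : ℕ → (Fin d → ℤ), (∀ n, xs n ∈ posAll) →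
      Tendsto (fun n => znorm (xs n)) atTop atTop →
      Tendsto (fun n i => (xs n i : ℝ) / znorm (xs n)) atTop
        (𝓝 (fun i => Mvec μ i / rnorm (Mvec μ))) →
      Fundamental μ posAll x₀ xs ∧
      ∀ x ∈ posAll,
        Tendsto (fun n => green μ posAll x (xs n) / green μ posAll x₀ (xs n)) atTop
          (𝓝 (hM2 μ i₀ x / hM2 μ i₀ x₀))) := by
  obtain ⟨r, S⟩ := KilledWalk.exists_setup hnn hsum hA1 hA2 hA3 hM hΛ
  refine ⟨⟨fun x hx => ?_, S.harmOn_hM2⟩, fun xs hxs htop hdir => ?_⟩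
  · rw [S.hM2_eq hx]
    exact ENNReal.toReal_pos (S.hfun_pos hx).ne'
      (S.hfun_ne_top (KilledWalk.posAll_subset_half i₀) x)
  · have P := S.poles hx₀ hxs htop hdir
    exact ⟨fun x hx => ⟨_, S.tendsto_green_ratio P hx₀ hxs hx⟩,
      fun x hx => S.tendsto_green_ratio P hx₀ hxs hx⟩
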